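/- Let 0 < γ₁, γ₂, γ₃ ≤ 1 and 0 < δ₁, δ₃ < 1 satisfy: (γ₁+γ₂)/2 + δ₁/40 > 1; (γ₁+γ₂)/2 + δ₃/3 > 1; 73(1−γᵢ) + 86δ₁ < 9 for i = 1, 2; and 1714(1−γ₃) + 1725δ₃ < 46. Then for every B > 0 there is a constant C(B) such that, for all sufficiently large integers N, |∫₀¹ T_{1,1}(N,α) T_{1,2}(N,α) T₃(N,α) e(−Nα) dα − ∫₀¹ S₁(N,α)² S₃(N,α) e(−Nα) dα| ≤ C(B) · N^{4/3} (log N)^{−B}. -/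

import Mathlib

open scoped Classical

/-- `e(x) = exp(2πix)`. -/
noncomputable def eexp (x : ℝ) : ℂ := Complex.exp (2 * Real.pi * Complex.I * x)

/-- The Piatetski-Shapiro prime set `𝒫_γ = {p prime : p = ⌊n^{1/γ}⌋ for some n ∈ ℕ, n ≥ 1}`. -/
def PiatetskiShapiroSet (γ : ℝ) : Set ℕ :=
  {p | Nat.Prime p ∧ ∃ n : ℕ, 0 < n ∧ p = ⌊(n : ℝ) ^ ((1 : ℝ) / γ)⌋₊}

/-- `S₁(N,α) = Σ_{p ≤ N, p prime} e(αp)`. -/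
noncomputable def S₁ (N : ℕ) (α : ℝ) : ℂ :=
  ∑ p ∈ (Finset.range (N + 1)).filter (fun p => Nat.Prime p), eexp (α * (p : ℝ))

/-- `S₃(N,α) = Σ_{p ≤ N^{1/3}, p prime} e(αp³)`. -/
noncomputable def S₃ (N : ℕ) (α : ℝ) : ℂ :=
  ∑ p ∈ (Finset.range (N + 1)).filter
      (fun p => Nat.Prime p ∧ (p : ℝ) ≤ (N : ℝ) ^ ((1 : ℝ) / 3)),
    eexp (α * (p : ℝ) ^ 3)

/-- `T₁(γ;N,α) = γ⁻¹ Σ_{p ≤ N, p ∈ 𝒫_γ} p^{1-γ} e(αp)`. -/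
noncomputable def T₁ (γ : ℝ) (N : ℕ) (α : ℝ) : ℂ :=
  (γ⁻¹ : ℝ) * ∑ p ∈ (Finset.range (N + 1)).filter (fun p => p ∈ PiatetskiShapiroSet γ),
    (((p : ℝ) ^ (1 - γ) : ℝ) : ℂ) * eexp (α * (p : ℝ))

/-- `T₃(γ;N,α) = γ⁻¹ Σ_{p ≤ N^{1/3}, p ∈ 𝒫_γ} p^{1-γ} e(αp³)`. -/
noncomputable def T₃ (γ : ℝ) (N : ℕ) (α : ℝ) : ℂ :=
  (γ⁻¹ : ℝ) * ∑ p ∈ (Finset.range (N + 1)).filter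
      (fun p => p ∈ PiatetskiShapiroSet γ ∧ (p : ℝ) ≤ (N : ℝ) ^ ((1 : ℝ) / 3)),
    (((p : ℝ) ^ (1 - γ) : ℝ) : ℂ) * eexp (α * (p : ℝ) ^ 3)



lemma eexp_add (x y : ℝ) : eexp (x + y) = eexp x * eexp y := by
  unfold eexp; rw [← Complex.exp_add]; congr 1; push_cast; ring

lemma norm_eexp (x : ℝ) : ‖eexp x‖ = 1 := by
  unfold eexp
  have : (2 * Real.pi * Complex.I * x : ℂ) = ((2 * Real.pi * x : ℝ) : ℂ) * Complex.I := by
    push_cast; ring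
  rw [this, Complex.norm_exp_ofReal_mul_I]

lemma eexp_zero : eexp 0 = 1 := by simp [eexp]

lemma conj_eexp (x : ℝ) : (starRingEnd ℂ) (eexp x) = eexp (-x) := by
  unfold eexp
  rw [← Complex.exp_conj]; congr 1
  simp [Complex.conj_ofNat]

lemma eexp_sub (x y : ℝ) : eexp (x - y) = eexp x * (starRingEnd ℂ) (eexp y) := by
  rw [conj_eexp, ← eexp_add, sub_eq_add_neg]

lemma eexp_int (n : ℤ) : eexp n = 1 := by
  unfold eexp
  rw [Complex.exp_eq_one_iff]; exact ⟨n, by push_cast; ring⟩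

lemma norm_eexp_sub_one (x : ℝ) : ‖eexp x - 1‖ = 2 * |Real.sin (Real.pi * x)| := by
  have := Complex.norm_exp_I_mul_ofReal_sub_one (2 * Real.pi * x)
  have h : eexp x = Complex.exp (Complex.I * ((2 * Real.pi * x : ℝ) : ℂ)) := by
    unfold eexp; congr 1; push_cast; ring
  rw [h, this, norm_mul]
  simp
  congr 2; ring

lemma norm_eexp_sub_eexp_le (x y : ℝ) : ‖eexp x - eexp y‖ ≤ 2 * Real.pi * |x - y| := by
  have h1 : eexp x - eexp y = eexp y * (eexp (x - y) - 1) := by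
    rw [mul_sub, ← eexp_add]; ring_nf
  rw [h1, norm_mul, norm_eexp, one_mul, norm_eexp_sub_one]
  have := Real.abs_sin_le_abs (x := Real.pi * (x - y))
  rw [abs_mul, abs_of_pos Real.pi_pos] at this
  linarith

lemma norm_eexp_sub_one_ge {x : ℝ} (h0 : 0 ≤ x) (h1 : x ≤ 1 / 2) : 4 * x ≤ ‖eexp x - 1‖ := by
  rw [norm_eexp_sub_one]
  have := Real.mul_le_sin (x := Real.pi * x) (by positivity) (by nlinarith [Real.pi_pos])
  have h2 : 2 / Real.pi * (Real.pi * x) = 2 * x := by field_simp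
  rw [h2] at this
  have := le_abs_self (Real.sin (Real.pi * x))
  linarith

/-- Kusmin-Landau inequality. -/
lemma kusmin_landau (f : ℕ → ℝ) (K : ℕ) (κ : ℝ) (hκ : 0 < κ)
    (h1 : ∀ n ≤ K, κ ≤ f (n + 1) - f n) (h2 : ∀ n ≤ K, f (n + 1) - f n ≤ 1 / 2)
    (h3 : ∀ n < K, f (n + 2) - f (n + 1) ≤ f (n + 1) - f n) :
    ‖∑ n ∈ Finset.range K, eexp (f n)‖ ≤ 1 / κ := by
  set d : ℕ → ℝ := fun n => f (n + 1) - f n with hd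
  set c : ℕ → ℂ := fun n => 1 / (eexp (d n) - 1) with hc
  have hlow : ∀ n ≤ K, 4 * d n ≤ ‖eexp (d n) - 1‖ := fun n hn =>
    norm_eexp_sub_one_ge (le_trans hκ.le (h1 n hn)) (h2 n hn)
  have hdpos : ∀ n ≤ K, 0 < d n := fun n hn => lt_of_lt_of_le hκ (h1 n hn)
  have hne : ∀ n ≤ K, eexp (d n) - 1 ≠ 0 := fun n hn => by
    rw [← norm_pos_iff]; linarith [hlow n hn, hdpos n hn]
  have hcn : ∀ n ≤ K, ‖c n‖ ≤ 1 / (4 * d n) := fun n hn => by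
    rw [hc]; simp only [norm_div, norm_one]
    exact one_div_le_one_div_of_le (by linarith [hdpos n hn]) (hlow n hn)
  have hcd : ∀ n < K, ‖c n - c (n + 1)‖ ≤ Real.pi / 8 * (1 / d (n + 1) - 1 / d n) := fun n hn => by
    have e1 := hne n hn.le
    have e2 := hne (n + 1) hn
    have p1 := hdpos n hn.le
    have p2 := hdpos (n + 1) hn
    have : c n - c (n + 1) = (eexp (d (n + 1)) - eexp (d n)) / ((eexp (d n) - 1) * (eexp (d (n + 1)) - 1)) := by
      rw [hc]; field_simp; ring
    rw [this, norm_div, norm_mul]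
    have h4 := norm_eexp_sub_eexp_le (d (n + 1)) (d n)
    have h5 : |d (n + 1) - d n| = d n - d (n + 1) := by
      rw [abs_sub_comm, abs_of_nonneg]; have := h3 n hn; simp only [hd]; ring_nf at this ⊢; linarith
    rw [h5] at h4
    calc _ ≤ (2 * Real.pi * (d n - d (n + 1))) / ((4 * d n) * (4 * d (n + 1))) := by
          apply div_le_div₀ (le_trans (norm_nonneg _) h4) h4 (by positivity)
          exact mul_le_mul (hlow n hn.le) (hlow (n + 1) hn) (by positivity) (norm_nonneg _)
      _ = _ := by field_simp; ring
  have hterm : ∀ n ≤ K, eexp (f n) = (eexp (f (n + 1)) - eexp (f n)) * c n := fun n hn => by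
    have e1 := hne n hn
    have : eexp (f (n + 1)) = eexp (f n) * eexp (d n) := by rw [← eexp_add]; simp [hd]
    rw [this, hc]; field_simp
  have key : ∀ k ≤ K, ‖∑ n ∈ Finset.range k, eexp (f n) - eexp (f k) * c k‖ ≤
      ‖c 0‖ + Real.pi / 8 * (1 / d k - 1 / d 0) := by
    intro k
    induction k with
    | zero => intro _; simp [norm_eexp]
    | succ k ih =>
      intro hk
      have ih := ih (by omega)
      rw [Finset.sum_range_succ]
      have hh : ∑ n ∈ Finset.range k, eexp (f n) + eexp (f k) - eexp (f (k + 1)) * c (k + 1)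
        = (∑ n ∈ Finset.range k, eexp (f n) - eexp (f k) * c k) + eexp (f (k + 1)) * (c k - c (k + 1)) := by
        have := hterm k (by omega)
        linear_combination this
      rw [hh]
      refine (norm_add_le _ _).trans ?_
      rw [norm_mul, norm_eexp, one_mul]
      linarith [hcd k (by omega)]
  have hk := key K le_rfl
  have h6 : ‖∑ n ∈ Finset.range K, eexp (f n)‖ ≤ ‖∑ n ∈ Finset.range K, eexp (f n) - eexp (f K) * c K‖ + ‖c K‖ := by
    have := norm_add_le (∑ n ∈ Finset.range K, eexp (f n) - eexp (f K) * c K) (eexp (f K) * c K)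
    rw [norm_mul, norm_eexp, one_mul] at this
    simpa using this
  have b1 : ∀ n ≤ K, 1 / d n ≤ 1 / κ := fun n hn => one_div_le_one_div_of_le hκ (h1 n hn)
  have b2 := hcn 0 (Nat.zero_le _)
  have b3 := hcn K le_rfl
  have b4 : 1 / (4 * d 0) = (1 / d 0) / 4 := by field_simp
  have b5 : 1 / (4 * d K) = (1 / d K) / 4 := by field_simp
  have b6 : 0 < 1 / d 0 := by have := hdpos 0 (Nat.zero_le _); positivity
  have b7 := b1 0 (Nat.zero_le _)
  have b8 := b1 K le_rfl
  have b9 : Real.pi / 8 * (1 / d K - 1 / d 0) ≤ Real.pi / 8 * (1 / κ) := by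
    apply mul_le_mul_of_nonneg_left _ (by positivity); linarith
  have b10 : Real.pi / 8 * (1 / κ) ≤ 1 / 2 * (1 / κ) := by
    apply mul_le_mul_of_nonneg_right _ (by positivity); linarith [Real.pi_le_four]
  linarith

/-- van der Corput inequality. -/
lemma vdc_ineq (z : ℕ → ℂ) (hz : ∀ n, ‖z n‖ ≤ 1) (K H : ℕ) (hH : 1 ≤ H) :
    (H : ℝ) * ‖∑ n ∈ Finset.range K, z n‖ ^ 2 ≤ ((K : ℝ) + H) *
      (K + 2 * ∑ q ∈ Finset.Ico 1 H, ‖∑ m ∈ Finset.range (K - q), z (m + q) * (starRingEnd ℂ) (z m)‖) := by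
  set w : ℕ → ℕ → ℂ := fun n r => if r ≤ n ∧ n - r < K then z (n - r) else 0 with hw
  set C : ℕ → ℝ := fun q => ‖∑ m ∈ Finset.range (K - q), z (m + q) * (starRingEnd ℂ) (z m)‖ with hC
  have hshift : ∀ (F : ℕ → ℂ) (r L : ℕ), r + L ≤ K + H → 
      ∑ n ∈ Finset.range (K + H), (if r ≤ n ∧ n - r < L then F (n - r) else 0) =
        ∑ m ∈ Finset.range L, F m := by
    intro F r L hr
    rw [← Finset.sum_filter]
    symm
    apply Finset.sum_nbij' (fun m => m + r) (fun n => n - r)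
    · intro m hm; simp at hm ⊢; omega
    · intro m hm; simp at hm ⊢; omega
    · intro m hm; simp
    · intro m hm; simp at hm ⊢; omega
    · intro m hm; simp
  have h1 : (H : ℂ) * ∑ n ∈ Finset.range K, z n = ∑ n ∈ Finset.range (K + H), ∑ r ∈ Finset.range H, w n r := by
    rw [Finset.sum_comm]
    rw [Finset.sum_congr rfl (fun r hr => hshift z r K (by simp at hr; omega))]
    simp
  have h2 : ((H : ℝ) * ‖∑ n ∈ Finset.range K, z n‖) ^ 2 ≤
      ((K : ℝ) + H) * ∑ n ∈ Finset.range (K + H), ‖∑ r ∈ Finset.range H, w n r‖ ^ 2 := by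
    have : (H : ℝ) * ‖∑ n ∈ Finset.range K, z n‖ = ‖∑ n ∈ Finset.range (K + H), ∑ r ∈ Finset.range H, w n r‖ := by
      rw [← h1, norm_mul]; simp
    rw [this]
    have a1 : ‖∑ n ∈ Finset.range (K + H), ∑ r ∈ Finset.range H, w n r‖ ^ 2 ≤
      (∑ n ∈ Finset.range (K + H), ‖∑ r ∈ Finset.range H, w n r‖) ^ 2 :=
      pow_le_pow_left₀ (norm_nonneg _) (norm_sum_le _ _) 2
    refine a1.trans ?_
    have := sq_sum_le_card_mul_sum_sq (s := Finset.range (K + H)) (f := fun n => ‖∑ r ∈ Finset.range H, w n r‖)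
    simpa using this
  have hcorr : ∀ r s, s ≤ r → r < H → ‖∑ n ∈ Finset.range (K + H), w n r * (starRingEnd ℂ) (w n s)‖ = C (r - s) := by
    intro r s hsr hr
    have e1 : ∀ n ∈ Finset.range (K + H), w n r * (starRingEnd ℂ) (w n s) =
        if r ≤ n ∧ n - r < K - (r - s) then (fun m => (starRingEnd ℂ) (z (m + (r - s))) * z m) (n - r) else 0 := by
      intro n _
      simp only [hw]
      by_cases h : r ≤ n ∧ n - r < K - (r - s)
      · rw [if_pos h, if_pos (by omega), if_pos (by omega)]
        have : n - r + (r - s) = n - s := by omega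
        rw [this, mul_comm]
      · rw [if_neg h]
        by_cases h' : r ≤ n ∧ n - r < K
        · rw [if_neg (c := s ≤ n ∧ n - s < K) (by omega)]; simp
        · rw [if_neg h']; simp
    rw [Finset.sum_congr rfl e1, hshift (fun m => (starRingEnd ℂ) (z (m + (r - s))) * z m) r (K - (r - s)) (by omega)]
    rw [hC]; simp only
    rw [← Complex.norm_conj]
    congr 1
    rw [map_sum]
    apply Finset.sum_congr rfl
    intro m _
    simp
  have hcorr' : ∀ r ∈ Finset.range H, ∀ s ∈ Finset.range H, 
      ‖∑ n ∈ Finset.range (K + H), w n r * (starRingEnd ℂ) (w n s)‖ ≤ C ((r - s) + (s - r)) := by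
    intro r hr s hs
    simp at hr hs
    rcases le_total s r with h | h
    · rw [hcorr r s h hr]; rw [show s - r = 0 by omega]; simp
    · have := hcorr s r h hs
      rw [show r - s = 0 by omega, zero_add, ← this, ← Complex.norm_conj]
      apply le_of_eq; congr 1
      rw [map_sum]; apply Finset.sum_congr rfl; intro n _; simp [mul_comm]
  have hC0 : C 0 ≤ K := by
    simp only [hC]
    refine (norm_sum_le _ _).trans ?_
    refine (Finset.sum_le_sum (g := fun _ => (1 : ℝ)) ?_).trans (by simp)
    intro m _
    simp only [norm_mul, RCLike.norm_conj]
    have := hz (m + 0); have := hz m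
    exact mul_le_one₀ (hz _) (norm_nonneg _) (hz _)
  have hCn : ∀ q, 0 ≤ C q := fun q => norm_nonneg _
  have hrow : ∀ r ∈ Finset.range H, ∑ s ∈ Finset.range H, C ((r - s) + (s - r)) ≤ K + 2 * ∑ q ∈ Finset.Ico 1 H, C q := by
    intro r hr
    simp at hr
    have e1 : Finset.range H = Finset.Ico 0 r ∪ ({r} ∪ Finset.Ico (r + 1) H) := by ext x; simp; omega
    have d1 : Disjoint (Finset.Ico 0 r) ({r} ∪ Finset.Ico (r + 1) H) := by
      rw [Finset.disjoint_left]; intro x; simp; omega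
    have d2 : Disjoint ({r} : Finset ℕ) (Finset.Ico (r + 1) H) := by
      rw [Finset.disjoint_left]; intro x; simp; omega
    rw [e1, Finset.sum_union d1, Finset.sum_union d2, Finset.sum_singleton]
    have i1 : ∑ s ∈ Finset.Ico 0 r, C ((r - s) + (s - r)) ≤ ∑ q ∈ Finset.Ico 1 H, C q := by
      rw [← Finset.sum_image (f := C) (g := fun s => (r - s) + (s - r))]
      · apply Finset.sum_le_sum_of_subset_of_nonneg
        · intro x; simp; intro y hy h; omega
        · intro _ _ _; exact hCn _
      · intro x hx y hy; simp at hx hy ⊢; omega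
    have i2 : ∑ s ∈ Finset.Ico (r + 1) H, C ((r - s) + (s - r)) ≤ ∑ q ∈ Finset.Ico 1 H, C q := by
      rw [← Finset.sum_image (f := C) (g := fun s => (r - s) + (s - r))]
      · apply Finset.sum_le_sum_of_subset_of_nonneg
        · intro x; simp; intro y hy h; omega
        · intro _ _ _; exact hCn _
      · intro x hx y hy; simp at hx hy ⊢; omega
    simp only [Nat.sub_self, Nat.add_zero] 
    linarith
  have h3 : ∑ n ∈ Finset.range (K + H), ‖∑ r ∈ Finset.range H, w n r‖ ^ 2 ≤
      H * (K + 2 * ∑ q ∈ Finset.Ico 1 H, C q) := by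
    have e1 : ((∑ n ∈ Finset.range (K + H), ‖∑ r ∈ Finset.range H, w n r‖ ^ 2 : ℝ) : ℂ) =
        ∑ r ∈ Finset.range H, ∑ s ∈ Finset.range H, ∑ n ∈ Finset.range (K + H), w n r * (starRingEnd ℂ) (w n s) := by
      push_cast
      rw [Finset.sum_congr rfl (fun r _ => Finset.sum_comm), Finset.sum_comm]
      apply Finset.sum_congr rfl
      intro n _
      rw [← Complex.mul_conj', map_sum, Finset.sum_mul_sum]
    have e2 : ∑ n ∈ Finset.range (K + H), ‖∑ r ∈ Finset.range H, w n r‖ ^ 2 = ‖((∑ n ∈ Finset.range (K + H), ‖∑ r ∈ Finset.range H, w n r‖ ^ 2 : ℝ) : ℂ)‖ := by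
      rw [Complex.norm_real, Real.norm_of_nonneg]; exact Finset.sum_nonneg (fun _ _ => by positivity)
    rw [e2, e1]
    refine (norm_sum_le _ _).trans ?_
    calc _ ≤ ∑ r ∈ Finset.range H, (K + 2 * ∑ q ∈ Finset.Ico 1 H, C q) := by
          apply Finset.sum_le_sum; intro r hr
          refine (norm_sum_le _ _).trans (le_trans ?_ (hrow r hr))
          exact Finset.sum_le_sum (fun s hs => hcorr' r hr s hs)
      _ = _ := by simp; ring
  have hHp : (0 : ℝ) < H := by exact_mod_cast hH
  have h4 := h2.trans (mul_le_mul_of_nonneg_left h3 (by positivity))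
  have h5 : (H : ℝ) * (H * ‖∑ n ∈ Finset.range K, z n‖ ^ 2) ≤ H * (((K : ℝ) + H) * (K + 2 * ∑ q ∈ Finset.Ico 1 H, C q)) := by
    calc _ = ((H : ℝ) * ‖∑ n ∈ Finset.range K, z n‖) ^ 2 := by ring
      _ ≤ _ := h4
      _ = _ := by ring
  exact le_of_mul_le_mul_left h5 hHp


/-- Iterated forward differences. -/
noncomputable def iterDiff : List ℕ → (ℝ → ℝ) → ℝ → ℝ
  | [], f, x => f x
  | q :: qs, f, x => iterDiff qs (fun y => f (y + q) - f y) x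

lemma iterDiff_neg (qs : List ℕ) : ∀ (f : ℝ → ℝ) (x : ℝ),
    iterDiff qs (fun y => - f y) x = - iterDiff qs f x := by
  induction qs with
  | nil => intro f x; simp [iterDiff]
  | cons q qs ih =>
    intro f x
    simp only [iterDiff]
    rw [← ih]
    congr 1; funext y; ring

lemma iterDiff_le (qs : List ℕ) : ∀ (F : ℕ → ℝ → ℝ) (a b hi : ℝ),
    (∀ i < qs.length, ∀ x ∈ Set.Icc a b, HasDerivAt (F i) (F (i + 1) x) x) →
    (∀ x ∈ Set.Icc a b, F qs.length x ≤ hi) →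
    ∀ x, a ≤ x → x + (qs.sum : ℕ) ≤ b → iterDiff qs (F 0) x ≤ (qs.prod : ℕ) * hi := by
  induction qs with
  | nil => intro F a b hi _ h x h1 h2; simp [iterDiff] at *; exact h x h1 h2
  | cons q qs ih =>
    intro F a b hi hd hh x h1 h2
    simp only [iterDiff]
    have hs : (q : ℝ) + (qs.sum : ℕ) = ((q :: qs).sum : ℕ) := by simp
    have := ih (fun i y => F i (y + q) - F i y) a (b - q) (q * hi) ?_ ?_ x h1 (by linarith)
    · refine this.trans (le_of_eq ?_)
      simp; ring
    · intro i hi' y hy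
      have q0 : (0:ℝ) ≤ q := Nat.cast_nonneg q
      have d1 := hd i (by simp; omega) y ⟨hy.1, by linarith [hy.2]⟩
      have d2 := hd i (by simp; omega) (y + q) ⟨by linarith [hy.1], by linarith [hy.2]⟩
      exact (d2.comp_add_const y (q:ℝ)).sub d1
    · intro y hy
      have q0 : (0:ℝ) ≤ q := Nat.cast_nonneg q
      have hdd : ∀ z ∈ Set.Icc y (y + q), HasDerivAt (F qs.length) (F (qs.length + 1) z) z :=
        fun z hz => hd _ (by simp) z ⟨by linarith [hy.1, hz.1], by linarith [hy.2, hz.2]⟩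
      have := (convex_Icc y (y + q)).image_sub_le_mul_sub_of_deriv_le (f := F qs.length) (C := hi)
        (fun z hz => (hdd z hz).continuousAt.continuousWithinAt)
        (fun z hz => ((hdd z (interior_subset hz)).differentiableAt).differentiableWithinAt)
        (fun z hz => by
          rw [(hdd z (interior_subset hz)).deriv]
          have hz' := interior_subset hz
          exact hh z ⟨by linarith [hy.1, hz'.1], by linarith [hy.2, hz'.2]⟩)
        y ⟨le_rfl, by linarith⟩ (y + q) ⟨by linarith, le_rfl⟩ (by linarith)

      linarith

lemma le_iterDiff (qs : List ℕ) (F : ℕ → ℝ → ℝ) (a b lo : ℝ)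
    (hd : ∀ i < qs.length, ∀ x ∈ Set.Icc a b, HasDerivAt (F i) (F (i + 1) x) x)
    (hh : ∀ x ∈ Set.Icc a b, lo ≤ F qs.length x) (x : ℝ) (h1 : a ≤ x) (h2 : x + (qs.sum : ℕ) ≤ b) :
    (qs.prod : ℕ) * lo ≤ iterDiff qs (F 0) x := by
  have := iterDiff_le qs (fun i y => - F i y) a b (-lo) (fun i hi x hx => (hd i hi x hx).neg)
    (fun x hx => by simpa using hh x hx) x h1 h2
  rw [iterDiff_neg] at this
  linarith

/-- Normalised exponential sum. -/
noncomputable def nsum (M : ℕ) (g : ℝ → ℝ) (A : ℝ) (K : ℕ) : ℝ :=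
  ‖∑ n ∈ Finset.range K, eexp (g (A + n))‖ / M

lemma nsum_nonneg (M : ℕ) (g : ℝ → ℝ) (A : ℝ) (K : ℕ) : 0 ≤ nsum M g A K := by
  unfold nsum; positivity

lemma nsum_le_one (M : ℕ) (g : ℝ → ℝ) (A : ℝ) (K : ℕ) (hK : K ≤ M) : nsum M g A K ≤ 1 := by
  unfold nsum
  apply div_le_one_of_le₀ _ (by positivity)
  refine (norm_sum_le _ _).trans ?_
  simp [norm_eexp]; exact hK

lemma vdc_step (M : ℕ) (g : ℝ → ℝ) (A : ℝ) (K H : ℕ) (hK : K ≤ M) (hH : 1 ≤ H) (hHM : H ≤ M) :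
    nsum M g A K ^ 2 ≤ 2 / H + 4 / H * ∑ q ∈ Finset.Ico 1 H, nsum M (fun y => g (y + q) - g y) A (K - q) := by
  have h := vdc_ineq (fun n => eexp (g (A + n))) (fun n => (norm_eexp _).le) K H hH
  have e : ∀ q ∈ Finset.Ico 1 H, ‖∑ m ∈ Finset.range (K - q), eexp (g (A + ((m + q : ℕ) : ℝ))) * (starRingEnd ℂ) (eexp (g (A + m)))‖
      = M * nsum M (fun y => g (y + q) - g y) A (K - q) := by
    intro q _
    unfold nsum
    have : (M : ℝ) ≠ 0 := by have : 0 < M := by omega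
                             positivity
    field_simp
    congr 1
    apply Finset.sum_congr rfl
    intro m _
    rw [eexp_sub]; congr 3; push_cast; ring

  rw [Finset.sum_congr rfl e, ← Finset.mul_sum] at h
  set s := ∑ q ∈ Finset.Ico 1 H, nsum M (fun y => g (y + q) - g y) A (K - q) with hs
  have hs0 : 0 ≤ s := Finset.sum_nonneg (fun _ _ => nsum_nonneg _ _ _ _)
  have hM : (0 : ℝ) < M := by have : 0 < M := by omega
                              positivity
  have hHp : (0 : ℝ) < H := by positivity
  have hK' : (K : ℝ) ≤ M := by exact_mod_cast hK
  have hH' : (H : ℝ) ≤ M := by exact_mod_cast hHM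
  have h2 : (H : ℝ) * ‖∑ n ∈ Finset.range K, eexp (g (A + n))‖ ^ 2 ≤ (2 * M) * (M + 2 * (M * s)) := by
    refine h.trans ?_
    apply mul_le_mul (by linarith) (by linarith) (by positivity) (by positivity)
  unfold nsum
  rw [div_pow, div_le_iff₀ (by positivity)]
  have : (2 / (H:ℝ) + 4 / H * s) * M ^ 2 = ((2 * M) * (M + 2 * (M * s))) / H := by field_simp; ring
  rw [this, le_div_iff₀ hHp]; linarith

lemma sum_inv_le (H M : ℕ) (hH : H ≤ M) (hM : 1 ≤ M) :
    ∑ q ∈ Finset.Ico 1 H, (1 : ℝ) / q ≤ 1 + Real.log M := by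
  have h1 : ∑ q ∈ Finset.Ico 1 H, (1 : ℝ) / q ≤ ∑ q ∈ Finset.Icc 1 M, (1 : ℝ) / q := by
    apply Finset.sum_le_sum_of_subset_of_nonneg
    · intro x; simp; omega
    · intro _ _ _; positivity
  refine h1.trans ?_
  have := harmonic_le_one_add_log M
  rw [harmonic_eq_sum_Icc] at this
  push_cast at this
  simpa using this

lemma sq_sum_step (x s H : ℝ) (hH : 0 < H) (T : Finset ℕ) (hT : (T.card : ℝ) ≤ H) (f : ℕ → ℝ) (a : ℝ) (ha : 0 ≤ a)
    (hx : 0 ≤ x) (hf : ∀ q ∈ T, 0 ≤ f q) (h : x ≤ a + s / H * ∑ q ∈ T, f q) (hs : 0 ≤ s) :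
    x ^ 2 ≤ 2 * a ^ 2 + 2 * s ^ 2 / H * ∑ q ∈ T, f q ^ 2 := by
  have h1 : (∑ q ∈ T, f q) ^ 2 ≤ H * ∑ q ∈ T, f q ^ 2 := by
    refine (sq_sum_le_card_mul_sum_sq).trans ?_
    apply mul_le_mul_of_nonneg_right hT
    exact Finset.sum_nonneg (fun _ _ => by positivity)
  have h2 : x ^ 2 ≤ (a + s / H * ∑ q ∈ T, f q) ^ 2 := pow_le_pow_left₀ hx h 2
  have h3 : (a + s / H * ∑ q ∈ T, f q) ^ 2 ≤ 2 * a ^ 2 + 2 * (s / H * ∑ q ∈ T, f q) ^ 2 := by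
    nlinarith [sq_nonneg (a - s / H * ∑ q ∈ T, f q)]
  have h4 : (s / H * ∑ q ∈ T, f q) ^ 2 ≤ s ^ 2 / H * ∑ q ∈ T, f q ^ 2 := by
    rw [mul_pow]
    calc _ ≤ (s / H) ^ 2 * (H * ∑ q ∈ T, f q ^ 2) := mul_le_mul_of_nonneg_left h1 (by positivity)
      _ = _ := by field_simp
  have : 2 * s ^ 2 / H * ∑ q ∈ T, f q ^ 2 = 2 * (s ^ 2 / H * ∑ q ∈ T, f q ^ 2) := by ring
  linarith

lemma avg_le (H : ℕ) (hH : 1 ≤ H) (f : ℕ → ℝ) (a b L : ℝ) (ha : 0 ≤ a) (hb : 0 ≤ b)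
    (hL : ∑ q ∈ Finset.Ico 1 H, (1 : ℝ) / q ≤ L)
    (h : ∀ q ∈ Finset.Ico 1 H, f q ≤ a + b / q) :
    1 / (H : ℝ) * ∑ q ∈ Finset.Ico 1 H, f q ≤ a + b * L / H := by
  have hHp : (0 : ℝ) < H := by positivity
  have h1 : ∑ q ∈ Finset.Ico 1 H, f q ≤ H * a + b * L := by
    calc _ ≤ ∑ q ∈ Finset.Ico 1 H, (a + b * (1 / q)) := Finset.sum_le_sum (fun q hq => by
            have := h q hq; rw [mul_one_div]; exact this)
      _ = (H - 1 : ℕ) * a + b * ∑ q ∈ Finset.Ico 1 H, (1 : ℝ) / q := by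
          rw [Finset.sum_add_distrib, ← Finset.mul_sum]; simp
      _ ≤ _ := by
        have : ((H - 1 : ℕ) : ℝ) ≤ H := by exact_mod_cast Nat.sub_le _ _
        have := mul_le_mul_of_nonneg_right this ha
        have := mul_le_mul_of_nonneg_left hL hb
        linarith
  calc _ ≤ 1 / (H:ℝ) * (H * a + b * L) := mul_le_mul_of_nonneg_left h1 (by positivity)
    _ = _ := by field_simp

/-- Core of the fourth derivative test with a parameter `H`. -/
lemma fourth_core (F : ℕ → ℝ → ℝ) (A : ℝ) (K M H : ℕ) (lam C : ℝ) (hl : 0 < lam)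
    (hK : K ≤ M) (hH : 1 ≤ H) (hHM : H ≤ M)
    (hd : ∀ i < 5, ∀ x ∈ Set.Icc A (A + 3 * M), HasDerivAt (F i) (F (i + 1) x) x)
    (h4 : ∀ x ∈ Set.Icc A (A + 3 * M), lam ≤ F 4 x) (h4' : ∀ x ∈ Set.Icc A (A + 3 * M), F 4 x ≤ C * lam)
    (h5 : ∀ x ∈ Set.Icc A (A + 3 * M), F 5 x ≤ 0) (hHs : C * lam * H ^ 2 * M ≤ 1 / 2) :
    nsum M (F 0) A K ^ 8 ≤ 128 / (H:ℝ) ^ 4 + 2048 * (8 / (H:ℝ) ^ 2 + 64 / M) +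
      2048 * 128 * (1 + Real.log M) ^ 3 / (H ^ 2 * M ^ 2 * lam) := by
  have hM1 : 1 ≤ M := hH.trans hHM
  have hMp : (0:ℝ) < M := by positivity
  have hHp : (0:ℝ) < H := by positivity
  have hM1' : (1:ℝ) ≤ M := by exact_mod_cast hM1
  set L := 1 + Real.log M with hL
  have hL1 : 1 ≤ L := by have := Real.log_nonneg hM1'; linarith
  have hCl : 0 < C * lam := lt_of_lt_of_le hl ((h4 A ⟨le_rfl, by linarith⟩).trans (h4' A ⟨le_rfl, by linarith⟩))
  have lev3 : ∀ q1 ∈ Finset.Ico 1 H, ∀ q2 ∈ Finset.Ico 1 H, ∀ q3 ∈ Finset.Ico 1 M,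
      nsum M (iterDiff [q1, q2, q3] (F 0)) A (K - q1 - q2 - q3) ≤ 1 / (M * lam * q1 * q2) / q3 := by
    intro q1 hq1 q2 hq2 q3 hq3
    simp at hq1 hq2 hq3
    rcases Nat.eq_zero_or_pos (K - q1 - q2 - q3) with h0 | h0
    · rw [h0]; unfold nsum; simp; positivity
    have p1 : (0:ℝ) < q1 := by exact_mod_cast hq1.1
    have p2 : (0:ℝ) < q2 := by exact_mod_cast hq2.1
    have p3 : (0:ℝ) < q3 := by exact_mod_cast hq3.1
    have hsum : (q1 : ℝ) + q2 + q3 + (K - q1 - q2 - q3 : ℕ) = K := by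
      have : q1 + q2 + q3 + (K - q1 - q2 - q3) = K := by omega
      exact_mod_cast this
    have hK' : (K : ℝ) ≤ M := by exact_mod_cast hK
    unfold nsum
    set κ := (q1 * q2 * q3 : ℝ) * lam with hκ
    have dstep : ∀ x : ℝ, iterDiff [q1, q2, q3] (F 0) (x + 1) - iterDiff [q1, q2, q3] (F 0) x =
        iterDiff [q1, q2, q3, 1] (F 0) x := by
      intro x; simp [iterDiff]
    have dstep2 : ∀ x : ℝ, iterDiff [q1, q2, q3, 1] (F 0) (x + 1) - iterDiff [q1, q2, q3, 1] (F 0) x =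
        iterDiff [q1, q2, q3, 1, 1] (F 0) x := by
      intro x; simp [iterDiff]
    have kl := kusmin_landau (fun n => iterDiff [q1, q2, q3] (F 0) (A + n)) (K - q1 - q2 - q3) κ (by positivity)
      (by
        intro n hn
        have hn' : (n : ℝ) ≤ (K - q1 - q2 - q3 : ℕ) := by exact_mod_cast hn
        have e : A + ((n + 1 : ℕ) : ℝ) = (A + n) + 1 := by push_cast; ring

        rw [e, dstep]
        have := le_iterDiff [q1, q2, q3, 1] F A (A + 3 * M) lam (fun i hi => hd i (by simp at hi; omega))
          (by simpa using h4) (A + n) (by linarith [Nat.cast_nonneg (α := ℝ) n]) (by simp; linarith)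
        refine le_trans (le_of_eq ?_) this
        have hp : ((([q1, q2, q3, 1] : List ℕ).prod : ℕ) : ℝ) = q1 * q2 * q3 := by simp; ring
        rw [hκ, hp])
      (by
        intro n hn
        have hn' : (n : ℝ) ≤ (K - q1 - q2 - q3 : ℕ) := by exact_mod_cast hn
        have e : A + ((n + 1 : ℕ) : ℝ) = (A + n) + 1 := by push_cast; ring

        rw [e, dstep]
        have := iterDiff_le [q1, q2, q3, 1] F A (A + 3 * M) (C * lam) (fun i hi => hd i (by simp at hi; omega))
          (by simpa using h4') (A + n) (by linarith [Nat.cast_nonneg (α := ℝ) n]) (by simp; linarith)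
        refine this.trans (le_trans ?_ hHs)
        have a1 : (q1 : ℝ) ≤ H := by exact_mod_cast hq1.2.le
        have a2 : (q2 : ℝ) ≤ H := by exact_mod_cast hq2.2.le
        have a3 : (q3 : ℝ) ≤ M := by exact_mod_cast hq3.2.le
        have : ((([q1, q2, q3, 1] : List ℕ).prod : ℕ) : ℝ) = q1 * q2 * q3 := by simp; ring
        rw [this]
        calc _ = C * lam * (q1 * q2 * q3) := by ring
          _ ≤ C * lam * (H * H * M) := by gcongr
          _ = _ := by ring)
      (by
        intro n hn
        have hn' : (n : ℝ) ≤ (K - q1 - q2 - q3 : ℕ) := by exact_mod_cast hn.le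
        have e : A + ((n + 1 : ℕ) : ℝ) = (A + n) + 1 := by push_cast; ring
        have e2 : A + ((n + 2 : ℕ) : ℝ) = (A + n) + 1 + 1 := by push_cast; ring

        rw [e, e2, dstep, dstep, ← sub_nonpos, dstep2]
        have := iterDiff_le [q1, q2, q3, 1, 1] F A (A + 3 * M) 0 (fun i hi => hd i (by simpa using hi))
          (by simpa using h5) (A + n) (by linarith [Nat.cast_nonneg (α := ℝ) n]) (by simp; linarith)
        simpa using this)
    calc _ ≤ 1 / κ / M := div_le_div_of_nonneg_right kl hMp.le
      _ = _ := by rw [hκ]; field_simp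
  have lev2 : ∀ q1 ∈ Finset.Ico 1 H, ∀ q2 ∈ Finset.Ico 1 H,
      nsum M (iterDiff [q1, q2] (F 0)) A (K - q1 - q2) ^ 2 ≤ 2 / M + (4 * L / (M ^ 2 * lam * q1)) / q2 := by
    intro q1 hq1 q2 hq2
    have p1 : (0:ℝ) < q1 := by simp at hq1; exact_mod_cast hq1.1
    have p2 : (0:ℝ) < q2 := by simp at hq2; exact_mod_cast hq2.1
    have h := vdc_step M (iterDiff [q1, q2] (F 0)) A (K - q1 - q2) M (by omega) hM1 le_rfl
    have hav := avg_le M hM1 (fun q => nsum M (iterDiff [q1, q2, q] (F 0)) A (K - q1 - q2 - q)) 0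
      (1 / (M * lam * q1 * q2)) L le_rfl (by positivity) (sum_inv_le M M le_rfl hM1)
      (fun q hq => by rw [zero_add]; exact lev3 q1 hq1 q2 hq2 q hq)
    have e : ∀ q : ℕ, (fun y => iterDiff [q1, q2] (F 0) (y + q) - iterDiff [q1, q2] (F 0) y) = iterDiff [q1, q2, q] (F 0) := by
      intro q; funext y; simp [iterDiff]
    simp only [e] at h
    have e3 : 4 / (M:ℝ) * ∑ q ∈ Finset.Ico 1 M, nsum M (iterDiff [q1, q2, q] (F 0)) A (K - q1 - q2 - q) =
      4 * (1 / (M:ℝ) * ∑ q ∈ Finset.Ico 1 M, nsum M (iterDiff [q1, q2, q] (F 0)) A (K - q1 - q2 - q)) := by ring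
    rw [e3] at h
    have e4 : 4 * L / (M ^ 2 * lam * q1) / q2 = 4 * (0 + 1 / (M * lam * q1 * q2) * L / M) := by field_simp; ring
    rw [e4]; linarith
  have lev1 : ∀ q1 ∈ Finset.Ico 1 H, 
      nsum M (iterDiff [q1] (F 0)) A (K - q1) ^ 4 ≤ (8 / (H:ℝ) ^ 2 + 64 / M) + (128 * L ^ 2 / (H * M ^ 2 * lam)) / q1 := by
    intro q1 hq1
    have p1 : (0:ℝ) < q1 := by simp at hq1; exact_mod_cast hq1.1
    have h := vdc_step M (iterDiff [q1] (F 0)) A (K - q1) H (by omega) hH hHM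
    have e : ∀ q : ℕ, (fun y => iterDiff [q1] (F 0) (y + q) - iterDiff [q1] (F 0) y) = iterDiff [q1, q] (F 0) := by
      intro q; funext y; simp [iterDiff]
    simp only [e] at h
    have h2 := sq_sum_step _ 4 H hHp (Finset.Ico 1 H) (by simp) _ (2 / (H:ℝ)) (by positivity)
      (sq_nonneg _) (fun q _ => nsum_nonneg _ _ _ _) h (by norm_num)
    have hav := avg_le H hH (fun q => nsum M (iterDiff [q1, q] (F 0)) A (K - q1 - q) ^ 2) (2 / M)
      (4 * L / (M ^ 2 * lam * q1)) L (by positivity) (by positivity) (sum_inv_le H M hHM hM1)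
      (fun q hq => lev2 q1 hq1 q hq)
    have e3 : 2 * 4 ^ 2 / (H:ℝ) * ∑ q ∈ Finset.Ico 1 H, nsum M (iterDiff [q1, q] (F 0)) A (K - q1 - q) ^ 2 =
      32 * (1 / (H:ℝ) * ∑ q ∈ Finset.Ico 1 H, nsum M (iterDiff [q1, q] (F 0)) A (K - q1 - q) ^ 2) := by ring
    rw [e3] at h2
    have e4 : (8 / (H:ℝ) ^ 2 + 64 / M) + 128 * L ^ 2 / (H * M ^ 2 * lam) / q1 =
      2 * (2 / (H:ℝ)) ^ 2 + 32 * (2 / M + 4 * L / (M ^ 2 * lam * q1) * L / H) := by field_simp; ring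
    rw [e4]
    calc _ = (nsum M (iterDiff [q1] (F 0)) A (K - q1) ^ 2) ^ 2 := by ring
      _ ≤ _ := by linarith
  have h := vdc_step M (F 0) A K H (by omega) hH hHM
  have e : ∀ q : ℕ, (fun y => F 0 (y + q) - F 0 y) = iterDiff [q] (F 0) := by
    intro q; funext y; simp [iterDiff]
  simp only [e] at h
  have h2 := sq_sum_step _ 4 H hHp (Finset.Ico 1 H) (by simp) _ (2 / (H:ℝ)) (by positivity)
    (sq_nonneg _) (fun q _ => nsum_nonneg _ _ _ _) h (by norm_num)
  have h3 := sq_sum_step _ (2 * 4 ^ 2) H hHp (Finset.Ico 1 H) (by simp) _ (2 * (2 / (H:ℝ)) ^ 2) (by positivity)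
    (sq_nonneg _) (fun q _ => by positivity) h2 (by norm_num)
  have hav := avg_le H hH (fun q => nsum M (iterDiff [q] (F 0)) A (K - q) ^ 4) (8 / (H:ℝ) ^ 2 + 64 / M)
    (128 * L ^ 2 / (H * M ^ 2 * lam)) L (by positivity) (by positivity) (sum_inv_le H M hHM hM1) lev1
  have e3 : 2 * (2 * 4 ^ 2) ^ 2 / (H:ℝ) * ∑ q ∈ Finset.Ico 1 H, (nsum M (iterDiff [q] (F 0)) A (K - q) ^ 2) ^ 2 =
      2048 * (1 / (H:ℝ) * ∑ q ∈ Finset.Ico 1 H, nsum M (iterDiff [q] (F 0)) A (K - q) ^ 4) := by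
    have : ∀ q, (nsum M (iterDiff [q] (F 0)) A (K - q) ^ 2) ^ 2 = nsum M (iterDiff [q] (F 0)) A (K - q) ^ 4 := by
      intro q; ring
    simp only [this]; ring
  rw [e3] at h3
  have e4 : 128 / (H:ℝ) ^ 4 + 2048 * (8 / (H:ℝ) ^ 2 + 64 / M) + 2048 * 128 * L ^ 3 / (H ^ 2 * M ^ 2 * lam) =
     2 * (2 * (2 / (H:ℝ)) ^ 2) ^ 2 + 2048 * (8 / (H:ℝ) ^ 2 + 64 / M + 128 * L ^ 2 / (H * M ^ 2 * lam) * L / H) := by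
    field_simp; ring
  rw [e4]
  calc _ = ((nsum M (F 0) A K ^ 2) ^ 2) ^ 2 := by ring
    _ ≤ _ := by linarith

/-- Fourth derivative test. -/
lemma fourth_test (F : ℕ → ℝ → ℝ) (A : ℝ) (K M : ℕ) (lam C : ℝ) (hl : 0 < lam) (hC : 1 ≤ C)
    (hK : K ≤ M) (hM : 1 ≤ M)
    (hd : ∀ i < 5, ∀ x ∈ Set.Icc A (A + 3 * M), HasDerivAt (F i) (F (i + 1) x) x)
    (h4 : ∀ x ∈ Set.Icc A (A + 3 * M), lam ≤ F 4 x) (h4' : ∀ x ∈ Set.Icc A (A + 3 * M), F 4 x ≤ C * lam)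
    (h5 : ∀ x ∈ Set.Icc A (A + 3 * M), F 5 x ≤ 0) :
    nsum M (F 0) A K ^ 8 ≤ 10 ^ 7 * C * (1 + Real.log M) ^ 3 * (lam * M + 1 / M + 1 / (lam * M ^ 4)) := by
  have hMp : (0:ℝ) < M := by positivity
  have hM1' : (1:ℝ) ≤ M := by exact_mod_cast hM
  set L := 1 + Real.log M with hL
  have hL1 : 1 ≤ L := by have := Real.log_nonneg hM1'; linarith
  have hL3 : 1 ≤ L ^ 3 := one_le_pow₀ hL1
  have hs1 : nsum M (F 0) A K ^ 8 ≤ 1 := pow_le_one₀ (nsum_nonneg _ _ _ _) (nsum_le_one _ _ _ _ hK)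
  by_cases hbig : 1 < 2 * C * lam * M
  · have : 1 ≤ 10 ^ 7 * C * L ^ 3 * (lam * M + 1 / M + 1 / (lam * M ^ 4)) := by
      calc 1 ≤ 10 ^ 7 * C * 1 * (lam * M + 0 + 0) := by nlinarith
        _ ≤ _ := by gcongr <;> positivity
    linarith
  push Not at hbig
  set t := 1 / (2 * C * lam * M) with ht
  have ht1 : 1 ≤ t := by rw [ht, le_div_iff₀ (by positivity)]; linarith
  have hst1 : 1 ≤ Real.sqrt t := by rw [Real.one_le_sqrt]; exact ht1
  set H := min M ⌊Real.sqrt t⌋₊ with hH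
  have hfl : 1 ≤ ⌊Real.sqrt t⌋₊ := by rw [Nat.one_le_floor_iff]; exact hst1
  have hH1 : 1 ≤ H := le_min hM hfl
  have hHp : (0:ℝ) < H := by positivity
  have hHle : (H:ℝ) ^ 2 ≤ t := by
    have : (H:ℝ) ≤ Real.sqrt t := le_trans (by exact_mod_cast min_le_right _ _) (Nat.floor_le (by positivity))
    calc (H:ℝ)^2 ≤ (Real.sqrt t) ^ 2 := by gcongr
      _ = t := Real.sq_sqrt (by linarith)
  have hHs : C * lam * H ^ 2 * M ≤ 1 / 2 := by
    calc C * lam * H ^ 2 * M ≤ C * lam * t * M := by gcongr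
      _ = 1 / 2 := by rw [ht]; field_simp
  have core := fourth_core F A K M H lam C hl hK hH1 (min_le_left _ _) hd h4 h4' h5 hHs
  have hinv : 1 / (H:ℝ) ^ 2 ≤ 1 / M ^ 2 + 8 * C * lam * M := by
    rcases min_choice M ⌊Real.sqrt t⌋₊ with h | h
    · rw [hH, h]; have : 0 ≤ 8 * C * lam * M := by positivity
      linarith
    · have h2 : Real.sqrt t / 2 ≤ H := by
        rw [hH, h]
        have := Nat.lt_floor_add_one (Real.sqrt t)
        have : (1:ℝ) ≤ ⌊Real.sqrt t⌋₊ := by exact_mod_cast hfl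
        linarith
      have h3 : t / 4 ≤ (H:ℝ) ^ 2 := by
        calc t / 4 = (Real.sqrt t / 2) ^ 2 := by rw [div_pow, Real.sq_sqrt (by linarith)]; norm_num
          _ ≤ _ := by gcongr
      have h4 : 1 / (H:ℝ) ^ 2 ≤ 1 / (t / 4) := one_div_le_one_div_of_le (by positivity) h3
      have h5 : 1 / (t / 4) = 8 * C * lam * M := by rw [ht]; field_simp; ring
      have : (0:ℝ) ≤ 1 / M ^ 2 := by positivity
      linarith
  have hH4 : 1 / (H:ℝ) ^ 4 ≤ 1 / (H:ℝ) ^ 2 := by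
    apply one_div_le_one_div_of_le (by positivity)
    apply pow_le_pow_right₀ (by exact_mod_cast hH1) (by norm_num)
  have hMM : 1 / (M:ℝ) ^ 2 ≤ 1 / M := by
    apply one_div_le_one_div_of_le (by positivity)
    nlinarith
  have hlast : L ^ 3 / (H ^ 2 * M ^ 2 * lam) ≤ L ^ 3 * (1 / (lam * M ^ 4) + 8 * C / M) := by
    have : L ^ 3 / (H ^ 2 * M ^ 2 * lam) = L ^ 3 / (M ^ 2 * lam) * (1 / (H:ℝ) ^ 2) := by field_simp
    rw [this]
    calc _ ≤ L ^ 3 / (M ^ 2 * lam) * (1 / M ^ 2 + 8 * C * lam * M) := by gcongr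
      _ = _ := by field_simp
  set a := lam * M with ha
  set b := 1 / (M:ℝ) with hb
  set c := 1 / (lam * (M:ℝ) ^ 4) with hc
  have a0 : 0 ≤ a := by positivity
  have b0 : 0 ≤ b := by positivity
  have c0 : 0 ≤ c := by positivity
  have e1 : 8 * C * lam * M = 8 * C * a := by rw [ha]; ring
  have e2 : 8 * C / M = 8 * C * b := by rw [hb]; ring
  have e3 : 64 / (M:ℝ) = 64 * b := by rw [hb]; ring
  have e4 : 8 / (H:ℝ)^2 = 8 * (1 / (H:ℝ)^2) := by ring
  have e5 : 128 / (H:ℝ)^4 = 128 * (1 / (H:ℝ)^4) := by ring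
  have e6 : 2048 * 128 * L ^ 3 / (H ^ 2 * M ^ 2 * lam) = 2048 * 128 * (L ^ 3 / (H ^ 2 * M ^ 2 * lam)) := by ring
  rw [e1] at hinv
  rw [e2] at hlast
  rw [e3, e4, e5, e6] at core
  have fin1 : nsum M (F 0) A K ^ 8 ≤ 20000 * (b + 8 * C * a) + 140000 * b + 270000 * (L ^ 3 * (c + 8 * C * b)) := by
    have : 0 ≤ L ^ 3 * (c + 8 * C * b) := by positivity
    have : 0 ≤ b + 8 * C * a := by positivity
    linarith
  refine fin1.trans ?_
  have k1 : b ≤ C * L ^ 3 * b := le_mul_of_one_le_left b0 (by nlinarith)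
  have k2 : C * a ≤ C * L ^ 3 * a := by
    have := mul_le_mul_of_nonneg_left hL3 (show 0 ≤ C * a by positivity); linarith
  have k3 : L ^ 3 * c ≤ C * L ^ 3 * c := by
    have := mul_le_mul_of_nonneg_right hC (show 0 ≤ L ^ 3 * c by positivity); linarith
  have k0 : 0 ≤ C * L ^ 3 * a := by positivity
  have k4 : 0 ≤ C * L ^ 3 * b := by positivity
  have k5 : 0 ≤ C * L ^ 3 * c := by positivity
  have k6 : 10 ^ 7 * C * L ^ 3 * (a + b + c) = 10 ^ 7 * (C * L ^ 3 * a) + 10 ^ 7 * (C * L ^ 3 * b) + 10 ^ 7 * (C * L ^ 3 * c) := by ring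
  have k7 : 270000 * (L ^ 3 * (c + 8 * C * b)) = 270000 * (L ^ 3 * c) + 2160000 * (C * L ^ 3 * b) := by ring
  rw [k6, k7]
  linarith


/-- falling factorial coefficients -/
noncomputable def ffc (γ : ℝ) : ℕ → ℝ
  | 0 => 1
  | (i+1) => ffc γ i * (γ - i)

noncomputable def EF (γ ν : ℝ) (n : ℕ) (i : ℕ) (x : ℝ) : ℝ :=
  ffc γ i * ((n:ℝ) ^ i * ((n:ℝ) * x + ν) ^ (γ - i))

noncomputable def GF (b1 b3 : ℝ) : ℕ → ℝ → ℝ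
  | 0 => fun x => b1 * x + b3 * x ^ 3
  | 1 => fun x => b1 + b3 * (3 * x ^ 2)
  | 2 => fun x => b3 * (6 * x)
  | 3 => fun x => b3 * 6
  | _ => fun x => 0

lemma EF_deriv (γ ν : ℝ) (n i : ℕ) (x : ℝ) (hx : 0 < x) (hν : 0 ≤ ν) :
    HasDerivAt (EF γ ν n i) (EF γ ν n (i+1) x) x := by
  rcases Nat.eq_zero_or_pos n with h | h
  · subst h
    have : EF γ ν 0 i = fun _ => ffc γ i * ((0:ℝ) ^ i * ν ^ (γ - i)) := by
      funext z; simp [EF]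
    rw [this]
    have h2 : EF γ ν 0 (i+1) x = 0 := by simp [EF]
    rw [h2]; exact hasDerivAt_const _ _
  · have hn : (0:ℝ) < n := by exact_mod_cast h
    have hp : 0 < (n:ℝ) * x + ν := by positivity
    have h1 : HasDerivAt (fun z : ℝ => (n:ℝ) * z + ν) (n:ℝ) x := by
      simpa using ((hasDerivAt_id x).const_mul (n:ℝ)).add_const ν
    have h2 := h1.rpow_const (p := γ - i) (Or.inl hp.ne')
    have h3 := (h2.const_mul ((n:ℝ)^i)).const_mul (ffc γ i)
    have h4 : HasDerivAt (EF γ ν n i) _ x := h3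
    refine h4.congr_deriv ?_
    simp only [EF, ffc]
    push_cast
    rw [show γ - i - 1 = γ - (i + 1) by ring]
    ring

lemma GF_deriv (b1 b3 : ℝ) (i : ℕ) (x : ℝ) : HasDerivAt (GF b1 b3 i) (GF b1 b3 (i+1) x) x := by
  match i with
  | 0 =>
    have h := ((hasDerivAt_id x).const_mul b1).add ((hasDerivAt_pow 3 x).const_mul b3)
    have h4 : HasDerivAt (GF b1 b3 0) _ x := h
    refine h4.congr_deriv ?_
    simp [GF]
  | 1 =>
    have h := (((hasDerivAt_pow 2 x).const_mul 3).const_mul b3).const_add b1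
    have h4 : HasDerivAt (GF b1 b3 1) _ x := h
    refine h4.congr_deriv ?_
    simp [GF]; left; ring
  | 2 =>
    have h := ((hasDerivAt_id x).const_mul 6).const_mul b3
    have h4 : HasDerivAt (GF b1 b3 2) _ x := h
    refine h4.congr_deriv ?_
    simp [GF]
  | 3 => exact hasDerivAt_const _ _
  | (k+4) => exact hasDerivAt_const _ _

lemma pow_diff_lower (γ ν x : ℝ) (n1 n2 i : ℕ) (hn : n1 < n2) (hx : 0 < x) (hν : 0 ≤ ν) (hi : 1 ≤ i) (hγ : 0 < γ) :
    ((n2:ℝ) / (n2 * x + ν)) ^ i * (((n2:ℝ) * x + ν) ^ γ - ((n1:ℝ) * x + ν) ^ γ) ≤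
    (n2:ℝ) ^ i * ((n2:ℝ) * x + ν) ^ (γ - i) - (n1:ℝ) ^ i * ((n1:ℝ) * x + ν) ^ (γ - i) := by
  have hn2 : (0:ℝ) < n2 := by
    have : 0 < n2 := by omega
    exact_mod_cast this
  have hb : 0 < (n2:ℝ) * x + ν := by positivity
  have key : ∀ n : ℕ, 0 < n → (n:ℝ) ^ i * ((n:ℝ) * x + ν) ^ (γ - i) = ((n:ℝ) / (n * x + ν)) ^ i * ((n:ℝ) * x + ν) ^ γ := by
    intro n h
    have hn : (0:ℝ) < n := by exact_mod_cast h
    have hp : 0 < (n:ℝ) * x + ν := by positivity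
    rw [Real.rpow_sub hp, Real.rpow_natCast, div_pow]; field_simp
  rw [key n2 (by omega)]
  rcases Nat.eq_zero_or_pos n1 with h | h
  · subst h
    have : (0:ℝ) ^ i = 0 := by rw [zero_pow]; omega
    push_cast
    rw [this, zero_mul, zero_mul, zero_add, sub_zero]
    apply mul_le_mul_of_nonneg_left _ (by positivity)
    have := Real.rpow_nonneg hν γ
    linarith
  · rw [key n1 h, mul_sub]
    have hn1 : (0:ℝ) < n1 := by exact_mod_cast h
    have hp : 0 < (n1:ℝ) * x + ν := by positivity
    have hlt : (n1:ℝ) ≤ n2 := by exact_mod_cast hn.le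
    have : ((n1:ℝ) / (n1 * x + ν)) ^ i ≤ ((n2:ℝ) / (n2 * x + ν)) ^ i := by
      apply pow_le_pow_left₀ (by positivity)
      rw [div_le_div_iff₀ hp hb]; nlinarith
    have := mul_le_mul_of_nonneg_right this (Real.rpow_nonneg hp.le γ)
    linarith

lemma rpow_concave_diff (γ a b : ℝ) (hγ : 0 < γ) (hγ1 : γ < 1) (ha : 0 ≤ a) (hab : a < b) :
    γ * (b - a) * b ^ (γ - 1) ≤ b ^ γ - a ^ γ := by
  have hb : 0 < b := by linarith
  have h := rpow_one_add_le_one_add_mul_self (s := (a - b) / b) (p := γ)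
    (by rw [le_div_iff₀ hb]; linarith) hγ.le hγ1.le
  have e : 1 + (a - b) / b = a / b := by field_simp; ring
  rw [e, Real.div_rpow ha hb.le, div_le_iff₀ (Real.rpow_pos_of_pos hb _)] at h
  have e2 : b ^ (γ - 1) = b ^ γ / b := by rw [Real.rpow_sub hb, Real.rpow_one]
  rw [e2]
  have : (1 + γ * ((a - b) / b)) * b ^ γ = b ^ γ - γ * (b - a) * (b ^ γ / b) := by field_simp; ring
  linarith

lemma pow_diff_upper (γ ν x : ℝ) (n1 n2 : ℕ) (hn : n1 < n2) (hx : 0 < x) (hν : 0 ≤ ν) (hγ : γ < 1) :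
    (n2:ℝ) ^ 4 * ((n2:ℝ) * x + ν) ^ (γ - 4) - (n1:ℝ) ^ 4 * ((n1:ℝ) * x + ν) ^ (γ - 4) ≤
    4 * ((n2:ℝ) - n1) * (((n2:ℝ) * x) ^ (γ - 1) / x ^ 3) := by
  have hn2 : (0:ℝ) < n2 := by
    have : 0 < n2 := by omega
    exact_mod_cast this
  have hn1 : (0:ℝ) ≤ n1 := by positivity
  have hlt : (n1:ℝ) < n2 := by exact_mod_cast hn
  have h1 : (n1:ℝ) ^ 4 * ((n2:ℝ) * x + ν) ^ (γ - 4) ≤ (n1:ℝ) ^ 4 * ((n1:ℝ) * x + ν) ^ (γ - 4) := by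
    rcases Nat.eq_zero_or_pos n1 with h | h
    · subst h; simp
    · have hn1 : (0:ℝ) < n1 := by exact_mod_cast h
      apply mul_le_mul_of_nonneg_left _ (by positivity)
      apply Real.rpow_le_rpow_of_nonpos (by positivity) (by nlinarith) (by linarith)
  have h2 : ((n2:ℝ) * x + ν) ^ (γ - 4) ≤ ((n2:ℝ) * x) ^ (γ - 4) :=
    Real.rpow_le_rpow_of_nonpos (by positivity) (by linarith) (by linarith)
  have h3 : ((n2:ℝ) * x) ^ (γ - 4) = ((n2:ℝ) * x) ^ (γ - 1) / (n2 * x) ^ 3 := by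
    rw [← Real.rpow_natCast, ← Real.rpow_sub (by positivity)]; norm_num; ring_nf
  have h4 : (n2:ℝ) ^ 4 - n1 ^ 4 ≤ 4 * (n2 - n1) * n2 ^ 3 := by
    have : (n2:ℝ) ^ 4 - n1 ^ 4 = (n2 - n1) * (n2^3 + n2^2*n1 + n2*n1^2+n1^3) := by ring
    rw [this]
    have b1 : (n1:ℝ)^2 ≤ n2^2 := by gcongr
    have b2 : (n1:ℝ)^3 ≤ n2^3 := by gcongr
    have b3 : (n2:ℝ)^2*n1 ≤ n2^2*n2 := by gcongr
    have b4 : (n2:ℝ)*n1^2 ≤ n2*n2^2 := by gcongr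
    have : (n2:ℝ)^3 + n2^2*n1 + n2*n1^2+n1^3 ≤ 4 * n2^3 := by nlinarith
    nlinarith [mul_le_mul_of_nonneg_left this (sub_nonneg.2 hlt.le)]
  have h5 : 0 ≤ ((n2:ℝ) * x + ν) ^ (γ - 4) := Real.rpow_nonneg (by positivity) _
  have h6 : 0 ≤ (n2:ℝ) ^ 4 - n1 ^ 4 := by
    have : (n1:ℝ)^4 ≤ n2^4 := by gcongr
    linarith
  calc _ ≤ ((n2:ℝ) ^ 4 - n1 ^ 4) * ((n2:ℝ) * x + ν) ^ (γ - 4) := by linarith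
    _ ≤ ((n2:ℝ) ^ 4 - n1 ^ 4) * ((n2:ℝ) * x) ^ (γ - 4) := mul_le_mul_of_nonneg_left h2 h6
    _ ≤ (4 * (n2 - n1) * n2 ^ 3) * ((n2:ℝ) * x) ^ (γ - 4) :=
        mul_le_mul_of_nonneg_right h4 (Real.rpow_nonneg (by positivity) _)
    _ = _ := by rw [h3]; field_simp


lemma ffc4_neg (γ : ℝ) (hγ : 97/100 ≤ γ) (hγ1 : γ < 1) : ∃ c0 : ℝ, 0 < c0 ∧ c0 ≤ 1 ∧ ffc γ 4 = - c0 := by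
  refine ⟨γ * (1-γ) * ((2-γ) * (3-γ)), ?_, ?_, ?_⟩
  · have : 0 < 1 - γ := by linarith
    have : 0 < 2 - γ := by linarith
    have : 0 < 3 - γ := by linarith
    positivity
  · have h1 : γ * (1-γ) ≤ 1/4 := by nlinarith [sq_nonneg (γ - 1/2)]
    have h2 : (2-γ) * (3-γ) ≤ 4 := by nlinarith
    have h3 : 0 ≤ (2-γ) * (3-γ) := by nlinarith
    nlinarith
  · simp [ffc]; ring

lemma log_bound (Y : ℝ) (hY : 1 ≤ Y) (M : ℕ) (hM : 1 ≤ M) (hMY : (M:ℝ) ≤ 2 * Y) :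
    1 + Real.log M ≤ 2002 * Y ^ (1/2000 : ℝ) := by
  have h1 : Real.log M ≤ Real.log (2 * Y) := Real.log_le_log (by exact_mod_cast hM) hMY
  rw [Real.log_mul (by norm_num) (by linarith)] at h1
  have h2 := Real.log_le_rpow_div (x := Y) (by linarith) (show (0:ℝ) < 1/2000 by norm_num)
  have h3 : Real.log 2 ≤ 1 := by linarith [Real.log_two_lt_d9]
  have h4 : 1 ≤ Y ^ (1/2000:ℝ) := Real.one_le_rpow hY (by norm_num)
  rw [div_div_eq_mul_div, div_one] at h2
  linarith

set_option maxHeartbeats 2000000 in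
lemma inner_expsum (γ : ℝ) (hγ : 97/100 ≤ γ) (hγ1 : γ < 1) : ∃ C : ℝ, 1 ≤ C ∧
    ∀ (Y : ℝ) (M n1 n2 K : ℕ) (A h b1 b3 ν : ℝ), 1 ≤ Y → 1 ≤ M → Y ≤ 4 * (M:ℝ) ^ 2 → n1 < n2 →
      Y ≤ 2 * M * n2 → (M:ℝ) * n2 ≤ 2 * Y → (M:ℝ) ≤ A → A ≤ 2 * M → K ≤ M → 1 ≤ h → h ≤ Y ^ (544/10000:ℝ) →
      0 ≤ ν → ν ≤ 1 →
      ‖∑ k ∈ Finset.range K, eexp (b1 * (A + k) + b3 * (A + k) ^ 3 +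
        h * (((n1:ℝ) * (A + k) + ν) ^ γ - ((n2:ℝ) * (A + k) + ν) ^ γ))‖ ≤ C * M * Y ^ (-(555/10000):ℝ) := by
  obtain ⟨c0, hc0, hc01, hc⟩ := ffc4_neg γ hγ hγ1
  set D : ℝ := 10^7 * 240000 * 2002^3 * (18 + 60000 / c0) with hD
  have hDpos : 0 < D := by positivity
  have hD1 : 1 ≤ D + 1 := by linarith
  refine ⟨D + 1, hD1, ?_⟩
  intro Y M n1 n2 K A h b1 b3 ν hY hM hYM hn hYn hMn hA hA2 hK hh hhY hν hν1
  have hY0 : 0 < Y := by linarith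
  have hM1 : (1:ℝ) ≤ M := by exact_mod_cast hM
  have hM0 : (0:ℝ) < M := by linarith
  have hn2 : (1:ℝ) ≤ n2 := by
    have : 1 ≤ n2 := by omega
    exact_mod_cast this
  have hn12 : (n1:ℝ) + 1 ≤ n2 := by exact_mod_cast hn
  have hn1 : (0:ℝ) ≤ n1 := by positivity
  set q : ℝ := n2 - n1 with hq
  have hq1 : 1 ≤ q := by linarith
  have hq2 : q ≤ n2 := by linarith
  have hYγ : 0 < Y ^ (γ - 1) := Real.rpow_pos_of_pos hY0 _
  set lam : ℝ := c0 * h * q * Y ^ (γ - 1) / M ^ 3 / 30000 with hlam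
  have hlam0 : 0 < lam := by positivity
  set F : ℕ → ℝ → ℝ := fun i x => GF b1 b3 i x + h * (EF γ ν n1 i x - EF γ ν n2 i x) with hF
  have hx0 : ∀ x ∈ Set.Icc A (A + 3 * M), (M:ℝ) ≤ x ∧ x ≤ 5 * M := by
    intro x hx; exact ⟨hA.trans hx.1, hx.2.trans (by linarith)⟩
  have hF4 : ∀ x, F 4 x = h * c0 * ((n2:ℝ) ^ 4 * ((n2:ℝ) * x + ν) ^ (γ - 4) - (n1:ℝ) ^ 4 * ((n1:ℝ) * x + ν) ^ (γ - 4)) := by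
    intro x; simp only [hF, GF, EF, hc]; push_cast; ring
  have hF5 : ∀ x, F 5 x = - (h * (c0 * (4 - γ))) * ((n2:ℝ) ^ 5 * ((n2:ℝ) * x + ν) ^ (γ - (5:ℕ)) - (n1:ℝ) ^ 5 * ((n1:ℝ) * x + ν) ^ (γ - (5:ℕ))) := by
    intro x
    have : ffc γ 5 = c0 * (4 - γ) := by
      rw [show ffc γ 5 = ffc γ 4 * (γ - (4:ℕ)) from rfl, hc]; push_cast; ring
    simp only [hF, GF, EF, this]; push_cast; ring
  have hgap : ∀ x, 0 < x → γ * (q * x) * ((n2:ℝ) * x + ν) ^ (γ - 1) ≤ ((n2:ℝ) * x + ν) ^ γ - ((n1:ℝ) * x + ν) ^ γ := by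
    intro x hx
    have := rpow_concave_diff γ ((n1:ℝ) * x + ν) ((n2:ℝ) * x + ν) (by linarith) hγ1 (by positivity) (by nlinarith)
    have e : ((n2:ℝ) * x + ν) - ((n1:ℝ) * x + ν) = q * x := by rw [hq]; ring
    rwa [e] at this
  have T := fourth_test F A K M lam 240000 hlam0 (by norm_num) hK hM ?_ ?_ ?_ ?_
  · have hF0 : ∀ k : ℕ, F 0 (A + k) = b1 * (A + k) + b3 * (A + k) ^ 3 +
        h * (((n1:ℝ) * (A + k) + ν) ^ γ - ((n2:ℝ) * (A + k) + ν) ^ γ) := by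
      intro k; simp [hF, GF, EF, ffc]
    have hs : ‖∑ k ∈ Finset.range K, eexp (b1 * (A + k) + b3 * (A + k) ^ 3 +
        h * (((n1:ℝ) * (A + k) + ν) ^ γ - ((n2:ℝ) * (A + k) + ν) ^ γ))‖ = nsum M (F 0) A K * M := by
      rw [nsum, div_mul_cancel₀ _ hM0.ne']
      simp only [hF0]
    rw [hs]
    set Z : ℝ := Y ^ (-(1/2):ℝ) with hZ
    have hZ0 : 0 < Z := Real.rpow_pos_of_pos hY0 _
    have hsq : Real.sqrt Y ≤ 2 * M := by
      rw [Real.sqrt_le_left (by positivity)]; nlinarith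
    have hZM : 1 / (M:ℝ) ≤ 2 * Z := by
      rw [hZ, Real.rpow_neg hY0.le, ← Real.sqrt_eq_rpow]
      have : 0 < Real.sqrt Y := Real.sqrt_pos.2 hY0
      rw [div_le_iff₀ hM0]
      field_simp; linarith
    have hZ2 : Z ^ 2 * Y = 1 := by
      rw [hZ, ← Real.rpow_natCast, ← Real.rpow_mul hY0.le]
      nth_rewrite 2 [← Real.rpow_one Y]
      rw [← Real.rpow_add hY0]; norm_num
    have hhp : 1 ≤ Y ^ (544/10000:ℝ) := Real.one_le_rpow hY (by norm_num)
    have hYγ1 : Y ^ (γ - 1) ≤ 1 := Real.rpow_le_one_of_one_le_of_nonpos hY (by linarith)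
    have t1 : lam * M ≤ 16 * (Z * Y ^ (544/10000:ℝ)) := by
      have a1 : lam * M ≤ h * q * (1 / M) ^ 2 := by
        have : lam * M = (c0 * Y ^ (γ - 1) / 30000) * (h * q * (1 / M) ^ 2) := by rw [hlam]; field_simp
        rw [this]
        have : c0 * Y ^ (γ - 1) / 30000 ≤ 1 := by
          have := mul_le_mul hc01 hYγ1 hYγ.le zero_le_one
          linarith
        exact mul_le_of_le_one_left (by positivity) this
      have a2 : q ≤ 2 * Y * (1 / M) := by
        rw [mul_one_div, le_div_iff₀ hM0]
        nlinarith
      calc lam * M ≤ h * q * (1 / M) ^ 2 := a1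
        _ ≤ h * (2 * Y * (1 / M)) * (1 / M) ^ 2 := by gcongr
        _ = 2 * h * Y * (1 / M) ^ 3 := by ring
        _ ≤ 2 * (Y ^ (544/10000:ℝ)) * Y * (2 * Z) ^ 3 := by gcongr
        _ = 16 * (Z * Y ^ (544/10000:ℝ)) * (Z ^ 2 * Y) := by ring
        _ = _ := by rw [hZ2, mul_one]
    have t2 : 1 / (M:ℝ) ≤ 2 * (Z * Y ^ (544/10000:ℝ)) := by
      refine hZM.trans ?_
      have := mul_le_mul_of_nonneg_left hhp hZ0.le
      linarith
    have t3 : 1 / (lam * M ^ 4) ≤ 60000 / c0 * (Z * Y ^ (544/10000:ℝ)) := by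
      have e : 1 / (lam * M ^ 4) = 30000 / c0 * ((1 / (h * q)) * (1 / M) * (1 / Y ^ (γ - 1))) := by
        rw [hlam]; field_simp
      rw [e]
      have b1 : 1 / (h * q) ≤ 1 := by
        rw [div_le_one (by positivity)]; nlinarith
      have b2 : 1 / Y ^ (γ - 1) ≤ Y ^ (544/10000:ℝ) := by
        rw [one_div, ← Real.rpow_neg hY0.le]
        exact Real.rpow_le_rpow_of_exponent_le hY (by linarith)
      calc _ ≤ 30000 / c0 * (1 * (2 * Z) * Y ^ (544/10000:ℝ)) := by gcongr
        _ = _ := by ring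
    have hMY : (M:ℝ) ≤ 2 * Y := (le_mul_of_one_le_right hM0.le hn2).trans hMn
    have hL := log_bound Y hY M hM hMY
    have hL0 : 0 ≤ Real.log M := Real.log_nonneg hM1
    have e1 : Z * Y ^ (544/10000:ℝ) * (Y ^ (1/2000:ℝ)) ^ 3 ≤ (Y ^ (-(555/10000):ℝ)) ^ 8 := by
      rw [hZ, ← Real.rpow_natCast, ← Real.rpow_natCast, ← Real.rpow_mul hY0.le, ← Real.rpow_mul hY0.le, ← Real.rpow_add hY0, ← Real.rpow_add hY0]
      exact Real.rpow_le_rpow_of_exponent_le hY (by norm_num)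
    have T2 : nsum M (F 0) A K ^ 8 ≤ ((D + 1) * Y ^ (-(555/10000):ℝ)) ^ 8 := by
      calc _ ≤ _ := T
        _ ≤ 10 ^ 7 * 240000 * (2002 * Y ^ (1/2000 : ℝ)) ^ 3 * (16 * (Z * Y ^ (544/10000:ℝ)) + 2 * (Z * Y ^ (544/10000:ℝ)) + 60000 / c0 * (Z * Y ^ (544/10000:ℝ))) := by
            gcongr
        _ = D * (Z * Y ^ (544/10000:ℝ) * (Y ^ (1/2000:ℝ)) ^ 3) := by rw [hD]; ring
        _ ≤ (D + 1) ^ 8 * (Y ^ (-(555/10000):ℝ)) ^ 8 := by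
            apply mul_le_mul _ e1 (by positivity) (by positivity)
            have := le_self_pow₀ hD1 (show 8 ≠ 0 by norm_num)
            linarith
        _ = _ := by ring
    have T3 := le_of_pow_le_pow_left₀ (by norm_num) (by positivity) T2
    calc _ ≤ ((D + 1) * Y ^ (-(555/10000):ℝ)) * M := by gcongr
      _ = _ := by ring
  · intro i _ x hx
    have hxp : 0 < x := by have := (hx0 x hx).1; linarith
    exact (GF_deriv b1 b3 i x).add (((EF_deriv γ ν n1 i x hxp hν).sub (EF_deriv γ ν n2 i x hxp hν)).const_mul h)
  · intro x hx
    obtain ⟨hx1, hx2⟩ := hx0 x hx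
    have hxp : 0 < x := by linarith
    rw [hF4]
    have l1 := pow_diff_lower γ ν x n1 n2 4 hn hxp hν (by norm_num) (by linarith)
    push_cast at l1
    have l2 := hgap x hxp
    have hnx : 1 ≤ (n2:ℝ) * x := by nlinarith
    have l3 : 1 / (2 * x) ≤ (n2:ℝ) / (n2 * x + ν) := by
      rw [div_le_div_iff₀ (by positivity) (by positivity)]; nlinarith
    have l4 : Y ^ (γ - 1) / 11 ≤ ((n2:ℝ) * x + ν) ^ (γ - 1) := by
      have : (11 * Y) ^ (γ - 1) ≤ ((n2:ℝ) * x + ν) ^ (γ - 1) := by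
        apply Real.rpow_le_rpow_of_nonpos (by positivity) _ (by linarith)
        nlinarith
      refine le_trans ?_ this
      rw [Real.mul_rpow (by norm_num) hY0.le]
      have : (11:ℝ) ^ (-1:ℝ) ≤ 11 ^ (γ - 1) := Real.rpow_le_rpow_of_exponent_le (by norm_num) (by linarith)
      rw [Real.rpow_neg_one] at this
      rw [div_eq_inv_mul]; gcongr
    have l5 : (1 / (2 * x)) ^ 4 * (γ * (q * x) * (Y ^ (γ - 1) / 11)) ≤
        (n2:ℝ) ^ 4 * ((n2:ℝ) * x + ν) ^ (γ - 4) - (n1:ℝ) ^ 4 * ((n1:ℝ) * x + ν) ^ (γ - 4) := by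
      refine le_trans ?_ l1
      apply mul_le_mul (by gcongr) _ (by positivity) (by positivity)
      refine le_trans ?_ l2
      gcongr
    have l6 : q * Y ^ (γ - 1) / M ^ 3 / 30000 ≤ (1 / (2 * x)) ^ 4 * (γ * (q * x) * (Y ^ (γ - 1) / 11)) := by
      have e : (1 / (2 * x)) ^ 4 * (γ * (q * x) * (Y ^ (γ - 1) / 11)) = (γ / 176) * (q * Y ^ (γ - 1) / x ^ 3) := by
        field_simp; norm_num
      rw [e]
      have e2 : q * Y ^ (γ - 1) / (5 * M) ^ 3 ≤ q * Y ^ (γ - 1) / x ^ 3 := by gcongr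
      have e3 : q * Y ^ (γ - 1) / (5 * M) ^ 3 = 1/125 * (q * Y ^ (γ - 1) / M ^ 3) := by field_simp; norm_num
      have e4 : 0 < q * Y ^ (γ - 1) / M ^ 3 := by positivity
      have e5 : (97/100 / 176) * (q * Y ^ (γ - 1) / (5 * M) ^ 3) ≤ (γ / 176) * (q * Y ^ (γ - 1) / x ^ 3) := by gcongr
      rw [e3] at e5
      linarith
    have l7 := l6.trans l5
    calc lam = h * c0 * (q * Y ^ (γ - 1) / M ^ 3 / 30000) := by rw [hlam]; ring
      _ ≤ _ := by gcongr
  · intro x hx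
    obtain ⟨hx1, hx2⟩ := hx0 x hx
    have hxp : 0 < x := by linarith
    rw [hF4]
    have u1 := pow_diff_upper γ ν x n1 n2 hn hxp hν hγ1
    have u2 : ((n2:ℝ) * x) ^ (γ - 1) ≤ 2 * Y ^ (γ - 1) := by
      have : ((n2:ℝ) * x) ^ (γ - 1) ≤ (2⁻¹ * Y) ^ (γ - 1) := by
        apply Real.rpow_le_rpow_of_nonpos (by positivity) _ (by linarith)
        nlinarith
      refine this.trans ?_
      rw [Real.mul_rpow (by norm_num) hY0.le]
      gcongr
      rw [Real.inv_rpow (by norm_num), ← Real.rpow_neg (by norm_num)]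
      calc (2:ℝ) ^ (-(γ - 1)) ≤ 2 ^ (1:ℝ) := Real.rpow_le_rpow_of_exponent_le (by norm_num) (by linarith)
        _ = 2 := Real.rpow_one 2
    calc _ ≤ h * c0 * (4 * ((n2:ℝ) - n1) * (((n2:ℝ) * x) ^ (γ - 1) / x ^ 3)) := by gcongr
      _ ≤ h * c0 * (4 * ((n2:ℝ) - n1) * ((2 * Y ^ (γ - 1)) / M ^ 3)) := by
          rw [← hq]; gcongr
      _ = _ := by rw [hlam, ← hq]; ring
  · intro x hx
    obtain ⟨hx1, hx2⟩ := hx0 x hx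
    have hxp : 0 < x := by linarith
    rw [hF5]
    have l1 := pow_diff_lower γ ν x n1 n2 5 hn hxp hν (by norm_num) (by linarith)
    have l2 := hgap x hxp
    have l3 : 0 ≤ γ * (q * x) * ((n2:ℝ) * x + ν) ^ (γ - 1) := by positivity
    have l4 : 0 ≤ ((n2:ℝ) / (n2 * x + ν)) ^ 5 * (((n2:ℝ) * x + ν) ^ γ - ((n1:ℝ) * x + ν) ^ γ) :=
      mul_nonneg (by positivity) (by linarith)
    have l5 := l4.trans l1
    have : 0 ≤ h * (c0 * (4 - γ)) := by
      have : 0 < 4 - γ := by linarith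
      positivity
    nlinarith


noncomputable def ph (γ a1 a3 h ν : ℝ) (n : ℕ) : ℝ := a1 * n + a3 * (n:ℝ) ^ 3 + h * ((n:ℝ) + ν) ^ γ

def PairBound (C : ℝ) (Y : ℕ) (g : ℕ → ℝ) : Prop :=
  ∀ M n1 n2 a b : ℕ, 1 ≤ M → Y ≤ 4 * M ^ 2 → n1 < n2 → Y ≤ 2 * M * n2 → M * n2 ≤ 2 * Y → M ≤ a → b ≤ 2 * M →
    ‖∑ m ∈ Finset.Ico a b, eexp (g (m * n1) - g (m * n2))‖ ≤ C * M * (Y:ℝ) ^ (-(555/10000):ℝ)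

lemma pairBound_ph (γ : ℝ) (hγ : 97/100 ≤ γ) (hγ1 : γ < 1) : ∃ C : ℝ, 1 ≤ C ∧
    ∀ (Y : ℕ) (a1 a3 h ν : ℝ), 1 ≤ Y → 1 ≤ h → h ≤ (Y:ℝ) ^ (544/10000:ℝ) → 0 ≤ ν → ν ≤ 1 →
      PairBound C Y (ph γ a1 a3 h ν) := by
  obtain ⟨C, hC, H⟩ := inner_expsum γ hγ hγ1
  refine ⟨C, hC, ?_⟩
  intro Y a1 a3 h ν hY hh hhY hν hν1 M n1 n2 a b hM hYM hn hYn hMn hMa hb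
  have hpos : 0 ≤ C * M * (Y:ℝ) ^ (-(555/10000):ℝ) := by positivity
  rcases le_or_gt b a with hab | hab
  · rw [Finset.Ico_eq_empty (by omega)]; simpa using hpos
  have := H Y M n1 n2 (b - a) a h (a1 * ((n1:ℝ) - n2)) (a3 * ((n1:ℝ)^3 - (n2:ℝ)^3)) ν (by exact_mod_cast hY) hM
    (by exact_mod_cast hYM) hn (by exact_mod_cast hYn) (by exact_mod_cast hMn) (by exact_mod_cast hMa)
    (by exact_mod_cast (by omega : a ≤ 2 * M)) (by omega) hh hhY hν hν1
  rw [Finset.sum_Ico_eq_sum_range]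
  convert this using 4 with k _
  simp only [ph]; push_cast; ring_nf

lemma pairBound_ne {C : ℝ} {Y : ℕ} {g : ℕ → ℝ} (H : PairBound C Y g) (M n1 n2 a b : ℕ) (hM : 1 ≤ M)
    (hYM : Y ≤ 4 * M ^ 2) (hn : n1 ≠ n2) (h1 : Y ≤ 2 * M * n1) (h1' : M * n1 ≤ 2 * Y)
    (h2 : Y ≤ 2 * M * n2) (h2' : M * n2 ≤ 2 * Y) (ha : M ≤ a) (hb : b ≤ 2 * M) :
    ‖∑ m ∈ Finset.Ico a b, eexp (g (m * n1) - g (m * n2))‖ ≤ C * M * (Y:ℝ) ^ (-(555/10000):ℝ) := by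
  rcases lt_or_gt_of_ne hn with h | h
  · exact H M n1 n2 a b hM hYM h h2 h2' ha hb
  · have := H M n2 n1 a b hM hYM h h1 h1' ha hb
    rw [← Complex.norm_conj, map_sum] at this
    convert this using 3 with m _
    rw [conj_eexp]; congr 1; ring

lemma pairBound_single {C : ℝ} {Y : ℕ} {g : ℕ → ℝ} (H : PairBound C Y g) (M n a b : ℕ) (hM : 1 ≤ M)
    (hYM : Y ≤ 4 * M ^ 2) (hn : 0 < n)
    (h2 : Y ≤ 2 * M * n) (h2' : M * n ≤ 2 * Y) (ha : M ≤ a) (hb : b ≤ 2 * M) :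
    ‖∑ m ∈ Finset.Ico a b, eexp (g (n * m))‖ ≤ C * M * (Y:ℝ) ^ (-(555/10000):ℝ) := by
  have := H M 0 n a b hM hYM hn h2 h2' ha hb
  rw [← Complex.norm_conj, map_sum] at this
  refine le_trans (le_of_eq ?_) this
  have e : ∀ m ∈ Finset.Ico a b, (starRingEnd ℂ) (eexp (g (m * 0) - g (m * n))) = eexp (- g 0) * eexp (g (n * m)) := by
    intro m _
    rw [conj_eexp, ← eexp_add, mul_zero, mul_comm m n]; congr 1; ring
  rw [Finset.sum_congr rfl e, ← Finset.mul_sum, norm_mul, norm_eexp, one_mul]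

lemma filter_convex_Ico (P : ℕ → Prop) [DecidablePred P] (hP : ∀ x y z, P x → P z → x ≤ y → y ≤ z → P y) (a b : ℕ) :
    ∃ a' b', a ≤ a' ∧ b' ≤ b ∧ (Finset.Ico a b).filter P = Finset.Ico a' b' := by
  rcases ((Finset.Ico a b).filter P).eq_empty_or_nonempty with h | h
  · rcases le_total a b with h1 | h1
    · exact ⟨a, a, le_rfl, h1, by simp [h]⟩
    · exact ⟨a, b, le_rfl, le_rfl, by rw [h, Finset.Ico_eq_empty (by omega)]⟩
  · have m1 := Finset.min'_mem _ h
    have m2 := Finset.max'_mem _ h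
    set u := Finset.min' _ h
    set v := Finset.max' _ h
    rw [Finset.mem_filter, Finset.mem_Ico] at m1 m2
    refine ⟨u, v + 1, m1.1.1, m2.1.2, ?_⟩
    ext x
    constructor
    · intro hx
      have := Finset.min'_le _ x hx
      have := Finset.le_max' _ x hx
      rw [Finset.mem_Ico]; omega
    · intro hx
      rw [Finset.mem_Ico] at hx
      rw [Finset.mem_filter, Finset.mem_Ico]
      exact ⟨by omega, hP u x v m1.2 m2.2 hx.1 (by omega)⟩

/-- Type II dyadic block. -/
lemma typeII_block {C : ℝ} (hC : 1 ≤ C) {Y : ℕ} (hY : 1 ≤ Y) {g : ℕ → ℝ} (H : PairBound C Y g) (B : ℝ) (hB : 0 ≤ B)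
    (a b : ℕ → ℂ) (ha : ∀ m ≤ 2 * Y, ‖a m‖ ≤ B) (hb : ∀ m ≤ 2 * Y, ‖b m‖ ≤ B) (M : ℕ) (hM : 1 ≤ M)
    (Q : ℕ → ℕ → Prop) [∀ m n, Decidable (Q m n)] (hQ : ∀ n x y z, Q x n → Q z n → x ≤ y → y ≤ z → Q y n)
    (hQ1 : ∀ m n, Q m n → Y < m * n ∧ m * n ≤ 2 * Y ∧ n ≤ m ∧ Y ≤ n ^ 3) (S : Finset ℕ) :
    ‖∑ m ∈ Finset.Ico M (2 * M), ∑ n ∈ S, (if Q m n then a m * b n * eexp (g (m * n)) else 0)‖ ≤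
      B ^ 2 * ((2 + 2 * C) * (Y:ℝ) ^ (1 - 277/10000 : ℝ)) := by
  have hY1 : (1:ℝ) ≤ Y := by exact_mod_cast hY
  have hY0 : (0:ℝ) < Y := by linarith
  have hM0 : (0:ℝ) < M := by exact_mod_cast hM
  obtain ⟨P, hP⟩ : ∃ P : ℕ → Prop, P = fun n => ∃ m ∈ Finset.Ico M (2 * M), Q m n := ⟨_, rfl⟩
  set 𝒩 := S.filter P with h𝒩
  set c : ℕ → ℕ → ℂ := fun m n => if Q m n then b n * eexp (g (m * n)) else 0 with hc
  have e1 : ∀ m ∈ Finset.Ico M (2 * M), (∑ n ∈ S, (if Q m n then a m * b n * eexp (g (m * n)) else 0)) =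
      a m * ∑ n ∈ 𝒩, c m n := by
    intro m hm
    rw [Finset.mul_sum, h𝒩, Finset.sum_filter]
    apply Finset.sum_congr rfl
    intro n _
    by_cases h : Q m n
    · have : P n := by rw [hP]; exact ⟨m, hm, h⟩
      simp only [hc, if_pos h, if_pos this]; ring
    · simp [hc, if_neg h]
  rw [Finset.sum_congr rfl e1]
  rcases 𝒩.eq_empty_or_nonempty with hem | ⟨n0, hn0⟩
  · rw [hem]; simp; positivity
  have hprop : ∀ n ∈ 𝒩, Y ≤ 2 * M * n ∧ M * n ≤ 2 * Y ∧ 1 ≤ n ∧ Y ≤ 4 * M ^ 2 ∧ Y ≤ n ^ 3 := by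
    intro n hn
    rw [h𝒩, Finset.mem_filter, hP] at hn
    obtain ⟨_, m, hm, hq⟩ := hn
    rw [Finset.mem_Ico] at hm
    obtain ⟨q1, q2, q3, q4⟩ := hQ1 m n hq
    refine ⟨?_, ?_, ?_, ?_, q4⟩
    · nlinarith
    · nlinarith
    · by_contra h; have : n = 0 := by omega
      subst this; simp at q1
    · nlinarith
  have hYM := (hprop n0 hn0).2.2.2.1
  have hM2Y : M ≤ 2 * Y := by
    have := hprop n0 hn0; nlinarith
  set R : ℝ := (𝒩.card : ℝ) with hR
  have hR1 : R * M ≤ 2 * Y := by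
    have hsub : 𝒩 ⊆ Finset.Icc 1 (2 * Y / M) := by
      intro n hn
      obtain ⟨p1, p2, p3, _⟩ := hprop n hn
      rw [Finset.mem_Icc]
      refine ⟨p3, ?_⟩
      rw [Nat.le_div_iff_mul_le (by omega)]; linarith
    have := Finset.card_le_card hsub
    rw [Nat.card_Icc, Nat.add_sub_cancel] at this
    have h2 : 𝒩.card * M ≤ 2 * Y := (Nat.mul_le_mul_right M this).trans (Nat.div_mul_le_self _ _)
    rw [hR]; exact_mod_cast h2
  set Z : ℝ := (Y:ℝ) ^ (-(555/10000):ℝ) with hZ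
  have hZ0 : 0 < Z := Real.rpow_pos_of_pos hY0 _
  have hbn : ∀ n ∈ 𝒩, ‖b n‖ ≤ B := by
    intro n hn
    apply hb
    obtain ⟨p1, p2, p3, _⟩ := hprop n hn
    nlinarith
  have cs : ‖∑ m ∈ Finset.Ico M (2 * M), a m * ∑ n ∈ 𝒩, c m n‖ ^ 2 ≤
      (B ^ 2 * M) * ∑ m ∈ Finset.Ico M (2 * M), ‖∑ n ∈ 𝒩, c m n‖ ^ 2 := by
    have h1 : ‖∑ m ∈ Finset.Ico M (2 * M), a m * ∑ n ∈ 𝒩, c m n‖ ≤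
        B * ∑ m ∈ Finset.Ico M (2 * M), ‖∑ n ∈ 𝒩, c m n‖ := by
      refine (norm_sum_le _ _).trans ?_
      rw [Finset.mul_sum]
      apply Finset.sum_le_sum
      intro m hm
      rw [norm_mul]
      by_cases hz : m ≤ 2 * Y
      · gcongr; exact ha m hz
      · have : ∑ n ∈ 𝒩, c m n = 0 := by
          apply Finset.sum_eq_zero
          intro n hn
          simp only [hc]
          rw [if_neg]
          intro hq
          have := hQ1 m n hq
          have p3 := (hprop n hn).2.2.1
          nlinarith
        rw [this]; simp
    have h2 := sq_sum_le_card_mul_sum_sq (s := Finset.Ico M (2 * M)) (f := fun m => ‖∑ n ∈ 𝒩, c m n‖)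
    rw [Nat.card_Ico, show 2 * M - M = M by omega] at h2
    calc _ ≤ (B * ∑ m ∈ Finset.Ico M (2 * M), ‖∑ n ∈ 𝒩, c m n‖) ^ 2 := by gcongr
      _ = B ^ 2 * (∑ m ∈ Finset.Ico M (2 * M), ‖∑ n ∈ 𝒩, c m n‖) ^ 2 := by ring
      _ ≤ B ^ 2 * (M * ∑ m ∈ Finset.Ico M (2 * M), ‖∑ n ∈ 𝒩, c m n‖ ^ 2) := by gcongr
      _ = _ := by ring
  have inner : ∀ n1 ∈ 𝒩, ∀ n2 ∈ 𝒩, ‖∑ m ∈ Finset.Ico M (2 * M), c m n1 * (starRingEnd ℂ) (c m n2)‖ ≤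
      B ^ 2 * ((if n1 = n2 then (M:ℝ) else 0) + C * M * Z) := by
    intro n1 h1 n2 h2
    have e : ∀ m, c m n1 * (starRingEnd ℂ) (c m n2) = if (Q m n1 ∧ Q m n2) then
        b n1 * (starRingEnd ℂ) (b n2) * eexp (g (m * n1) - g (m * n2)) else 0 := by
      intro m
      simp only [hc]
      by_cases q1 : Q m n1 <;> by_cases q2 : Q m n2 <;> simp [q1, q2, eexp_sub]
      ring
    simp only [e]
    rw [← Finset.sum_filter, ← Finset.mul_sum]
    obtain ⟨a', b', ha', hb', hf⟩ := filter_convex_Ico (fun m => Q m n1 ∧ Q m n2)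
      (fun x y z hx hz hxy hyz => ⟨hQ n1 x y z hx.1 hz.1 hxy hyz, hQ n2 x y z hx.2 hz.2 hxy hyz⟩) M (2 * M)
    rw [hf, norm_mul, norm_mul, Complex.norm_conj]
    have hbb : ‖b n1‖ * ‖b n2‖ ≤ B ^ 2 := by
      rw [sq]; exact mul_le_mul (hbn n1 h1) (hbn n2 h2) (norm_nonneg _) hB
    apply mul_le_mul hbb _ (norm_nonneg _) (by positivity)
    by_cases hne : n1 = n2
    · rw [if_pos hne]
      have : ‖∑ m ∈ Finset.Ico a' b', eexp (g (m * n1) - g (m * n2))‖ ≤ M := by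
        refine (norm_sum_le _ _).trans ?_
        simp only [norm_eexp, Finset.sum_const, Nat.card_Ico, nsmul_eq_mul, mul_one]
        exact_mod_cast (by omega : b' - a' ≤ M)
      have : 0 ≤ C * M * Z := by positivity
      linarith
    · rw [if_neg hne, zero_add]
      obtain ⟨p1, p2, p3, _⟩ := hprop n1 h1
      obtain ⟨q1, q2, q3, _⟩ := hprop n2 h2
      exact pairBound_ne H M n1 n2 a' b' hM hYM hne p1 p2 q1 q2 ha' hb'
  have expand : (∑ m ∈ Finset.Ico M (2 * M), ‖∑ n ∈ 𝒩, c m n‖ ^ 2) ≤ B ^ 2 * (R * M + R ^ 2 * (C * M * Z)) := by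
    have e : (((∑ m ∈ Finset.Ico M (2 * M), ‖∑ n ∈ 𝒩, c m n‖ ^ 2 : ℝ)) : ℂ) =
        ∑ n1 ∈ 𝒩, ∑ n2 ∈ 𝒩, ∑ m ∈ Finset.Ico M (2 * M), c m n1 * (starRingEnd ℂ) (c m n2) := by
      push_cast
      have : ∀ m ∈ Finset.Ico M (2 * M), ((‖∑ n ∈ 𝒩, c m n‖ : ℂ)) ^ 2 =
          ∑ n1 ∈ 𝒩, ∑ n2 ∈ 𝒩, c m n1 * (starRingEnd ℂ) (c m n2) := by
        intro m _
        rw [← Complex.mul_conj', map_sum, Finset.sum_mul_sum]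
      rw [Finset.sum_congr rfl this, Finset.sum_comm]
      apply Finset.sum_congr rfl; intro n1 _
      rw [Finset.sum_comm]
    have nn : 0 ≤ (∑ m ∈ Finset.Ico M (2 * M), ‖∑ n ∈ 𝒩, c m n‖ ^ 2 : ℝ) := Finset.sum_nonneg (fun _ _ => by positivity)
    have e2 : (∑ m ∈ Finset.Ico M (2 * M), ‖∑ n ∈ 𝒩, c m n‖ ^ 2 : ℝ) =
        ‖((∑ m ∈ Finset.Ico M (2 * M), ‖∑ n ∈ 𝒩, c m n‖ ^ 2 : ℝ) : ℂ)‖ := by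
      rw [Complex.norm_real, Real.norm_of_nonneg nn]
    rw [e2, e]
    calc _ ≤ ∑ n1 ∈ 𝒩, ∑ n2 ∈ 𝒩, B ^ 2 * ((if n1 = n2 then (M:ℝ) else 0) + C * M * Z) := by
          refine (norm_sum_le _ _).trans (Finset.sum_le_sum (fun n1 h1 => ?_))
          exact (norm_sum_le _ _).trans (Finset.sum_le_sum (fun n2 h2 => inner n1 h1 n2 h2))
      _ = _ := by
          simp only [← Finset.mul_sum, Finset.sum_add_distrib, Finset.sum_ite_eq, Finset.sum_const, nsmul_eq_mul]
          rw [Finset.sum_congr rfl (fun n1 h1 => if_pos h1)]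
          simp only [Finset.sum_const, nsmul_eq_mul]
          rw [← hR]; ring
  have hMM : (Y:ℝ) * M ≤ 2 * Y ^ 2 * Z := by
    obtain ⟨p1, p2, p3, p4, p5⟩ := hprop n0 hn0
    have hn0r : (Y:ℝ) ^ (1/3:ℝ) ≤ n0 := by
      have : (Y:ℝ) ≤ (n0:ℝ) ^ 3 := by exact_mod_cast p5
      calc (Y:ℝ) ^ (1/3:ℝ) ≤ ((n0:ℝ)^3) ^ (1/3:ℝ) := Real.rpow_le_rpow hY0.le this (by norm_num)
        _ = n0 := by rw [← Real.rpow_natCast, ← Real.rpow_mul (by positivity)]; norm_num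
    have h3 : 1 ≤ Z * (Y:ℝ) ^ (1/3:ℝ) := by
      rw [hZ, ← Real.rpow_add hY0]; exact Real.one_le_rpow hY1 (by norm_num)
    have h4 : (M:ℝ) * n0 ≤ 2 * Y := by exact_mod_cast p2
    have h5 : (M:ℝ) ≤ 2 * Y * Z := by
      calc (M:ℝ) ≤ M * (Z * (Y:ℝ) ^ (1/3:ℝ)) := le_mul_of_one_le_right hM0.le h3
        _ = Z * (M * (Y:ℝ) ^ (1/3:ℝ)) := by ring
        _ ≤ Z * (M * n0) := by gcongr
        _ ≤ Z * (2 * Y) := by gcongr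
        _ = _ := by ring
    calc (Y:ℝ) * M ≤ Y * (2 * Y * Z) := by gcongr
      _ = _ := by ring
  have fin : ‖∑ m ∈ Finset.Ico M (2 * M), a m * ∑ n ∈ 𝒩, c m n‖ ^ 2 ≤ (B ^ 2 * ((2 + 2 * C) * (Y:ℝ) ^ (1 - 277/10000 : ℝ))) ^ 2 := by
    have hR0 : 0 ≤ R := by positivity
    calc _ ≤ (B ^ 2 * M) * (B ^ 2 * (R * M + R ^ 2 * (C * M * Z))) := cs.trans (by gcongr)
      _ = B ^ 4 * ((R * M) * M + (R * M) ^ 2 * (C * Z)) := by ring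
      _ ≤ B ^ 4 * ((2 * Y) * M + (2 * Y) ^ 2 * (C * Z)) := by gcongr
      _ ≤ B ^ 4 * ((2 + 2 * C) ^ 2 * (Y ^ 2 * Z)) := by
          gcongr
          have w0 : 0 ≤ (Y:ℝ) ^ 2 * Z := by positivity
          have w1 : 0 ≤ C * ((Y:ℝ) ^ 2 * Z) := by positivity
          have w2 : 0 ≤ C ^ 2 * ((Y:ℝ) ^ 2 * Z) := by positivity
          linarith
      _ ≤ B ^ 4 * ((2 + 2 * C) ^ 2 * ((Y:ℝ) ^ (1 - 277/10000 : ℝ)) ^ 2) := by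
          gcongr
          rw [hZ, ← Real.rpow_natCast, ← Real.rpow_natCast, ← Real.rpow_mul hY0.le, ← Real.rpow_add hY0]
          exact Real.rpow_le_rpow_of_exponent_le hY1 (by norm_num)
      _ = _ := by ring
  exact le_of_pow_le_pow_left₀ (by norm_num) (by positivity) fin


lemma dyadic_sum (f : ℕ → ℂ) (J : ℕ) :
    ∑ m ∈ Finset.Ico 1 (2 ^ J), f m = ∑ j ∈ Finset.range J, ∑ m ∈ Finset.Ico (2 ^ j) (2 * 2 ^ j), f m := by
  induction J with
  | zero => simp
  | succ J ih =>
    rw [Finset.sum_range_succ, ← ih, pow_succ, mul_comm (2 ^ J) 2,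
      Finset.sum_Ico_consecutive _ (Nat.one_le_two_pow) (by omega)]

lemma log2_bound (Y : ℕ) (hY : 1 ≤ Y) : ((Nat.log 2 (2 * Y) + 1 : ℕ) : ℝ) ≤ 20002 * (Y:ℝ) ^ (1/10000:ℝ) := by
  have hY1 : (1:ℝ) ≤ Y := by exact_mod_cast hY
  rw [mul_comm 2 Y, Nat.log_mul_base (by norm_num) (by omega)]
  push_cast
  have h1 : (Nat.log 2 Y : ℝ) ≤ Real.logb 2 Y := by
    have := Real.natLog_le_logb Y 2; simpa using this
  have h2 : Real.logb 2 Y ≤ 2 * Real.log Y := by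
    rw [Real.logb, div_le_iff₀ (Real.log_pos (by norm_num))]
    nlinarith [Real.log_two_gt_d9, Real.log_nonneg hY1]
  have h3 := Real.log_le_rpow_div (x := (Y:ℝ)) (by linarith) (show (0:ℝ) < 1/10000 by norm_num)
  rw [div_div_eq_mul_div, div_one] at h3
  have h4 : 1 ≤ (Y:ℝ) ^ (1/10000:ℝ) := Real.one_le_rpow hY1 (by norm_num)
  linarith

lemma typeII_half {C : ℝ} (hC : 1 ≤ C) {Y : ℕ} (hY : 1 ≤ Y) {g : ℕ → ℝ} (H : PairBound C Y g) (B : ℝ) (hB : 0 ≤ B)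
    (a b : ℕ → ℂ) (ha : ∀ m ≤ 2 * Y, ‖a m‖ ≤ B) (hb : ∀ m ≤ 2 * Y, ‖b m‖ ≤ B)
    (Q : ℕ → ℕ → Prop) [∀ m n, Decidable (Q m n)] (hQ : ∀ n x y z, Q x n → Q z n → x ≤ y → y ≤ z → Q y n)
    (hQ1 : ∀ m n, Q m n → Y < m * n ∧ m * n ≤ 2 * Y ∧ n ≤ m ∧ Y ≤ n ^ 3) :
    ‖∑ m ∈ Finset.range (2 * Y + 1), ∑ n ∈ Finset.range (2 * Y + 1), (if Q m n then a m * b n * eexp (g (m * n)) else 0)‖ ≤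
      B ^ 2 * ((2 + 2 * C) * 20002 * (Y:ℝ) ^ (1 - 276/10000 : ℝ)) := by
  have hY1 : (1:ℝ) ≤ Y := by exact_mod_cast hY
  have hY0 : (0:ℝ) < Y := by linarith
  set f : ℕ → ℂ := fun m => ∑ n ∈ Finset.range (2 * Y + 1), (if Q m n then a m * b n * eexp (g (m * n)) else 0) with hf
  have hf0 : f 0 = 0 := by
    apply Finset.sum_eq_zero; intro n _; rw [if_neg]; intro h; have := (hQ1 _ _ h).1; simp at this
  have hf1 : ∀ m, 2 * Y < m → f m = 0 := by
    intro m hm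
    apply Finset.sum_eq_zero; intro n _; rw [if_neg]; intro h
    obtain ⟨h1, h2, h3, h4⟩ := hQ1 _ _ h
    have : n ≠ 0 := by rintro rfl; simp at h1
    have : 1 ≤ n := by omega
    nlinarith
  set J := Nat.log 2 (2 * Y) + 1 with hJ
  have hJ2 : 2 * Y < 2 ^ J := Nat.lt_pow_succ_log_self (by norm_num) _
  have e : ∑ m ∈ Finset.range (2 * Y + 1), f m = ∑ m ∈ Finset.Ico 1 (2 ^ J), f m := by
    rw [Finset.range_eq_Ico, Finset.sum_eq_sum_Ico_succ_bot (by omega), hf0, zero_add]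
    rw [← Finset.sum_Ico_consecutive f (show 1 ≤ 2 * Y + 1 by omega) hJ2]
    rw [Finset.sum_eq_zero (s := Finset.Ico (2 * Y + 1) (2 ^ J)), add_zero]
    intro m hm; rw [Finset.mem_Ico] at hm; exact hf1 m (by omega)
  rw [e, dyadic_sum]
  calc _ ≤ ∑ j ∈ Finset.range J, B ^ 2 * ((2 + 2 * C) * (Y:ℝ) ^ (1 - 277/10000 : ℝ)) := by
        refine (norm_sum_le _ _).trans (Finset.sum_le_sum (fun j _ => ?_))
        exact typeII_block hC hY H B hB a b ha hb (2 ^ j) Nat.one_le_two_pow Q hQ hQ1 _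
    _ = B ^ 2 * ((2 + 2 * C) * (Y:ℝ) ^ (1 - 277/10000 : ℝ)) * (J:ℝ) := by
        rw [Finset.sum_const, Finset.card_range, nsmul_eq_mul]; ring
    _ ≤ B ^ 2 * ((2 + 2 * C) * (Y:ℝ) ^ (1 - 277/10000 : ℝ)) * (20002 * (Y:ℝ) ^ (1/10000:ℝ)) := by
        gcongr; exact log2_bound Y hY
    _ = B ^ 2 * ((2 + 2 * C) * 20002 * ((Y:ℝ) ^ (1 - 277/10000 : ℝ) * (Y:ℝ) ^ (1/10000:ℝ))) := by ring
    _ = _ := by rw [← Real.rpow_add hY0]; norm_num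

lemma typeII_full {C : ℝ} (hC : 1 ≤ C) {Y : ℕ} (hY : 1 ≤ Y) {g : ℕ → ℝ} (H : PairBound C Y g) (B : ℝ) (hB : 0 ≤ B)
    (a b : ℕ → ℂ) (ha : ∀ m ≤ 2 * Y, ‖a m‖ ≤ B) (hb : ∀ m ≤ 2 * Y, ‖b m‖ ≤ B) (Y' U : ℕ) (hY' : Y' ≤ 2 * Y)
    (hU : Y < (U + 1) ^ 3) :
    ‖∑ m ∈ Finset.range (2 * Y + 1), ∑ n ∈ Finset.range (2 * Y + 1),
      (if (Y < m * n ∧ m * n ≤ Y' ∧ U < m ∧ U < n) then a m * b n * eexp (g (m * n)) else 0)‖ ≤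
      B ^ 2 * ((2 + 2 * C) * 40004 * (Y:ℝ) ^ (1 - 276/10000 : ℝ)) := by
  have hU3 : ∀ n, U < n → Y ≤ n ^ 3 := by
    intro n hn
    have : (U + 1) ^ 3 ≤ n ^ 3 := Nat.pow_le_pow_left hn 3
    omega
  have h1 := typeII_half hC hY H B hB a b ha hb
    (fun m n => (Y < m * n ∧ m * n ≤ Y' ∧ U < m ∧ U < n) ∧ n ≤ m)
    (by
      rintro n x y z ⟨⟨x1, x2, x3, x4⟩, x5⟩ ⟨⟨z1, z2, z3, z4⟩, z5⟩ hxy hyz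
      refine ⟨⟨?_, ?_, by omega, by omega⟩, by omega⟩
      · nlinarith
      · nlinarith)
    (by
      rintro m n ⟨⟨x1, x2, x3, x4⟩, x5⟩
      exact ⟨x1, x2.trans hY', x5, hU3 n x4⟩)
  have h2 := typeII_half hC hY H B hB b a hb ha
    (fun n m => (Y < m * n ∧ m * n ≤ Y' ∧ U < m ∧ U < n) ∧ m < n)
    (by
      rintro m x y z ⟨⟨x1, x2, x3, x4⟩, x5⟩ ⟨⟨z1, z2, z3, z4⟩, z5⟩ hxy hyz
      refine ⟨⟨?_, ?_, by omega, by omega⟩, by omega⟩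
      · nlinarith
      · nlinarith)
    (by
      rintro n m ⟨⟨x1, x2, x3, x4⟩, x5⟩
      rw [mul_comm n m]
      exact ⟨x1, x2.trans hY', x5.le, hU3 m x3⟩)
  rw [Finset.sum_comm] at h2
  have e : ∑ m ∈ Finset.range (2 * Y + 1), ∑ n ∈ Finset.range (2 * Y + 1),
      (if (Y < m * n ∧ m * n ≤ Y' ∧ U < m ∧ U < n) then a m * b n * eexp (g (m * n)) else 0) =
      (∑ m ∈ Finset.range (2 * Y + 1), ∑ n ∈ Finset.range (2 * Y + 1),
      (if ((Y < m * n ∧ m * n ≤ Y' ∧ U < m ∧ U < n) ∧ n ≤ m) then a m * b n * eexp (g (m * n)) else 0)) +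
      ∑ m ∈ Finset.range (2 * Y + 1), ∑ n ∈ Finset.range (2 * Y + 1),
      (if ((Y < m * n ∧ m * n ≤ Y' ∧ U < m ∧ U < n) ∧ m < n) then b n * a m * eexp (g (n * m)) else 0) := by
    rw [← Finset.sum_add_distrib]
    apply Finset.sum_congr rfl; intro m _
    rw [← Finset.sum_add_distrib]
    apply Finset.sum_congr rfl; intro n _
    by_cases h : (Y < m * n ∧ m * n ≤ Y' ∧ U < m ∧ U < n)
    · rcases le_or_gt n m with h' | h'
      · simp only [h, h', not_lt.2 h', and_self, and_false, if_true, if_false, add_zero]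
      · simp only [h, h', not_le.2 h', and_self, and_false, if_true, if_false, zero_add]
        rw [mul_comm n m]; ring
    · simp only [h, false_and, if_false, add_zero]
  rw [e]
  refine (norm_add_le _ _).trans ?_
  refine (add_le_add h1 h2).trans (le_of_eq ?_)
  ring

lemma abel_range (z : ℕ → ℂ) (w : ℕ → ℝ) (K : ℕ) (X : ℝ) (hX : ∀ c ≤ K, ‖∑ i ∈ Finset.range c, z i‖ ≤ X) :
    ‖∑ i ∈ Finset.range K, (w i : ℂ) * z i‖ ≤ X * (|w (K - 1)| + ∑ i ∈ Finset.range (K - 1), |w (i + 1) - w i|) := by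
  have h := Finset.sum_range_by_parts (fun i => (w i : ℂ)) z K
  simp only [smul_eq_mul] at h
  rw [h]
  refine (norm_sub_le _ _).trans ?_
  rw [mul_add]
  apply add_le_add
  · rw [norm_mul, Complex.norm_real, Real.norm_eq_abs, mul_comm]
    gcongr
    exact hX K le_rfl
  · refine (norm_sum_le _ _).trans ?_
    rw [Finset.mul_sum]
    apply Finset.sum_le_sum
    intro i hi
    rw [Finset.mem_range] at hi
    rw [norm_mul, ← Complex.ofReal_sub, Complex.norm_real, Real.norm_eq_abs, mul_comm]
    gcongr
    exact hX _ (by omega)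

lemma abel_mono (z : ℕ → ℂ) (w : ℕ → ℝ) (a b : ℕ) (X W : ℝ) (hX : ∀ c ≤ b, ‖∑ i ∈ Finset.Ico a c, z i‖ ≤ X)
    (hw : ∀ i, a ≤ i → i + 1 < b → w i ≤ w (i + 1)) (hw0 : ∀ i, a ≤ i → i < b → 0 ≤ w i ∧ w i ≤ W) (hW : 0 ≤ W) :
    ‖∑ i ∈ Finset.Ico a b, (w i : ℂ) * z i‖ ≤ X * (2 * W) := by
  have hX0 : 0 ≤ X := (norm_nonneg _).trans (hX b le_rfl)
  rcases le_or_gt b a with h | h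
  · rw [Finset.Ico_eq_empty (by omega)]; simp; positivity
  rw [Finset.sum_Ico_eq_sum_range]
  have := abel_range (fun i => z (a + i)) (fun i => w (a + i)) (b - a) X (by
    intro c hc
    have := hX (a + c) (by omega)
    rw [Finset.sum_Ico_eq_sum_range] at this
    simpa using this)
  refine this.trans ?_
  gcongr
  have e : ∑ i ∈ Finset.range (b - a - 1), |w (a + (i + 1)) - w (a + i)| = w (a + (b - a - 1)) - w (a + 0) := by
    rw [← Finset.sum_range_sub (fun i => w (a + i))]
    apply Finset.sum_congr rfl; intro i hi
    rw [Finset.mem_range] at hi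
    rw [abs_of_nonneg]
    have := hw (a + i) (by omega) (by omega)
    rw [← add_assoc]; linarith
  rw [e]
  have h1 := hw0 (a + (b - a - 1)) (by omega) (by omega)
  have h2 := hw0 (a + 0) (by omega) (by omega)
  rw [abs_of_nonneg h1.1]; linarith

lemma abel_anti (z : ℕ → ℂ) (w : ℕ → ℝ) (a b : ℕ) (X W : ℝ) (hX : ∀ c ≤ b, ‖∑ i ∈ Finset.Ico a c, z i‖ ≤ X)
    (hw : ∀ i, a ≤ i → i + 1 < b → w (i + 1) ≤ w i) (hw0 : ∀ i, a ≤ i → i < b → 0 ≤ w i ∧ w i ≤ W) (hW : 0 ≤ W) :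
    ‖∑ i ∈ Finset.Ico a b, (w i : ℂ) * z i‖ ≤ X * (2 * W) := by
  have hX0 : 0 ≤ X := (norm_nonneg _).trans (hX b le_rfl)
  rcases le_or_gt b a with h | h
  · rw [Finset.Ico_eq_empty (by omega)]; simp; positivity
  rw [Finset.sum_Ico_eq_sum_range]
  have := abel_range (fun i => z (a + i)) (fun i => w (a + i)) (b - a) X (by
    intro c hc
    have := hX (a + c) (by omega)
    rw [Finset.sum_Ico_eq_sum_range] at this
    simpa using this)
  refine this.trans ?_
  gcongr
  have e : ∑ i ∈ Finset.range (b - a - 1), |w (a + (i + 1)) - w (a + i)| = w (a + 0) - w (a + (b - a - 1)) := by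
    rw [← Finset.sum_range_sub' (fun i => w (a + i))]
    apply Finset.sum_congr rfl; intro i hi
    rw [Finset.mem_range] at hi
    rw [abs_of_nonpos]
    · ring
    have := hw (a + i) (by omega) (by omega)
    rw [← add_assoc]; linarith
  rw [e]
  have h1 := hw0 (a + (b - a - 1)) (by omega) (by omega)
  have h2 := hw0 (a + 0) (by omega) (by omega)
  rw [abs_of_nonneg h1.1]; linarith

lemma typeI {C : ℝ} (hC : 1 ≤ C) {Y : ℕ} (hY : 1 ≤ Y) {g : ℕ → ℝ} (H : PairBound C Y g) (B W : ℝ) (hB : 0 ≤ B) (hW : 0 ≤ W)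
    (b : ℕ → ℂ) (w : ℕ → ℝ) (hb : ∀ m ≤ 2 * Y, ‖b m‖ ≤ B) (hw : ∀ i, 1 ≤ i → w i ≤ w (i + 1))
    (hw0 : ∀ i, 1 ≤ i → i ≤ 2 * Y → 0 ≤ w i ∧ w i ≤ W) (Y' U : ℕ) (hYY : Y ≤ Y') (hY' : Y' ≤ 2 * Y)
    (hU : U ^ 3 ≤ Y) :
    ‖∑ m ∈ Finset.range (2 * Y + 1), ∑ n ∈ Finset.range (2 * Y + 1),
      (if (Y < m * n ∧ m * n ≤ Y' ∧ m ≤ U) then b m * (w n:ℂ) * eexp (g (m * n)) else 0)‖ ≤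
      B * W * (8008 * C * (Y:ℝ) ^ (1 - 5/100 : ℝ)) := by
  have hY1 : (1:ℝ) ≤ Y := by exact_mod_cast hY
  have hY0 : (0:ℝ) < Y := by linarith
  have hUY : U ≤ Y := by
    rcases Nat.eq_zero_or_pos U with h | h
    · omega
    · exact (Nat.le_self_pow (by norm_num) U).trans hU
  set Z : ℝ := (Y:ℝ) ^ (-(555/10000):ℝ) with hZ
  have hZ0 : 0 < Z := Real.rpow_pos_of_pos hY0 _
  have main : ∀ m ∈ Finset.Ico 1 (U + 1), ‖∑ n ∈ Finset.range (2 * Y + 1),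
      (if (Y < m * n ∧ m * n ≤ Y' ∧ m ≤ U) then b m * (w n:ℂ) * eexp (g (m * n)) else 0)‖ ≤
      B * (4 * W * C * Y * Z) * (1 / (m:ℝ)) := by
    intro m hm
    rw [Finset.mem_Ico] at hm
    have hm0 : 0 < m := by omega
    have e : ∑ n ∈ Finset.range (2 * Y + 1),
      (if (Y < m * n ∧ m * n ≤ Y' ∧ m ≤ U) then b m * (w n:ℂ) * eexp (g (m * n)) else 0) =
      b m * ∑ n ∈ Finset.Ico (Y / m + 1) (Y' / m + 1), (w n : ℂ) * eexp (g (m * n)) := by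
      rw [← Finset.sum_filter, Finset.mul_sum]
      apply Finset.sum_congr
      · ext n
        have i1 : Y / m < n ↔ Y < m * n := by rw [Nat.div_lt_iff_lt_mul hm0, mul_comm]
        have i2 : n ≤ Y' / m ↔ m * n ≤ Y' := by rw [Nat.le_div_iff_mul_le hm0, mul_comm]
        rw [Finset.mem_filter, Finset.mem_range, Finset.mem_Ico, Nat.add_one_le_iff, Nat.lt_add_one_iff (m := n) (n := Y' / m), i1, i2]
        constructor
        · rintro ⟨_, h1, h2, _⟩; exact ⟨h1, h2⟩
        · rintro ⟨h1, h2⟩; exact ⟨by nlinarith, h1, h2, by omega⟩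
      · intro n _; ring
    rw [e, norm_mul]
    have hdiv : Y / m * m ≤ Y := Nat.div_mul_le_self Y m
    have hdiv2 : Y < (Y / m + 1) * m := by
      have := Nat.lt_div_mul_add (a := Y) hm0; linarith
    have hd3 : Y' / m + 1 ≤ 2 * (Y / m + 1) := by
      have : Y' / m < 2 * (Y / m + 1) := by
        rw [Nat.div_lt_iff_lt_mul hm0]; nlinarith
      omega
    have hmY : m ≤ Y := by omega
    have hm2 : m ^ 2 ≤ Y := by
      have : m ^ 2 ≤ U ^ 2 := Nat.pow_le_pow_left (by omega) 2
      have : U ^ 2 ≤ U ^ 3 := Nat.pow_le_pow_right (by omega) (by norm_num)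
      omega
    have hYM : Y ≤ 4 * (Y / m + 1) ^ 2 := by
      have h1 : m ≤ Y / m + 1 := by
        by_contra hcon
        push Not at hcon
        have : (Y / m + 1) * m ≤ m * m := by nlinarith
        nlinarith
      nlinarith
    have hX : ∀ c ≤ Y' / m + 1, ‖∑ n ∈ Finset.Ico (Y / m + 1) c, eexp (g (m * n))‖ ≤ C * ((Y / m + 1 : ℕ) : ℝ) * Z := by
      intro c hc
      exact pairBound_single H (Y / m + 1) m (Y / m + 1) c (Nat.le_add_left 1 _) hYM hm0 (by nlinarith) (by nlinarith) le_rfl (hc.trans hd3)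
    have hab := abel_mono (fun n => eexp (g (m * n))) w (Y / m + 1) (Y' / m + 1) _ W hX
      (fun i hi _ => hw i (by omega)) (fun i hi hi2 => hw0 i (by omega) (by
        have : Y' / m ≤ Y' := Nat.div_le_self _ _
        omega)) hW
    have hM : ((Y / m + 1 : ℕ) : ℝ) ≤ 2 * Y * (1 / m) := by
      have hmr : (0:ℝ) < m := by exact_mod_cast hm0
      rw [mul_one_div, le_div_iff₀ hmr]
      exact_mod_cast (by nlinarith : (Y / m + 1) * m ≤ 2 * Y)
    calc _ ≤ B * (C * ((Y / m + 1 : ℕ) : ℝ) * Z * (2 * W)) := by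
          apply mul_le_mul (hb m (by omega)) hab (norm_nonneg _) hB
      _ ≤ B * (C * (2 * Y * (1 / m)) * Z * (2 * W)) := by gcongr
      _ = _ := by ring
  have e : ∑ m ∈ Finset.range (2 * Y + 1), ∑ n ∈ Finset.range (2 * Y + 1),
      (if (Y < m * n ∧ m * n ≤ Y' ∧ m ≤ U) then b m * (w n:ℂ) * eexp (g (m * n)) else 0) =
      ∑ m ∈ Finset.Ico 1 (U + 1), ∑ n ∈ Finset.range (2 * Y + 1),
      (if (Y < m * n ∧ m * n ≤ Y' ∧ m ≤ U) then b m * (w n:ℂ) * eexp (g (m * n)) else 0) := by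
    symm
    apply Finset.sum_subset
    · intro m; rw [Finset.mem_Ico, Finset.mem_range]; omega
    · intro m _ hm
      rw [Finset.mem_Ico] at hm
      apply Finset.sum_eq_zero; intro n _; rw [if_neg]
      rintro ⟨h1, h2, h3⟩
      have : m = 0 := by omega
      subst this; simp at h1
  rw [e]
  calc _ ≤ ∑ m ∈ Finset.Ico 1 (U + 1), B * (4 * W * C * Y * Z) * (1 / (m:ℝ)) :=
        (norm_sum_le _ _).trans (Finset.sum_le_sum main)
    _ = B * (4 * W * C * Y * Z) * ∑ m ∈ Finset.Ico 1 (U + 1), (1 / (m:ℝ)) := by rw [Finset.mul_sum]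
    _ ≤ B * (4 * W * C * Y * Z) * (2002 * (Y:ℝ) ^ (1/2000:ℝ)) := by
        gcongr
        refine (sum_inv_le (U + 1) (2 * Y) (by omega) (by omega)).trans ?_
        exact log_bound Y hY1 (2 * Y) (by omega) (by push_cast; linarith)
    _ = B * W * (8008 * C * (Y * Z * (Y:ℝ) ^ (1/2000:ℝ))) := by ring
    _ ≤ _ := by
        gcongr
        nth_rewrite 1 [← Real.rpow_one (Y:ℝ)]
        rw [hZ, ← Real.rpow_add hY0, ← Real.rpow_add hY0]
        exact Real.rpow_le_rpow_of_exponent_le hY1 (by norm_num)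


lemma card_divisors_bound (ε : ℝ) (hε : 0 < ε) : ∃ C : ℝ, 1 ≤ C ∧ ∀ n : ℕ, n ≠ 0 → (n.divisors.card : ℝ) ≤ C * (n:ℝ) ^ ε := by
  set P0 : ℕ := ⌈(2:ℝ) ^ (1/ε)⌉₊ with hP0
  have hl2 : 0 < Real.log 2 := Real.log_pos (by norm_num)
  set K : ℝ := 1 + 1 / (ε * Real.log 2) with hK
  have hK1 : 1 ≤ K := by rw [hK]; have : 0 < 1 / (ε * Real.log 2) := by positivity
                         linarith
  refine ⟨K ^ P0, one_le_pow₀ hK1, ?_⟩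
  intro n hn
  rw [Nat.card_divisors hn]
  have e : (n:ℝ) ^ ε = ∏ p ∈ n.primeFactors, ((p:ℝ) ^ n.factorization p) ^ ε := by
    rw [Real.finsetProd_rpow _ _ (fun i _ => by positivity)]
    congr 1
    conv_lhs => rw [← Nat.prod_factorization_pow_eq_self hn]
    rw [Finsupp.prod, Nat.support_factorization]
    push_cast; rfl
  have loc : ∀ p ∈ n.primeFactors, ((n.factorization p + 1 : ℕ) : ℝ) ≤
      (if p < P0 then K else 1) * ((p:ℝ) ^ n.factorization p) ^ ε := by
    intro p hp
    have hp2 : (2:ℝ) ≤ p := by exact_mod_cast (Nat.prime_of_mem_primeFactors hp).two_le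
    set a := n.factorization p with ha
    have e1 : ((p:ℝ) ^ a) ^ ε = ((p:ℝ) ^ ε) ^ a := by
      rw [← Real.rpow_natCast, ← Real.rpow_natCast, ← Real.rpow_mul (by positivity), ← Real.rpow_mul (by positivity), mul_comm]
    rw [e1]
    split_ifs with h
    · have h1 : ((2:ℝ) ^ ε) ^ a ≤ ((p:ℝ) ^ ε) ^ a := by gcongr
      have h2 : 1 + a * (ε * Real.log 2) ≤ ((2:ℝ) ^ ε) ^ a := by
        rw [← Real.rpow_natCast, ← Real.rpow_mul (by norm_num), Real.rpow_def_of_pos (by norm_num)]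
        have := Real.add_one_le_exp (Real.log 2 * (ε * a))
        linarith
      have h3 : 0 < ε * Real.log 2 := by positivity
      calc ((a + 1 : ℕ) : ℝ) ≤ K * (1 + a * (ε * Real.log 2)) := by
            rw [hK]; push_cast
            have e5 : (1 + 1 / (ε * Real.log 2)) * (1 + a * (ε * Real.log 2)) =
              1 + a * (ε * Real.log 2) + 1 / (ε * Real.log 2) + a := by field_simp; ring
            rw [e5]
            have : 0 < 1 / (ε * Real.log 2) := by positivity
            have : 0 ≤ a * (ε * Real.log 2) := by positivity
            linarith
        _ ≤ K * ((p:ℝ) ^ ε) ^ a := by gcongr; linarith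
    · push Not at h
      have h1 : (2:ℝ) ^ (1/ε) ≤ p := (Nat.le_ceil _).trans (by exact_mod_cast h)
      have h2 : (2:ℝ) ≤ (p:ℝ) ^ ε := by
        calc (2:ℝ) = ((2:ℝ) ^ (1/ε)) ^ ε := by
              rw [← Real.rpow_mul (by norm_num)]; field_simp; simp
          _ ≤ _ := by gcongr
      rw [one_mul]
      calc ((a + 1 : ℕ) : ℝ) ≤ (2:ℝ) ^ a := by exact_mod_cast Nat.lt_two_pow_self
        _ ≤ _ := by gcongr
  push_cast at loc ⊢
  calc _ ≤ ∏ p ∈ n.primeFactors, (if p < P0 then K else 1) * ((p:ℝ) ^ n.factorization p) ^ ε :=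
        Finset.prod_le_prod (fun i _ => by positivity) loc
    _ = (∏ p ∈ n.primeFactors, (if p < P0 then K else 1)) * (n:ℝ) ^ ε := by rw [Finset.prod_mul_distrib, e]
    _ ≤ _ := by
      gcongr
      rw [← Finset.prod_filter, Finset.prod_const]
      apply pow_le_pow_right₀ hK1
      calc _ ≤ (Finset.range P0).card := Finset.card_le_card (by
            intro p hp; rw [Finset.mem_filter] at hp; exact Finset.mem_range.2 hp.2)
        _ = P0 := Finset.card_range _

open ArithmeticFunction in
lemma conv_sum (f g : ArithmeticFunction ℝ) (G : ℕ → ℂ) (Y Y' : ℕ) (hY : Y' ≤ 2 * Y) :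
    ∑ n ∈ Finset.Ioc Y Y', (((f * g) n : ℝ) : ℂ) * G n =
    ∑ m ∈ Finset.range (2 * Y + 1), ∑ n ∈ Finset.range (2 * Y + 1),
      (if (Y < m * n ∧ m * n ≤ Y') then (f m : ℂ) * (g n : ℂ) * G (m * n) else 0) := by
  have e : ∀ N ∈ Finset.Ioc Y Y', (((f * g) N : ℝ) : ℂ) * G N = ∑ m ∈ Finset.range (2 * Y + 1), ∑ n ∈ Finset.range (2 * Y + 1),
      (if m * n = N then (f m : ℂ) * (g n : ℂ) * G (m * n) else 0) := by
    intro N hN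
    rw [Finset.mem_Ioc] at hN
    rw [ArithmeticFunction.mul_apply, ← Finset.sum_product', ← Finset.sum_filter]
    push_cast
    rw [Finset.sum_mul]
    apply Finset.sum_congr
    · ext ⟨m, n⟩
      simp only [Nat.mem_divisorsAntidiagonal, Finset.mem_filter, Finset.mem_product, Finset.mem_range]
      constructor
      · rintro ⟨h1, h2⟩
        have hm : m ∣ N := ⟨n, h1.symm⟩
        have hn : n ∣ N := ⟨m, by rw [mul_comm]; exact h1.symm⟩
        have := Nat.le_of_dvd (by omega) hm
        have := Nat.le_of_dvd (by omega) hn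
        exact ⟨⟨by omega, by omega⟩, h1⟩
      · rintro ⟨_, h⟩; exact ⟨h, by omega⟩
    · rintro ⟨m, n⟩ h
      rw [Finset.mem_filter] at h
      simp only at h ⊢
      rw [h.2]
  rw [Finset.sum_congr rfl e, Finset.sum_comm]
  apply Finset.sum_congr rfl; intro m _
  rw [Finset.sum_comm]
  apply Finset.sum_congr rfl; intro n _
  rw [Finset.sum_ite_eq]
  simp only [Finset.mem_Ioc]

open ArithmeticFunction in
lemma vaughan_id (L1 L2 m1 m2 : ArithmeticFunction ℝ) (hL : L1 + L2 = vonMangoldt)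
    (hm : m1 + m2 = ((moebius : ArithmeticFunction ℤ) : ArithmeticFunction ℝ)) :
    vonMangoldt = L1 + m1 * log - (L1 * m1) * (zeta : ArithmeticFunction ℝ) + L2 * (m2 * (zeta : ArithmeticFunction ℝ)) := by
  have h1 : (m1 + m2) * (zeta : ArithmeticFunction ℝ) = 1 := by
    rw [hm]; exact ArithmeticFunction.coe_moebius_mul_coe_zeta
  have h2 : log = (L1 + L2) * (zeta : ArithmeticFunction ℝ) := by rw [hL, vonMangoldt_mul_zeta]
  rw [← hL, h2]
  linear_combination (-L2) * h1


noncomputable def afLE (U : ℕ) (f : ArithmeticFunction ℝ) : ArithmeticFunction ℝ :=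
  ⟨fun n => if n ≤ U then f n else 0, by simp⟩

noncomputable def afGT (U : ℕ) (f : ArithmeticFunction ℝ) : ArithmeticFunction ℝ :=
  ⟨fun n => if U < n then f n else 0, by simp⟩

lemma afLE_apply (U : ℕ) (f : ArithmeticFunction ℝ) (n : ℕ) : afLE U f n = if n ≤ U then f n else 0 := rfl
lemma afGT_apply (U : ℕ) (f : ArithmeticFunction ℝ) (n : ℕ) : afGT U f n = if U < n then f n else 0 := rfl

lemma afLE_add_afGT (U : ℕ) (f : ArithmeticFunction ℝ) : afLE U f + afGT U f = f := by
  ext n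
  rw [ArithmeticFunction.add_apply, afLE_apply, afGT_apply]
  rcases le_or_gt n U with h | h
  · simp [h, not_lt.2 h]
  · simp [h, not_le.2 h]

lemma exists_cuberoot (Y : ℕ) : ∃ U : ℕ, U ^ 3 ≤ Y ∧ Y < (U + 1) ^ 3 := by
  have hex : ∃ U, Y < (U + 1) ^ 3 := ⟨Y, by
    have := Nat.le_self_pow (show 3 ≠ 0 by norm_num) (Y + 1); omega⟩
  refine ⟨Nat.find hex, ?_, Nat.find_spec hex⟩
  rcases Nat.eq_zero_or_pos (Nat.find hex) with h | h
  · rw [h]; simp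
  · have := Nat.find_min hex (m := Nat.find hex - 1) (by omega)
    rw [Nat.sub_add_cancel h] at this
    omega

open ArithmeticFunction in
lemma lambda_sum : ∃ D : ℝ, 1 ≤ D ∧ ∀ (C : ℝ) (Y Y' : ℕ) (g : ℕ → ℝ), 1 ≤ C → 1 ≤ Y → Y ≤ Y' → Y' ≤ 2 * Y →
    PairBound C Y g → ‖∑ n ∈ Finset.Ioc Y Y', ((vonMangoldt n : ℝ) : ℂ) * eexp (g n)‖ ≤
      D * C * (Y:ℝ) ^ (1 - 275/10000 : ℝ) := by
  obtain ⟨Dd, hDd, hdiv⟩ := card_divisors_bound (1/20000) (by norm_num)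
  set D0 : ℝ := 2 * Dd + 20002 with hD0
  have hD01 : 1 ≤ D0 := by linarith
  refine ⟨400000 * D0 ^ 2, by nlinarith, ?_⟩
  intro C Y Y' g hC hY hYY hY' H
  have hY1 : (1:ℝ) ≤ Y := by exact_mod_cast hY
  have hY0 : (0:ℝ) < Y := by linarith
  obtain ⟨U, hU1, hU2⟩ := exists_cuberoot Y
  have hUY : U ≤ Y := by
    rcases Nat.eq_zero_or_pos U with h | h
    · omega
    · exact (Nat.le_self_pow (by norm_num) U).trans hU1
  set B : ℝ := D0 * (Y:ℝ) ^ (1/20000:ℝ) with hB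
  have hYp : 1 ≤ (Y:ℝ) ^ (1/20000:ℝ) := Real.one_le_rpow hY1 (by norm_num)
  have hB1 : 1 ≤ B := by nlinarith
  have hB0 : 0 ≤ B := by linarith
  have blog : ∀ m : ℕ, m ≤ 2 * Y → Real.log m ≤ B := by
    intro m hm
    rcases Nat.eq_zero_or_pos m with h | h
    · subst h; simpa using hB0
    have h1 : Real.log m ≤ Real.log (2 * Y) := Real.log_le_log (by exact_mod_cast h) (by exact_mod_cast hm)
    rw [Real.log_mul (by norm_num) (by linarith)] at h1
    have h2 := Real.log_le_rpow_div (x := (Y:ℝ)) (by linarith) (show (0:ℝ) < 1/20000 by norm_num)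
    have h3 : Real.log 2 ≤ 1 := by linarith [Real.log_two_lt_d9]
    rw [div_div_eq_mul_div, div_one] at h2
    rw [hB]; nlinarith
  have bdiv : ∀ m : ℕ, m ≤ 2 * Y → (m.divisors.card : ℝ) ≤ B := by
    intro m hm
    rcases Nat.eq_zero_or_pos m with h | h
    · subst h; simpa using hB0
    have h1 := hdiv m (by omega)
    have h2 : (m:ℝ) ^ (1/20000:ℝ) ≤ 2 * (Y:ℝ) ^ (1/20000:ℝ) := by
      calc (m:ℝ) ^ (1/20000:ℝ) ≤ (2 * Y) ^ (1/20000:ℝ) := by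
            apply Real.rpow_le_rpow (by positivity) (by exact_mod_cast hm) (by norm_num)
        _ = 2 ^ (1/20000:ℝ) * (Y:ℝ) ^ (1/20000:ℝ) := Real.mul_rpow (by norm_num) (by linarith)
        _ ≤ 2 ^ (1:ℝ) * (Y:ℝ) ^ (1/20000:ℝ) := by
            gcongr
            · norm_num
            · norm_num
        _ = _ := by rw [Real.rpow_one]
    rw [hB]
    calc _ ≤ Dd * (2 * (Y:ℝ) ^ (1/20000:ℝ)) := h1.trans (by gcongr)
      _ = (2 * Dd) * (Y:ℝ) ^ (1/20000:ℝ) := by ring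
      _ ≤ _ := by gcongr; linarith
  set μr : ArithmeticFunction ℝ := ((moebius : ArithmeticFunction ℤ) : ArithmeticFunction ℝ) with hμr
  have hμ : ∀ m, |μr m| ≤ 1 := by
    intro m
    rw [hμr, ArithmeticFunction.intCoe_apply]
    exact_mod_cast ArithmeticFunction.abs_moebius_le_one
  set L1 := afLE U vonMangoldt with hL1
  set L2 := afGT U vonMangoldt with hL2
  set m1 := afLE U μr with hm1
  set m2 := afGT U μr with hm2
  have hm1b : ∀ m, |m1 m| ≤ 1 := by
    intro m; rw [hm1, afLE_apply]; split_ifs; exact hμ m; simp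
  have hm2b : ∀ m, |m2 m| ≤ 1 := by
    intro m; rw [hm2, afGT_apply]; split_ifs; exact hμ m; simp
  have hL1b : ∀ m, |L1 m| ≤ vonMangoldt m := by
    intro m; rw [hL1, afLE_apply]; split_ifs
    · rw [abs_of_nonneg vonMangoldt_nonneg]
    · simp
  have hid := vaughan_id L1 L2 m1 m2 (afLE_add_afGT U _) (afLE_add_afGT U _)
  set z : ArithmeticFunction ℝ := (zeta : ArithmeticFunction ℝ) with hz
  have hzn : ∀ n : ℕ, 1 ≤ n → z n = 1 := by
    intro n hn; rw [hz, ArithmeticFunction.natCoe_apply, ArithmeticFunction.zeta_apply, if_neg (by omega)]; simp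
  set f3 := L1 * m1 with hf3
  have hf3b : ∀ m ≤ 2 * Y, ‖(f3 m : ℂ)‖ ≤ B := by
    intro m hm
    rw [Complex.norm_real, Real.norm_eq_abs, hf3, ArithmeticFunction.mul_apply]
    refine le_trans ?_ (blog m hm)
    have hsd := Nat.sum_divisorsAntidiagonal (fun i _ => (vonMangoldt i : ℝ)) (n := m)
    rw [← vonMangoldt_sum, ← hsd]
    refine (Finset.abs_sum_le_sum_abs _ _).trans (Finset.sum_le_sum ?_)
    intro x _
    rw [abs_mul]
    calc _ ≤ vonMangoldt x.1 * 1 := mul_le_mul (hL1b _) (hm1b _) (abs_nonneg _) vonMangoldt_nonneg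
      _ = _ := mul_one _
  have hf3s : ∀ m, U ^ 2 < m → f3 m = 0 := by
    intro m hm
    rw [hf3, ArithmeticFunction.mul_apply]
    apply Finset.sum_eq_zero
    intro x hx
    rw [Nat.mem_divisorsAntidiagonal] at hx
    rw [hL1, hm1, afLE_apply, afLE_apply]
    by_cases h1 : x.1 ≤ U
    · by_cases h2 : x.2 ≤ U
      · exfalso
        have : x.1 * x.2 ≤ U * U := Nat.mul_le_mul h1 h2
        rw [hx.1] at this; nlinarith
      · rw [if_neg h2, mul_zero]
    · rw [if_neg h1, zero_mul]
  set f4 := m2 * z with hf4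
  have hf4b : ∀ m ≤ 2 * Y, ‖(f4 m : ℂ)‖ ≤ B := by
    intro m hm
    rw [Complex.norm_real, Real.norm_eq_abs, hf4, ArithmeticFunction.mul_apply]
    refine le_trans ?_ (bdiv m hm)
    refine (Finset.abs_sum_le_sum_abs _ _).trans ?_
    have hsd := Nat.sum_divisorsAntidiagonal (fun _ _ => (1 : ℝ)) (n := m)
    have hcd : ((Nat.divisors m).card : ℝ) = ∑ i ∈ m.divisors, (1:ℝ) := by simp
    rw [hcd, ← hsd]
    refine Finset.sum_le_sum ?_
    intro x hx
    rw [Nat.mem_divisorsAntidiagonal] at hx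
    have : 1 ≤ x.2 := by
      by_contra h
      have : x.2 = 0 := by omega
      rw [this, mul_zero] at hx; exact hx.2 hx.1.symm
    rw [hzn _ this, mul_one]; exact hm2b _
  have hf4s : ∀ m, m ≤ U → f4 m = 0 := by
    intro m hm
    rw [hf4, ArithmeticFunction.mul_apply]
    apply Finset.sum_eq_zero
    intro x hx
    rw [Nat.mem_divisorsAntidiagonal] at hx
    have : x.1 ≤ m := Nat.le_of_dvd (by omega) ⟨x.2, hx.1.symm⟩
    rw [hm2, afGT_apply, if_neg (by omega), zero_mul]
  have e0 : ∀ n ∈ Finset.Ioc Y Y', ((vonMangoldt n : ℝ) : ℂ) * eexp (g n) =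
      (((m1 * log) n : ℝ) : ℂ) * eexp (g n) - (((f3 * z) n : ℝ) : ℂ) * eexp (g n) + (((L2 * f4) n : ℝ) : ℂ) * eexp (g n) := by
    intro n hn
    rw [Finset.mem_Ioc] at hn
    have hL1n : L1 n = 0 := by rw [hL1, afLE_apply, if_neg (by omega)]
    have e : vonMangoldt n = (m1 * log) n - (f3 * z) n + (L2 * f4) n := by
      conv_lhs => rw [hid]
      rw [ArithmeticFunction.add_apply, sub_eq_add_neg, ArithmeticFunction.add_apply, ArithmeticFunction.neg_apply, ArithmeticFunction.add_apply, hL1n, zero_add, ← sub_eq_add_neg]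
    rw [e]; push_cast; ring
  rw [Finset.sum_congr rfl e0, Finset.sum_add_distrib, Finset.sum_sub_distrib,
    conv_sum _ _ (fun n => eexp (g n)) Y Y' hY', conv_sum _ _ (fun n => eexp (g n)) Y Y' hY', conv_sum _ _ (fun n => eexp (g n)) Y Y' hY']
  have A1 := typeI hC hY H 1 B (by norm_num) hB0 (fun m => (m1 m : ℂ)) (fun n => Real.log n)
    (by intro m _; rw [Complex.norm_real]; exact hm1b m)
    (by intro i hi; apply Real.log_le_log (by exact_mod_cast hi); push_cast; linarith)
    (by intro i hi hi2; exact ⟨Real.log_nonneg (by exact_mod_cast hi), blog i hi2⟩) Y' U hYY hY' hU1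
  have A2 := typeI hC hY H B 1 hB0 (by norm_num) (fun m => (f3 m : ℂ)) (fun n => 1)
    hf3b (by intro i hi; exact le_rfl)
    (by intro i hi hi2; norm_num) Y' U hYY hY' hU1
  have A3 := typeII_full hC hY H B hB0 (fun m => (f3 m : ℂ)) (fun n => 1) hf3b (by intro m _; simpa using hB1) Y' U hY' hU2
  have A4 := typeII_full hC hY H B hB0 (fun m => (L2 m : ℂ)) (fun n => (f4 n : ℂ)) (by
    intro m hm
    rw [Complex.norm_real, Real.norm_eq_abs, hL2, afGT_apply]
    split_ifs
    · rw [abs_of_nonneg vonMangoldt_nonneg]; exact vonMangoldt_le_log.trans (blog m hm)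
    · simpa using hB0) hf4b Y' U hY' hU2
  have E1 : ∀ m ∈ Finset.range (2 * Y + 1), ∀ n ∈ Finset.range (2 * Y + 1),
      (if (Y < m * n ∧ m * n ≤ Y') then (m1 m : ℂ) * ((log n : ℝ) : ℂ) * eexp (g (m * n)) else 0) =
      (if (Y < m * n ∧ m * n ≤ Y' ∧ m ≤ U) then (m1 m : ℂ) * ((Real.log n : ℝ):ℂ) * eexp (g (m * n)) else 0) := by
    intro m _ n _
    rw [log_apply]
    by_cases h : m ≤ U
    · simp only [h, and_true]
    · have : m1 m = 0 := by rw [hm1, afLE_apply, if_neg h]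
      simp [this]
  have E2 : ∀ m ∈ Finset.range (2 * Y + 1), ∀ n ∈ Finset.range (2 * Y + 1),
      (if (Y < m * n ∧ m * n ≤ Y') then (f3 m : ℂ) * ((z n : ℝ) : ℂ) * eexp (g (m * n)) else 0) =
      (if (Y < m * n ∧ m * n ≤ Y' ∧ m ≤ U) then (f3 m : ℂ) * (((1:ℝ)):ℂ) * eexp (g (m * n)) else 0) +
      (if (Y < m * n ∧ m * n ≤ Y' ∧ U < m ∧ U < n) then (f3 m : ℂ) * 1 * eexp (g (m * n)) else 0) := by
    intro m _ n _
    by_cases h : (Y < m * n ∧ m * n ≤ Y')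
    · have hn : 1 ≤ n := by
        by_contra hc
        have : n = 0 := by omega
        subst this; simp at h
      rw [hzn n hn, if_pos h]
      by_cases hm : m ≤ U
      · rw [if_pos ⟨h.1, h.2, hm⟩, if_neg (by omega), add_zero]
      · rw [if_neg (by tauto), zero_add]
        by_cases hn2 : U < n
        · rw [if_pos ⟨h.1, h.2, by omega, hn2⟩]; simp
        · rw [if_neg (by tauto)]
          have : U ^ 2 < m := by
            by_contra hcc
            push Not at hcc hn2
            have : m * n ≤ U ^ 2 * U := Nat.mul_le_mul hcc hn2
            have : U ^ 2 * U = U ^ 3 := by ring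
            omega
          rw [hf3s m this]; simp
    · rw [if_neg h, if_neg (by tauto), if_neg (by tauto), add_zero]
  have E4 : ∀ m ∈ Finset.range (2 * Y + 1), ∀ n ∈ Finset.range (2 * Y + 1),
      (if (Y < m * n ∧ m * n ≤ Y') then (L2 m : ℂ) * ((f4 n : ℝ) : ℂ) * eexp (g (m * n)) else 0) =
      (if (Y < m * n ∧ m * n ≤ Y' ∧ U < m ∧ U < n) then (L2 m : ℂ) * (f4 n : ℂ) * eexp (g (m * n)) else 0) := by
    intro m _ n _
    by_cases h : U < m
    · by_cases h' : U < n
      · simp only [h, h', and_true]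
      · rw [hf4s n (by omega)]; simp
    · have : L2 m = 0 := by rw [hL2, afGT_apply, if_neg h]
      simp [this]
  rw [Finset.sum_congr rfl (fun m hm => Finset.sum_congr rfl (E1 m hm)),
    Finset.sum_congr rfl (fun m hm => Finset.sum_congr rfl (E2 m hm)),
    Finset.sum_congr rfl (fun m hm => Finset.sum_congr rfl (E4 m hm))]
  simp only [Finset.sum_add_distrib]
  set W : ℝ := (Y:ℝ) ^ (1 - 275/10000 : ℝ) with hW
  have hW0 : 0 < W := Real.rpow_pos_of_pos hY0 _
  have p1 : B * (Y:ℝ) ^ (1 - 5/100 : ℝ) ≤ D0 * W := by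
    rw [hB, hW, mul_assoc, ← Real.rpow_add hY0]
    refine mul_le_mul_of_nonneg_left (Real.rpow_le_rpow_of_exponent_le hY1 (by norm_num)) (by positivity)
  have p2 : B ^ 2 * (Y:ℝ) ^ (1 - 276/10000 : ℝ) ≤ D0 ^ 2 * W := by
    rw [hB, hW, mul_pow, mul_assoc, ← Real.rpow_natCast (_ ^ _ : ℝ), ← Real.rpow_mul hY0.le, ← Real.rpow_add hY0]
    refine mul_le_mul_of_nonneg_left (Real.rpow_le_rpow_of_exponent_le hY1 (by norm_num)) (by positivity)
  have p3 : D0 * W ≤ D0 ^ 2 * W := by gcongr; exact le_self_pow₀ hD01 (by norm_num)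
  refine (norm_add_le _ _).trans ?_
  refine (add_le_add ((norm_sub_le _ _).trans (add_le_add A1 ((norm_add_le _ _).trans (add_le_add A2 A3)))) A4).trans ?_
  have q1 : C * (B * (Y:ℝ) ^ (1 - 5/100 : ℝ)) ≤ C * (D0 ^ 2 * W) := by exact mul_le_mul_of_nonneg_left (p1.trans p3) (by linarith)
  have q2 : C * (B ^ 2 * (Y:ℝ) ^ (1 - 276/10000 : ℝ)) ≤ C * (D0 ^ 2 * W) := mul_le_mul_of_nonneg_left p2 (by linarith)
  have q3 : (B ^ 2 * (Y:ℝ) ^ (1 - 276/10000 : ℝ)) ≤ C * (D0 ^ 2 * W) := by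
    refine p2.trans (le_mul_of_one_le_left (by positivity) hC)
  have q4 : 0 ≤ C * (D0 ^ 2 * W) := by positivity
  nlinarith


open ArithmeticFunction in
lemma nonprime_lambda : ∃ C : ℝ, 1 ≤ C ∧ ∀ Y Y' : ℕ, 1 ≤ Y → Y' ≤ 2 * Y →
    ∑ n ∈ (Finset.Ioc Y Y').filter (fun n => ¬ n.Prime), (vonMangoldt n : ℝ) ≤ C * (Y:ℝ) ^ (1 - 275/10000 : ℝ) := by
  refine ⟨100, by norm_num, ?_⟩
  intro Y Y' hY hY'
  have hY1 : (1:ℝ) ≤ Y := by exact_mod_cast hY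
  have hY0 : (0:ℝ) < Y := by linarith
  have h1 := Chebyshev.psi_sub_theta_le (x := 2 * (Y:ℝ)) (by linarith)
  rw [Chebyshev.psi_sub_theta_eq_sum_not_prime] at h1
  have hfl : ⌊2 * (Y:ℝ)⌋₊ = 2 * Y := by
    have : (2 * (Y:ℝ)) = ((2 * Y : ℕ) : ℝ) := by push_cast; ring
    rw [this, Nat.floor_natCast]
  rw [hfl] at h1
  refine le_trans ?_ (h1.trans ?_)
  · apply Finset.sum_le_sum_of_subset_of_nonneg
    · intro n hn
      simp only [Finset.mem_filter, Finset.mem_Ioc] at hn ⊢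
      exact ⟨⟨by omega, by omega⟩, hn.2⟩
    · intro i _ _; exact vonMangoldt_nonneg
  · have h2 := Real.log_le_rpow_div (x := 2 * (Y:ℝ)) (by linarith) (show (0:ℝ) < 1/4 by norm_num)
    rw [Real.sqrt_eq_rpow]
    have h3 : (2 * (Y:ℝ)) ^ (1/2:ℝ) * (2 * (Y:ℝ)) ^ (1/4:ℝ) ≤ 2 * (Y:ℝ) ^ (1 - 275/10000 : ℝ) := by
      rw [← Real.rpow_add (by linarith), Real.mul_rpow (by norm_num) hY0.le]
      apply mul_le_mul _ _ (by positivity) (by norm_num)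
      · calc (2:ℝ) ^ (1/2 + 1/4:ℝ) ≤ 2 ^ (1:ℝ) := Real.rpow_le_rpow_of_exponent_le (by norm_num) (by norm_num)
          _ = 2 := Real.rpow_one 2
      · exact Real.rpow_le_rpow_of_exponent_le hY1 (by norm_num)
    have h4 : 0 ≤ (2 * (Y:ℝ)) ^ (1/2:ℝ) := by positivity
    have h5 : 0 < (Y:ℝ) ^ (1 - 275/10000 : ℝ) := by positivity
    have h6 : Real.log (2 * Y) ≤ 4 * (2 * (Y:ℝ)) ^ (1/4:ℝ) := by linarith
    have := mul_le_mul_of_nonneg_left h6 h4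
    nlinarith

open ArithmeticFunction in
lemma prime_exp (γ : ℝ) (hγ : 97/100 ≤ γ) (hγ1 : γ < 1) : ∃ C : ℝ, 1 ≤ C ∧
    ∀ (Y Y' : ℕ) (a1 a3 h ν : ℝ), 1 ≤ Y → Y ≤ Y' → Y' ≤ 2 * Y → 1 ≤ h → h ≤ (Y:ℝ) ^ (544/10000:ℝ) → 0 ≤ ν → ν ≤ 1 →
    ‖∑ p ∈ (Finset.Ioc Y Y').filter (fun n => n.Prime), (((p:ℝ) ^ (1 - γ) : ℝ) : ℂ) * eexp (ph γ a1 a3 h ν p)‖ ≤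
      C * (Y:ℝ) ^ (1 - 275/10000 + (1 - γ) : ℝ) := by
  obtain ⟨C1, hC1, hP⟩ := pairBound_ph γ hγ hγ1
  obtain ⟨D, hD, hL⟩ := lambda_sum
  obtain ⟨C2, hC2, hN⟩ := nonprime_lambda
  refine ⟨(D * C1 + C2) * 16, by nlinarith, ?_⟩
  intro Y Y' a1 a3 h ν hY hYY hY' hh hhY hν hν1
  have hY1 : (1:ℝ) ≤ Y := by exact_mod_cast hY
  have hY0 : (0:ℝ) < Y := by linarith
  set g := ph γ a1 a3 h ν with hg
  have hPB : PairBound C1 Y g := hP Y a1 a3 h ν hY hh hhY hν hν1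
  set W : ℝ := (Y:ℝ) ^ (1 - 275/10000 : ℝ) with hW
  have hW0 : 0 < W := by positivity
  set z0 : ℕ → ℂ := fun n => if n.Prime then ((Real.log n : ℝ) : ℂ) * eexp (g n) else 0 with hz0
  have ico : ∀ c, Finset.Ico (Y+1) (c+1) = Finset.Ioc Y c := by intro c; ext x; simp [Finset.mem_Ico, Finset.mem_Ioc]
  have step1 : ∀ c, c ≤ Y' → ‖∑ n ∈ Finset.Ioc Y c, z0 n‖ ≤ (D * C1 + C2) * W := by
    intro c hc
    rcases le_or_gt Y c with hYc | hYc
    swap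
    · rw [Finset.Ioc_eq_empty (by omega)]; simp; positivity
    have e : ∑ n ∈ Finset.Ioc Y c, z0 n = ∑ n ∈ Finset.Ioc Y c, ((vonMangoldt n : ℝ) : ℂ) * eexp (g n) -
        ∑ n ∈ (Finset.Ioc Y c).filter (fun n => ¬ n.Prime), ((vonMangoldt n : ℝ) : ℂ) * eexp (g n) := by
      rw [Finset.sum_filter, ← Finset.sum_sub_distrib]
      apply Finset.sum_congr rfl
      intro n _
      by_cases hp : n.Prime
      · simp [hz0, hp, vonMangoldt_apply_prime hp]
      · simp [hz0, hp]
    rw [e]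
    refine (norm_sub_le _ _).trans ?_
    have t1 := hL C1 Y c g hC1 hY hYc (by omega) hPB
    have t2 := hN Y c hY (by omega)
    have t3 : ‖∑ n ∈ (Finset.Ioc Y c).filter (fun n => ¬ n.Prime), ((vonMangoldt n : ℝ) : ℂ) * eexp (g n)‖ ≤ C2 * W := by
      refine (norm_sum_le _ _).trans (le_trans (Finset.sum_le_sum ?_) t2)
      intro i _
      rw [norm_mul, norm_eexp, mul_one, Complex.norm_real, Real.norm_eq_abs, abs_of_nonneg vonMangoldt_nonneg]
    refine (add_le_add t1 t3).trans (le_of_eq ?_)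
    rw [← hW]; ring
  have step2 : ∀ c, c ≤ Y' + 1 → ‖∑ n ∈ Finset.Ico (Y+1) c, (((Real.log n)⁻¹ : ℝ) : ℂ) * z0 n‖ ≤ (D * C1 + C2) * W * (2 * 2) := by
    intro c hc
    apply abel_anti
    · intro d hd
      rcases Nat.eq_zero_or_pos d with h0 | h0
      · subst h0; simp; positivity
      · obtain ⟨d', rfl⟩ : ∃ d', d = d' + 1 := ⟨d - 1, by omega⟩
        rw [ico]; exact step1 d' (by omega)
    · intro i hi _
      have : 0 < Real.log i := Real.log_pos (by exact_mod_cast (by omega : 1 < i))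
      apply inv_anti₀ this
      apply Real.log_le_log
      · exact_mod_cast (by omega : 0 < i)
      · push_cast; linarith
    · intro i hi _
      have h2 : Real.log 2 ≤ Real.log i := Real.log_le_log (by norm_num) (by exact_mod_cast (by omega : 2 ≤ i))
      have h3 := Real.log_two_gt_d9
      refine ⟨inv_nonneg.2 (by linarith), ?_⟩
      rw [show (2:ℝ) = (1/2)⁻¹ by norm_num]
      exact inv_anti₀ (by norm_num) (by linarith)
    · norm_num
  have step3 := abel_mono (fun n => (((Real.log n)⁻¹ : ℝ) : ℂ) * z0 n) (fun n => (n:ℝ) ^ (1 - γ)) (Y+1) (Y'+1)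
    ((D * C1 + C2) * W * (2 * 2)) (2 * (Y:ℝ) ^ (1 - γ)) step2
    (by intro i _ _; exact Real.rpow_le_rpow (by positivity) (by push_cast; linarith) (by linarith))
    (by
      intro i hi hi2
      refine ⟨by positivity, ?_⟩
      calc (i:ℝ) ^ (1 - γ) ≤ (2 * Y) ^ (1 - γ) := by
            apply Real.rpow_le_rpow (by positivity) (by exact_mod_cast (by omega)) (by linarith)
        _ = 2 ^ (1 - γ) * (Y:ℝ) ^ (1 - γ) := Real.mul_rpow (by norm_num) (by linarith)
        _ ≤ 2 ^ (1:ℝ) * (Y:ℝ) ^ (1 - γ) := by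
            apply mul_le_mul_of_nonneg_right _ (by positivity)
            apply Real.rpow_le_rpow_of_exponent_le (by norm_num) (by linarith)
        _ = _ := by rw [Real.rpow_one]) (by positivity)
  rw [ico] at step3
  rw [Finset.sum_filter]
  refine le_trans (le_of_eq ?_) (step3.trans (le_of_eq ?_))
  · congr 1
    apply Finset.sum_congr rfl
    intro n hn
    rw [Finset.mem_Ioc] at hn
    by_cases hp : n.Prime
    · have : Real.log n ≠ 0 := (Real.log_pos (by exact_mod_cast hp.one_lt)).ne'
      simp only [hz0, hp, if_true]
      rw [← mul_assoc (((Real.log n)⁻¹ : ℝ) : ℂ), ← Complex.ofReal_mul, inv_mul_cancel₀ this]; simp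
    · simp [hz0, hp]
  · rw [Real.rpow_add hY0]; ring


noncomputable def sawE (H : ℕ) (t : ℝ) : ℝ :=
  (⌈t⌉ : ℝ) - t - 1/2 - ∑ h ∈ Finset.Icc 1 H, Real.sin (2 * Real.pi * h * t) / (Real.pi * h)

/-- smooth version -/
noncomputable def sawF (H : ℕ) (t : ℝ) : ℝ :=
  1/2 - t - ∑ h ∈ Finset.Icc 1 H, Real.sin (2 * Real.pi * h * t) / (Real.pi * h)

lemma dirichlet_id (H : ℕ) (t : ℝ) :
    (1 + 2 * ∑ h ∈ Finset.Icc 1 H, Real.cos (2 * Real.pi * h * t)) * Real.sin (Real.pi * t) =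
      Real.sin ((2 * H + 1) * Real.pi * t) := by
  induction H with
  | zero => simp
  | succ n ih =>
    rw [Finset.sum_Icc_succ_top (by omega), mul_add, ← add_assoc, add_mul, ih]
    have e1 : (2 * ((n + 1 : ℕ):ℝ) + 1) * Real.pi * t = 2 * Real.pi * ((n+1:ℕ):ℝ) * t + Real.pi * t := by ring
    have e2 : (2 * (n:ℝ) + 1) * Real.pi * t = 2 * Real.pi * ((n+1:ℕ):ℝ) * t - Real.pi * t := by push_cast; ring
    rw [e1, e2, Real.sin_add, Real.sin_sub]; ring

lemma hasDerivAt_sawF (H : ℕ) (t : ℝ) (ht : Real.sin (Real.pi * t) ≠ 0) :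
    HasDerivAt (sawF H) (- (Real.sin ((2 * H + 1) * Real.pi * t) / Real.sin (Real.pi * t))) t := by
  have hs : HasDerivAt (fun t : ℝ => ∑ h ∈ Finset.Icc 1 H, Real.sin (2 * Real.pi * h * t) / (Real.pi * h))
      (∑ h ∈ Finset.Icc 1 H, 2 * Real.cos (2 * Real.pi * h * t)) t := by
    apply HasDerivAt.fun_sum
    intro h hh
    rw [Finset.mem_Icc] at hh
    have h0 : (h:ℝ) ≠ 0 := by exact_mod_cast (by omega : h ≠ 0)
    have h1 : HasDerivAt (fun t : ℝ => 2 * Real.pi * h * t) (2 * Real.pi * h) t := by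
      simpa using (hasDerivAt_id t).const_mul (2 * Real.pi * h)
    refine (h1.sin.div_const (Real.pi * h)).congr_deriv ?_
    have := Real.pi_ne_zero
    field_simp
  have h2 : HasDerivAt (fun t : ℝ => 1/2 - t) (-1) t := by
    exact (hasDerivAt_id t).const_sub (1/2)
  refine (h2.sub hs).congr_deriv ?_
  rw [← dirichlet_id, mul_div_cancel_right₀ _ ht, Finset.mul_sum]; ring

lemma sawF_half (H : ℕ) : sawF H (1/2) = 0 := by
  rw [sawF, Finset.sum_eq_zero]
  · norm_num
  · intro h _
    rw [show 2 * Real.pi * h * (1/2) = (h:ℝ) * Real.pi by ring, Real.sin_nat_mul_pi]; simp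

lemma sawF_bound (H : ℕ) (t : ℝ) (ht : 0 < t) (ht2 : t ≤ 1/2) :
    |sawF H t| ≤ 2 / ((2 * H + 1) * Real.pi * Real.sin (Real.pi * t)) := by
  set M : ℝ := (2 * H + 1) * Real.pi with hM
  have hpi := Real.pi_pos
  have hM0 : 0 < M := by positivity
  have hsin : ∀ u ∈ Set.Icc t (1/2), 0 < Real.sin (Real.pi * u) := by
    intro u hu
    apply Real.sin_pos_of_pos_of_lt_pi
    · have := lt_of_lt_of_le ht hu.1; positivity
    · nlinarith [hu.2]
  have hcos : ∀ u ∈ Set.Icc t (1/2), 0 ≤ Real.cos (Real.pi * u) := by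
    intro u hu
    apply Real.cos_nonneg_of_neg_pi_div_two_le_of_le
    · have := lt_of_lt_of_le ht hu.1; nlinarith
    · nlinarith [hu.2]
  have hcM : Real.cos (M * (1/2)) = 0 := by
    rw [hM, Real.cos_eq_zero_iff]; exact ⟨H, by push_cast; ring⟩
  have hder : ∀ s : ℝ, ∀ u ∈ Set.Icc t (1/2), HasDerivAt
      (fun u => sawF H u + (s - Real.cos (M * u)) / (M * Real.sin (Real.pi * u)))
      (Real.pi * Real.cos (Real.pi * u) * (Real.cos (M * u) - s) / (M * Real.sin (Real.pi * u) ^ 2)) u := by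
    intro s u hu
    have h0 := (hsin u hu).ne'
    have d1 := hasDerivAt_sawF H u h0
    have d2 : HasDerivAt (fun u : ℝ => M * u) M u := by simpa using (hasDerivAt_id u).const_mul M
    have d3 : HasDerivAt (fun u : ℝ => Real.pi * u) Real.pi u := by simpa using (hasDerivAt_id u).const_mul Real.pi
    refine (d1.add ((d2.cos.const_sub s).div (d3.sin.const_mul M) (mul_ne_zero hM0.ne' h0))).congr_deriv ?_
    rw [← hM]
    field_simp
    ring
  have hcont : ∀ s : ℝ, ContinuousOn (fun u => sawF H u + (s - Real.cos (M * u)) / (M * Real.sin (Real.pi * u))) (Set.Icc t (1/2)) :=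
    fun s u hu => (hder s u hu).continuousAt.continuousWithinAt
  have a1 : AntitoneOn (fun u => sawF H u + (1 - Real.cos (M * u)) / (M * Real.sin (Real.pi * u))) (Set.Icc t (1/2)) := by
    apply antitoneOn_of_deriv_nonpos (convex_Icc _ _) (hcont 1)
    · intro u hu; exact (hder 1 u (interior_subset hu)).differentiableAt.differentiableWithinAt
    · intro u hu
      have hu' := interior_subset hu
      rw [(hder 1 u hu').deriv]
      apply div_nonpos_of_nonpos_of_nonneg
      · apply mul_nonpos_of_nonneg_of_nonpos
        · exact mul_nonneg hpi.le (hcos u hu')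
        · linarith [Real.cos_le_one (M * u)]
      · positivity
  have a2 : MonotoneOn (fun u => sawF H u + (-1 - Real.cos (M * u)) / (M * Real.sin (Real.pi * u))) (Set.Icc t (1/2)) := by
    apply monotoneOn_of_deriv_nonneg (convex_Icc _ _) (hcont (-1))
    · intro u hu; exact (hder (-1) u (interior_subset hu)).differentiableAt.differentiableWithinAt
    · intro u hu
      have hu' := interior_subset hu
      rw [(hder (-1) u hu').deriv]
      apply div_nonneg
      · apply mul_nonneg
        · exact mul_nonneg hpi.le (hcos u hu')
        · linarith [Real.neg_one_le_cos (M * u)]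
      · positivity
  have b1 := a1 ⟨le_rfl, ht2⟩ ⟨ht2, le_rfl⟩ ht2
  have b2 := a2 ⟨le_rfl, ht2⟩ ⟨ht2, le_rfl⟩ ht2
  simp only [hcM, sawF_half] at b1 b2
  have hs1 : Real.sin (Real.pi * (1/2)) = 1 := by rw [mul_one_div]; exact Real.sin_pi_div_two
  rw [hs1] at b1 b2
  have hst := hsin t ⟨le_rfl, ht2⟩
  have hMs : 0 < M * Real.sin (Real.pi * t) := by positivity
  have hM1 : 0 < 1 / M := by positivity
  have c1 : (1 - Real.cos (M * t)) / (M * Real.sin (Real.pi * t)) ≤ 2 / (M * Real.sin (Real.pi * t)) := by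
    apply div_le_div_of_nonneg_right _ hMs.le
    linarith [Real.neg_one_le_cos (M * t)]
  have c2 : -(2 / (M * Real.sin (Real.pi * t))) ≤ (-1 - Real.cos (M * t)) / (M * Real.sin (Real.pi * t)) := by
    rw [← neg_div]
    apply div_le_div_of_nonneg_right _ hMs.le
    linarith [Real.cos_le_one (M * t)]
  have e1 : (0:ℝ) + (1 - 0) / (M * 1) = 1 / M := by ring
  have e2 : (0:ℝ) + (-1 - 0) / (M * 1) = -(1 / M) := by ring
  rw [e1] at b1
  rw [e2] at b2
  rw [abs_le]
  constructor <;> linarith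

lemma sawF_bound_small (H : ℕ) (t : ℝ) (ht : 0 < t) (ht2 : t ≤ 1/2) : |sawF H t| ≤ 1/2 + 2 * H * t := by
  rw [sawF]
  refine (abs_sub _ _).trans (add_le_add ?_ ?_)
  · rw [abs_le]; constructor <;> linarith
  · refine (Finset.abs_sum_le_sum_abs _ _).trans ?_
    have : ∀ h ∈ Finset.Icc 1 H, |Real.sin (2 * Real.pi * h * t) / (Real.pi * h)| ≤ 2 * t := by
      intro h hh
      rw [Finset.mem_Icc] at hh
      have h0 : (0:ℝ) < h := by exact_mod_cast (by omega : 0 < h)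
      have := Real.pi_pos
      rw [abs_div, abs_of_pos (show 0 < Real.pi * h by positivity), div_le_iff₀ (by positivity)]
      have h1 := Real.abs_sin_le_abs (x := 2 * Real.pi * h * t)
      rw [abs_of_pos (show 0 < 2 * Real.pi * h * t by positivity)] at h1
      linarith
    refine (Finset.sum_le_sum this).trans (le_of_eq ?_)
    rw [Finset.sum_const, Nat.card_Icc]; simp; ring

/-- combined on (0,1/2] -/
lemma sawF_bound' (H : ℕ) (hH : 1 ≤ H) (t : ℝ) (ht : 0 < t) (ht2 : t ≤ 1/2) :
    |sawF H t| ≤ 3/2 ∧ |sawF H t| ≤ 1 / (H * t) := by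
  have hH0 : (1:ℝ) ≤ H := by exact_mod_cast hH
  have hpi := Real.pi_gt_three
  have hs : 2 * t ≤ Real.sin (Real.pi * t) := by
    have := Real.mul_le_sin (x := Real.pi * t) (by positivity) (by nlinarith)
    calc 2 * t = 2 / Real.pi * (Real.pi * t) := by field_simp
      _ ≤ _ := this
  have h2 : |sawF H t| ≤ 1 / (2 * (H * t)) := by
    refine (sawF_bound H t ht ht2).trans ?_
    have hsp : 0 < Real.sin (Real.pi * t) := by linarith
    have hHt : 0 < H * t := by positivity
    rw [div_le_div_iff₀ (by positivity) (by positivity)]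
    have : (2 * H) * 2 * (2 * t) ≤ (2 * (H:ℝ) + 1) * Real.pi * Real.sin (Real.pi * t) := by
      apply mul_le_mul _ hs (by positivity) (by positivity)
      nlinarith
    linarith
  constructor
  · rcases le_or_gt (H * t) (1/2) with h | h
    · have := sawF_bound_small H t ht ht2
      nlinarith
    · refine h2.trans ?_
      rw [div_le_iff₀ (by positivity)]; nlinarith
  · refine h2.trans ?_
    apply one_div_le_one_div_of_le (by positivity)
    have : 0 < H * t := by positivity
    linarith

lemma sawE_add_int (H : ℕ) (t : ℝ) (k : ℤ) : sawE H (t + k) = sawE H t := by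
  rw [sawE, sawE, Int.ceil_add_intCast]
  have : ∀ h ∈ Finset.Icc 1 H, Real.sin (2 * Real.pi * h * (t + k)) / (Real.pi * h) = Real.sin (2 * Real.pi * h * t) / (Real.pi * h) := by
    intro h _
    rw [show 2 * Real.pi * h * (t + k) = 2 * Real.pi * h * t + ((h * k : ℤ) : ℝ) * (2 * Real.pi) by push_cast; ring,
      Real.sin_add_int_mul_two_pi]
  rw [Finset.sum_congr rfl this]
  push_cast; ring

lemma sawE_eq_sawF (H : ℕ) (t : ℝ) (ht : 0 < t) (ht1 : t ≤ 1) : sawE H t = sawF H t := by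
  have : ⌈t⌉ = 1 := by rw [Int.ceil_eq_iff]; constructor <;> norm_num <;> linarith
  rw [sawE, sawF, this]; push_cast; ring

lemma sawF_symm (H : ℕ) (t : ℝ) : sawF H (1 - t) = - sawF H t := by
  rw [sawF, sawF]
  have : ∀ h ∈ Finset.Icc 1 H, Real.sin (2 * Real.pi * h * (1 - t)) / (Real.pi * h) = - (Real.sin (2 * Real.pi * h * t) / (Real.pi * h)) := by
    intro h _
    rw [show 2 * Real.pi * h * (1 - t) = (h:ℕ) * (2 * Real.pi) - 2 * Real.pi * h * t by ring,
      Real.sin_nat_mul_two_pi_sub]; ring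
  rw [Finset.sum_congr rfl this, Finset.sum_neg_distrib]
  ring

/-- Main pointwise majorant. -/
lemma sawE_bound (H K : ℕ) (hH : 1 ≤ H) (hK : 1 ≤ K) (t : ℝ) :
    |sawE H t| ≤ 50 / (K:ℝ)^2 * ‖∑ k ∈ Finset.range K, eexp (k * t)‖ ^ 2 + 8 * K / H := by
  have hH0 : (1:ℝ) ≤ H := by exact_mod_cast hH
  have hK0 : (1:ℝ) ≤ K := by exact_mod_cast hK
  have red : ∀ u : ℝ, |u| ≤ 1/2 → |sawE H u| ≤ 3/2 ∧ (u ≠ 0 → |sawE H u| ≤ 1 / (H * |u|)) := by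
    intro u hu
    rcases lt_trichotomy u 0 with h | h | h
    · have e : sawE H u = - sawF H (-u) := by
        rw [← sawE_add_int H u 1, sawE_eq_sawF H _ (by push_cast; linarith [(abs_le.1 hu).1]) (by push_cast; linarith), ← sawF_symm]
        congr 1; push_cast; ring
      rw [abs_of_neg h] at hu
      have := sawF_bound' H hH (-u) (by linarith) hu
      rw [e, abs_neg, abs_of_neg h]
      exact ⟨this.1, fun _ => this.2⟩
    · subst h
      refine ⟨?_, fun h => absurd rfl h⟩
      simp [sawE]; norm_num
    · rw [abs_of_pos h] at hu
      rw [sawE_eq_sawF H u h (by linarith), abs_of_pos h]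
      have := sawF_bound' H hH u h hu
      exact ⟨this.1, fun _ => this.2⟩
  set u := t - round t with hu
  have hu2 : |u| ≤ 1/2 := abs_sub_round t
  have et : t = u + (round t : ℤ) := by rw [hu]; ring
  have eS : ∑ k ∈ Finset.range K, eexp (k * t) = ∑ k ∈ Finset.range K, eexp (k * u) := by
    apply Finset.sum_congr rfl
    intro k _
    have : (k:ℝ) * t = k * u + ((k * round t : ℤ) : ℝ) := by push_cast; rw [hu]; ring
    rw [this, eexp_add, eexp_int, mul_one]
  have e1 : sawE H t = sawE H u := by conv_lhs => rw [et, sawE_add_int]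
  rw [e1, eS]
  obtain ⟨r1, r2⟩ := red u hu2
  rcases le_or_gt (|u|) (1 / (8 * K)) with h | h
  · have hS : (K:ℝ) / 5 ≤ ‖∑ k ∈ Finset.range K, eexp (k * u)‖ := by
      have h1 : ‖∑ k ∈ Finset.range K, (eexp (k * u) - 1)‖ ≤ K * (4/5) := by
        refine (norm_sum_le _ _).trans ?_
        have : ∀ k ∈ Finset.range K, ‖eexp (k * u) - 1‖ ≤ 4/5 := by
          intro k hk
          rw [Finset.mem_range] at hk
          have hk' : (k:ℝ) ≤ K := by exact_mod_cast hk.le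
          have := norm_eexp_sub_eexp_le (k * u) 0
          rw [eexp_zero, sub_zero] at this
          refine this.trans ?_
          rw [abs_mul, abs_of_nonneg (Nat.cast_nonneg k)]
          have h3 : (k:ℝ) * |u| ≤ 1/8 := by
            calc (k:ℝ) * |u| ≤ K * (1 / (8 * K)) := by gcongr
              _ = 1/8 := by field_simp
          have := Real.pi_lt_d2
          have := Real.pi_pos
          nlinarith
        refine (Finset.sum_le_sum this).trans ?_
        rw [Finset.sum_const, Finset.card_range]; simp
      have h2 : (K:ℂ) = ∑ k ∈ Finset.range K, eexp (k * u) - ∑ k ∈ Finset.range K, (eexp (k * u) - 1) := by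
        rw [Finset.sum_sub_distrib]; simp
      have h3 : (K:ℝ) = ‖(K:ℂ)‖ := by simp
      have h4 := norm_sub_le (∑ k ∈ Finset.range K, eexp (k * u)) (∑ k ∈ Finset.range K, (eexp (k * u) - 1))
      rw [← h2, ← h3] at h4
      linarith
    have h5 : (3/2:ℝ) ≤ 50 / (K:ℝ)^2 * ‖∑ k ∈ Finset.range K, eexp (k * u)‖ ^ 2 := by
      calc (3/2:ℝ) ≤ 50 / (K:ℝ)^2 * (K / 5) ^ 2 := by
            rw [show 50 / (K:ℝ)^2 * (K / 5) ^ 2 = 2 by field_simp; norm_num]; norm_num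
        _ ≤ _ := by gcongr
    have : 0 ≤ 8 * (K:ℝ) / H := by positivity
    linarith
  · have hu0 : u ≠ 0 := by
      intro h0; rw [h0, abs_zero] at h
      have : (0:ℝ) < 1 / (8 * K) := by positivity
      linarith
    have h6 := r2 hu0
    have hup : 0 < |u| := abs_pos.2 hu0
    have h7 : 1 / (H * |u|) ≤ 8 * K / H := by
      rw [div_le_div_iff₀ (by positivity) (by positivity)]
      rw [div_lt_iff₀ (by positivity)] at h
      nlinarith
    have : 0 ≤ 50 / (K:ℝ)^2 * ‖∑ k ∈ Finset.range K, eexp (k * u)‖ ^ 2 := by positivity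
    linarith


lemma normsq_expand (K : ℕ) (t : ℝ) :
    (((‖∑ k ∈ Finset.range K, eexp (k * t)‖ ^ 2 : ℝ)) : ℂ) =
      ∑ k ∈ Finset.range K, ∑ l ∈ Finset.range K, eexp (((k:ℝ) - l) * t) := by
  rw [Complex.ofReal_pow, ← Complex.mul_conj', map_sum, Finset.sum_mul_sum]
  apply Finset.sum_congr rfl; intro k _
  apply Finset.sum_congr rfl; intro l _
  rw [sub_mul, eexp_sub]

lemma plain_sum (γ : ℝ) (hγ : 97/100 ≤ γ) (hγ1 : γ < 1) : ∃ C : ℝ, 1 ≤ C ∧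
    ∀ (Y : ℕ) (h ν : ℝ), 1 ≤ Y → 1 ≤ |h| → |h| ≤ (Y:ℝ) ^ (544/10000:ℝ) → 0 ≤ ν → ν ≤ 1 →
      ‖∑ n ∈ Finset.Ioc Y (2*Y), eexp (h * ((n:ℝ) + ν) ^ γ)‖ ≤ C * (Y:ℝ) ^ (1 - 272/10000 : ℝ) := by
  obtain ⟨C, hC, HP⟩ := pairBound_ph γ hγ hγ1
  refine ⟨2 * C, by linarith, ?_⟩
  intro Y h ν hY hh hhY hν hν1
  have hY1 : (1:ℝ) ≤ Y := by exact_mod_cast hY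
  have hY0 : (0:ℝ) < Y := by linarith
  have ico : Finset.Ico (Y+1) (2*Y+1) = Finset.Ioc Y (2*Y) := by ext x; simp [Finset.mem_Ico, Finset.mem_Ioc]
  have key : ‖∑ n ∈ Finset.Ioc Y (2*Y), eexp (|h| * ((n:ℝ) + ν) ^ γ)‖ ≤ 2 * C * (Y:ℝ) ^ (1 - 272/10000 : ℝ) := by
    have PB := HP Y 0 0 |h| ν hY hh hhY hν hν1
    have h1 := pairBound_single PB (Y+1) 1 (Y+1) (2*Y+1) (by omega) (by nlinarith) (by omega) (by omega) (by omega) le_rfl (by omega)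
    rw [ico] at h1
    have e : ∀ n ∈ Finset.Ioc Y (2*Y), eexp (|h| * ((n:ℝ) + ν) ^ γ) = eexp (ph γ 0 0 |h| ν (1 * n)) := by
      intro n _; rw [ph]; congr 1; push_cast; ring_nf
    rw [Finset.sum_congr rfl e]
    refine h1.trans ?_
    have e2 : (Y:ℝ) ^ (1 - 272/10000 : ℝ) = Y * (Y:ℝ) ^ (-(272/10000) : ℝ) := by
      rw [sub_eq_add_neg, Real.rpow_add hY0, Real.rpow_one]
    have e3 : (Y:ℝ) ^ (-(555/10000) : ℝ) ≤ (Y:ℝ) ^ (-(272/10000) : ℝ) := Real.rpow_le_rpow_of_exponent_le hY1 (by norm_num)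
    rw [e2]
    have e4 : C * ((Y + 1 : ℕ):ℝ) ≤ 2 * C * Y := by push_cast; nlinarith
    calc C * ((Y + 1 : ℕ):ℝ) * (Y:ℝ) ^ (-(555/10000) : ℝ) ≤ (2 * C * Y) * (Y:ℝ) ^ (-(272/10000) : ℝ) :=
          mul_le_mul e4 e3 (by positivity) (by positivity)
      _ = _ := by ring
  rcases abs_cases h with ⟨h1, _⟩ | ⟨h1, _⟩
  · rwa [h1] at key
  · rw [h1] at key
    rw [← Complex.norm_conj, map_sum]
    convert key using 3 with n
    rw [conj_eexp]; congr 1; ring_nf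

lemma sawE_sum (γ : ℝ) (hγ : 97/100 ≤ γ) (hγ1 : γ < 1) : ∃ C : ℝ, 1 ≤ C ∧
    ∀ (Y : ℕ) (ν : ℝ), 1 ≤ Y → 0 ≤ ν → ν ≤ 1 →
      ∑ n ∈ Finset.Ioc Y (2*Y), |sawE ⌊(Y:ℝ) ^ (544/10000:ℝ)⌋₊ (((n:ℝ) + ν) ^ γ)| ≤ C * (Y:ℝ) ^ (1 - 272/10000 : ℝ) := by
  obtain ⟨C, hC, HP⟩ := plain_sum γ hγ hγ1
  refine ⟨50 * (2 + C) + 16, by linarith, ?_⟩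
  intro Y ν hY hν hν1
  have hY1 : (1:ℝ) ≤ Y := by exact_mod_cast hY
  have hY0 : (0:ℝ) < Y := by linarith
  set H := ⌊(Y:ℝ) ^ (544/10000:ℝ)⌋₊ with hH
  set K := ⌊(Y:ℝ) ^ (272/10000:ℝ)⌋₊ with hK
  have q1 : 1 ≤ (Y:ℝ) ^ (544/10000:ℝ) := Real.one_le_rpow hY1 (by norm_num)
  have q2 : 1 ≤ (Y:ℝ) ^ (272/10000:ℝ) := Real.one_le_rpow hY1 (by norm_num)
  have hH1 : 1 ≤ H := Nat.le_floor (by simpa using q1)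
  have hK1 : 1 ≤ K := Nat.le_floor (by simpa using q2)
  have hHr : (1:ℝ) ≤ H := by exact_mod_cast hH1
  have hKr : (1:ℝ) ≤ K := by exact_mod_cast hK1
  have hHl : (Y:ℝ) ^ (544/10000:ℝ) ≤ 2 * H := by
    have := Nat.lt_floor_add_one ((Y:ℝ) ^ (544/10000:ℝ)); rw [← hH] at this; linarith
  have hKl : (Y:ℝ) ^ (272/10000:ℝ) ≤ 2 * K := by
    have := Nat.lt_floor_add_one ((Y:ℝ) ^ (272/10000:ℝ)); rw [← hK] at this; linarith
  have hKu : (K:ℝ) ≤ (Y:ℝ) ^ (272/10000:ℝ) := Nat.floor_le (by positivity)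
  set W := (Y:ℝ) ^ (1 - 272/10000 : ℝ) with hW
  have hWY : W * (Y:ℝ) ^ (272/10000:ℝ) = Y := by
    rw [hW, ← Real.rpow_add hY0]; norm_num
  have hsq : (Y:ℝ) ^ (544/10000:ℝ) = (Y:ℝ) ^ (272/10000:ℝ) * (Y:ℝ) ^ (272/10000:ℝ) := by
    rw [← Real.rpow_add hY0]; norm_num
  have hW0 : 0 < W := by positivity
  refine (Finset.sum_le_sum (fun n _ => sawE_bound H K hH1 hK1 _)).trans ?_
  rw [Finset.sum_add_distrib, ← Finset.mul_sum, Finset.sum_const, Nat.card_Ioc]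
  have hcard : ((2 * Y - Y : ℕ) : ℝ) = Y := by congr 1; omega
  have main : ∑ n ∈ Finset.Ioc Y (2*Y), ‖∑ k ∈ Finset.range K, eexp (k * ((n:ℝ) + ν) ^ γ)‖ ^ 2 ≤ K * Y + K * (K * (C * W)) := by
    have e1 : ∑ n ∈ Finset.Ioc Y (2*Y), ‖∑ k ∈ Finset.range K, eexp (k * ((n:ℝ) + ν) ^ γ)‖ ^ 2 =
        ‖∑ k ∈ Finset.range K, ∑ l ∈ Finset.range K, ∑ n ∈ Finset.Ioc Y (2*Y), eexp (((k:ℝ) - l) * ((n:ℝ) + ν) ^ γ)‖ := by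
      have e2 : ∑ k ∈ Finset.range K, ∑ l ∈ Finset.range K, ∑ n ∈ Finset.Ioc Y (2*Y), eexp (((k:ℝ) - l) * ((n:ℝ) + ν) ^ γ)
        = ((∑ n ∈ Finset.Ioc Y (2*Y), ‖∑ k ∈ Finset.range K, eexp (k * ((n:ℝ) + ν) ^ γ)‖ ^ 2 : ℝ) : ℂ) := by
        rw [Complex.ofReal_sum]
        simp_rw [normsq_expand]
        rw [Finset.sum_comm]
        conv_rhs => rw [Finset.sum_comm]
        rw [Finset.sum_comm]
        apply Finset.sum_congr rfl; intro k _
        rw [Finset.sum_comm]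
      rw [e2, Complex.norm_real, Real.norm_eq_abs, abs_of_nonneg]
      positivity
    rw [e1]
    have e3 : ∀ k ∈ Finset.range K, ∀ l ∈ Finset.range K,
        ‖∑ n ∈ Finset.Ioc Y (2*Y), eexp (((k:ℝ) - l) * ((n:ℝ) + ν) ^ γ)‖ ≤ (if k = l then (Y:ℝ) else 0) + C * W := by
      intro k hk l hl
      rw [Finset.mem_range] at hk hl
      split_ifs with h
      · subst h
        have : ‖∑ n ∈ Finset.Ioc Y (2*Y), eexp (((k:ℝ) - k) * ((n:ℝ) + ν) ^ γ)‖ ≤ Y := by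
          refine (norm_sum_le _ _).trans ?_
          simp only [norm_eexp, Finset.sum_const, Nat.card_Ioc, nsmul_eq_mul, mul_one]
          rw [hcard]
        have : 0 ≤ C * W := by positivity
        linarith
      · rw [zero_add]
        have hz : ((k:ℝ) - l) = (((k:ℤ) - l : ℤ) : ℝ) := by push_cast; ring
        have hne : ((k:ℤ) - l) ≠ 0 := by omega
        apply HP Y _ ν hY _ _ hν hν1
        · rw [hz, ← Int.cast_abs]; exact_mod_cast Int.one_le_abs hne
        · have hk' : (k:ℝ) ≤ K := by exact_mod_cast hk.le
          have hl' : (l:ℝ) ≤ K := by exact_mod_cast hl.le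
          have : |(k:ℝ) - l| ≤ K := by
            rw [abs_le]; constructor <;> linarith [Nat.cast_nonneg (α := ℝ) k, Nat.cast_nonneg (α := ℝ) l]
          refine this.trans (hKu.trans (Real.rpow_le_rpow_of_exponent_le hY1 (by norm_num)))
    refine (norm_sum_le _ _).trans ?_
    have e4 : ∀ k ∈ Finset.range K, ‖∑ l ∈ Finset.range K, ∑ n ∈ Finset.Ioc Y (2*Y), eexp (((k:ℝ) - l) * ((n:ℝ) + ν) ^ γ)‖ ≤ Y + K * (C * W) := by
      intro k hk
      refine (norm_sum_le _ _).trans ((Finset.sum_le_sum (e3 k hk)).trans ?_)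
      rw [Finset.sum_add_distrib, Finset.sum_ite_eq, if_pos hk]; simp
    refine (Finset.sum_le_sum e4).trans (le_of_eq ?_)
    rw [Finset.sum_const, Finset.card_range, nsmul_eq_mul]; ring
  rw [nsmul_eq_mul, hcard]
  have f1 : 50 / (K:ℝ)^2 * (K * Y + K * (K * (C * W))) = 50 * (Y / K + C * W) := by field_simp
  have f2 : (Y:ℝ) / K ≤ 2 * W := by
    rw [div_le_iff₀ (by positivity)]; nlinarith
  have f3 : (Y:ℝ) * (8 * K / H) ≤ 16 * W := by
    rw [mul_div_assoc', div_le_iff₀ (by positivity)]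
    have : (Y:ℝ) * K ≤ W * (2 * H) := by
      calc (Y:ℝ) * K ≤ Y * (Y:ℝ) ^ (272/10000:ℝ) := by gcongr
        _ = W * ((Y:ℝ) ^ (272/10000:ℝ) * (Y:ℝ) ^ (272/10000:ℝ)) := by rw [← mul_assoc, hWY]
        _ ≤ _ := by rw [← hsq]; gcongr
    linarith
  have f4 := mul_le_mul_of_nonneg_left main (show 0 ≤ 50 / (K:ℝ)^2 by positivity)
  rw [f1] at f4
  linarith


lemma sin_eexp (x : ℝ) : ((Real.sin (2 * Real.pi * x) : ℝ) : ℂ) = (eexp x - eexp (-x)) / (2 * Complex.I) := by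
  rw [Complex.ofReal_sin, Complex.sin, eexp, eexp]
  have e1 : -((2 * Real.pi * x : ℝ) : ℂ) * Complex.I = 2 * Real.pi * Complex.I * ((-x : ℝ):ℂ) := by push_cast; ring
  have e2 : ((2 * Real.pi * x : ℝ) : ℂ) * Complex.I = 2 * Real.pi * Complex.I * (x:ℂ) := by push_cast; ring
  rw [e1, e2, div_eq_div_iff (by norm_num) (by simp)]
  ring_nf
  rw [Complex.I_sq]; ring

lemma psi_block (γ : ℝ) (hγ : 97/100 ≤ γ) (hγ1 : γ < 1) : ∃ C : ℝ, 1 ≤ C ∧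
    ∀ (Y Y' : ℕ) (a1 a3 ν : ℝ), 1 ≤ Y → Y ≤ Y' → Y' ≤ 2 * Y → 0 ≤ ν → ν ≤ 1 →
    ‖∑ p ∈ (Finset.Ioc Y Y').filter (fun n => n.Prime), (((p:ℝ) ^ (1 - γ) : ℝ) : ℂ) *
      (((⌈((p:ℝ) + ν) ^ γ⌉ : ℝ) - ((p:ℝ) + ν) ^ γ - 1/2 : ℝ) : ℂ) * eexp (a1 * p + a3 * (p:ℝ)^3)‖ ≤
      C * (Y:ℝ) ^ (1 - 270/10000 + (1 - γ) : ℝ) := by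
  obtain ⟨C1, hC1, H1⟩ := prime_exp γ hγ hγ1
  obtain ⟨C2, hC2, H2⟩ := sawE_sum γ hγ hγ1
  refine ⟨C1 * 2002 + 2 * C2, by linarith, ?_⟩
  intro Y Y' a1 a3 ν hY hYY hY' hν hν1
  have hY1 : (1:ℝ) ≤ Y := by exact_mod_cast hY
  have hY0 : (0:ℝ) < Y := by linarith
  set H := ⌊(Y:ℝ) ^ (544/10000:ℝ)⌋₊ with hH
  have hHu : (H:ℝ) ≤ (Y:ℝ) ^ (544/10000:ℝ) := Nat.floor_le (by positivity)
  set V := C1 * (Y:ℝ) ^ (1 - 275/10000 + (1 - γ) : ℝ) with hV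
  have hV0 : 0 ≤ V := by positivity
  set Q := (Finset.Ioc Y Y').filter (fun n => n.Prime) with hQ
  have split : ∀ p ∈ Q, (((p:ℝ) ^ (1 - γ) : ℝ) : ℂ) *
      (((⌈((p:ℝ) + ν) ^ γ⌉ : ℝ) - ((p:ℝ) + ν) ^ γ - 1/2 : ℝ) : ℂ) * eexp (a1 * p + a3 * (p:ℝ)^3) =
      (∑ h ∈ Finset.Icc 1 H, (((Real.pi * h)⁻¹ : ℝ) : ℂ) * ((((p:ℝ) ^ (1 - γ) : ℝ) : ℂ) *
        (((Real.sin (2 * Real.pi * (h * ((p:ℝ) + ν) ^ γ)) : ℝ) : ℂ) * eexp (a1 * p + a3 * (p:ℝ)^3)))) +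
      (((p:ℝ) ^ (1 - γ) : ℝ) : ℂ) * ((sawE H (((p:ℝ) + ν) ^ γ) : ℝ) : ℂ) * eexp (a1 * p + a3 * (p:ℝ)^3) := by
    intro p _
    have e : (⌈((p:ℝ) + ν) ^ γ⌉ : ℝ) - ((p:ℝ) + ν) ^ γ - 1/2 =
        (∑ h ∈ Finset.Icc 1 H, (Real.pi * h)⁻¹ * Real.sin (2 * Real.pi * (h * ((p:ℝ) + ν) ^ γ))) + sawE H (((p:ℝ) + ν) ^ γ) := by
      rw [sawE]
      have : ∑ h ∈ Finset.Icc 1 H, (Real.pi * h)⁻¹ * Real.sin (2 * Real.pi * (h * ((p:ℝ) + ν) ^ γ)) =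
        ∑ h ∈ Finset.Icc 1 H, Real.sin (2 * Real.pi * h * ((p:ℝ) + ν) ^ γ) / (Real.pi * h) := by
        apply Finset.sum_congr rfl; intro h _
        rw [mul_comm, ← div_eq_mul_inv, mul_assoc (2 * Real.pi)]
      rw [this]; ring
    rw [e, Complex.ofReal_add, mul_add, add_mul, Complex.ofReal_sum, Finset.mul_sum, Finset.sum_mul]
    congr 1
    apply Finset.sum_congr rfl; intro h _
    rw [Complex.ofReal_mul]; ring
  rw [Finset.sum_congr rfl split, Finset.sum_add_distrib, Finset.sum_comm]
  refine (norm_add_le _ _).trans ?_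
  have A : ‖∑ h ∈ Finset.Icc 1 H, ∑ p ∈ Q, (((Real.pi * h)⁻¹ : ℝ) : ℂ) * ((((p:ℝ) ^ (1 - γ) : ℝ) : ℂ) *
        (((Real.sin (2 * Real.pi * (h * ((p:ℝ) + ν) ^ γ)) : ℝ) : ℂ) * eexp (a1 * p + a3 * (p:ℝ)^3)))‖ ≤
        C1 * 2002 * (Y:ℝ) ^ (1 - 270/10000 + (1 - γ) : ℝ) := by
    have A1 : ∀ h ∈ Finset.Icc 1 H, ‖∑ p ∈ Q, (((Real.pi * h)⁻¹ : ℝ) : ℂ) * ((((p:ℝ) ^ (1 - γ) : ℝ) : ℂ) *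
        (((Real.sin (2 * Real.pi * (h * ((p:ℝ) + ν) ^ γ)) : ℝ) : ℂ) * eexp (a1 * p + a3 * (p:ℝ)^3)))‖ ≤ 1 / (h:ℝ) * V := by
      intro h hh
      rw [Finset.mem_Icc] at hh
      have hh1 : (1:ℝ) ≤ h := by exact_mod_cast hh.1
      have hhH : (h:ℝ) ≤ (Y:ℝ) ^ (544/10000:ℝ) := le_trans (by exact_mod_cast hh.2) hHu
      have B1 := H1 Y Y' a1 a3 h ν hY hYY hY' hh1 hhH hν hν1
      have B2 := H1 Y Y' (-a1) (-a3) h ν hY hYY hY' hh1 hhH hν hν1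
      rw [← Complex.norm_conj, map_sum] at B2
      have e : ∑ p ∈ Q, ((((p:ℝ) ^ (1 - γ) : ℝ) : ℂ) *
        (((Real.sin (2 * Real.pi * (h * ((p:ℝ) + ν) ^ γ)) : ℝ) : ℂ) * eexp (a1 * p + a3 * (p:ℝ)^3))) =
        ((∑ p ∈ Q, (((p:ℝ) ^ (1 - γ) : ℝ) : ℂ) * eexp (ph γ a1 a3 h ν p)) -
         (∑ p ∈ Q, (starRingEnd ℂ) ((((p:ℝ) ^ (1 - γ) : ℝ) : ℂ) * eexp (ph γ (-a1) (-a3) h ν p)))) / (2 * Complex.I) := by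
        rw [← Finset.sum_sub_distrib, Finset.sum_div]
        apply Finset.sum_congr rfl; intro p _
        rw [sin_eexp, map_mul, conj_eexp, Complex.conj_ofReal]
        have e1 : ph γ a1 a3 h ν p = h * ((p:ℝ) + ν) ^ γ + (a1 * p + a3 * (p:ℝ)^3) := by rw [ph]; ring
        have e2 : -ph γ (-a1) (-a3) h ν p = -(h * ((p:ℝ) + ν) ^ γ) + (a1 * p + a3 * (p:ℝ)^3) := by rw [ph]; ring
        rw [e1, e2, eexp_add (h * ((p:ℝ) + ν) ^ γ) (a1 * p + a3 * (p:ℝ)^3), eexp_add (-(h * ((p:ℝ) + ν) ^ γ)) (a1 * p + a3 * (p:ℝ)^3)]; ring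
      rw [← Finset.mul_sum, e, norm_mul, norm_div, Complex.norm_real, Real.norm_eq_abs]
      have hpi := Real.pi_gt_three
      rw [abs_of_pos (by positivity)]
      have n2 : ‖(2 * Complex.I : ℂ)‖ = 2 := by simp
      rw [n2]
      have B3 := (norm_sub_le _ _).trans (add_le_add B1 B2)
      apply mul_le_mul _ _ (by positivity) (by positivity)
      · rw [← one_div]; apply one_div_le_one_div_of_le (by linarith); nlinarith
      · rw [div_le_iff₀ (by norm_num)]; linarith
    refine (norm_sum_le _ _).trans ((Finset.sum_le_sum A1).trans ?_)
    rw [← Finset.sum_mul]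
    have hHY : H ≤ Y := by
      have : (H:ℝ) ≤ Y := hHu.trans (by
        calc (Y:ℝ) ^ (544/10000:ℝ) ≤ (Y:ℝ) ^ (1:ℝ) := Real.rpow_le_rpow_of_exponent_le hY1 (by norm_num)
          _ = Y := Real.rpow_one _)
      exact_mod_cast this
    have s1 := sum_inv_le (H+1) (H+1) le_rfl (by omega)
    have s2 := log_bound Y hY1 (H+1) (by omega) (by exact_mod_cast (by omega : H + 1 ≤ 2 * Y))
    have ico : Finset.Ico 1 (H+1) = Finset.Icc 1 H := by ext x; simp [Finset.mem_Ico, Finset.mem_Icc]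
    rw [ico] at s1
    calc _ ≤ (2002 * (Y:ℝ) ^ (1/2000:ℝ)) * V := mul_le_mul_of_nonneg_right (s1.trans s2) hV0
      _ = C1 * 2002 * ((Y:ℝ) ^ (1/2000:ℝ) * (Y:ℝ) ^ (1 - 275/10000 + (1 - γ) : ℝ)) := by rw [hV]; ring
      _ = _ := by rw [← Real.rpow_add hY0]; congr 2; ring
  have B : ‖∑ p ∈ Q, (((p:ℝ) ^ (1 - γ) : ℝ) : ℂ) * ((sawE H (((p:ℝ) + ν) ^ γ) : ℝ) : ℂ) * eexp (a1 * p + a3 * (p:ℝ)^3)‖ ≤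
      2 * C2 * (Y:ℝ) ^ (1 - 270/10000 + (1 - γ) : ℝ) := by
    refine (norm_sum_le _ _).trans ?_
    have b1 : ∀ p ∈ Q, ‖(((p:ℝ) ^ (1 - γ) : ℝ) : ℂ) * ((sawE H (((p:ℝ) + ν) ^ γ) : ℝ) : ℂ) * eexp (a1 * p + a3 * (p:ℝ)^3)‖ ≤
        2 * (Y:ℝ) ^ (1 - γ) * |sawE H (((p:ℝ) + ν) ^ γ)| := by
      intro p hp
      rw [hQ, Finset.mem_filter, Finset.mem_Ioc] at hp
      rw [norm_mul, norm_mul, norm_eexp, mul_one, Complex.norm_real, Complex.norm_real, Real.norm_eq_abs, Real.norm_eq_abs]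
      apply mul_le_mul_of_nonneg_right _ (abs_nonneg _)
      rw [abs_of_nonneg (by positivity)]
      calc (p:ℝ) ^ (1 - γ) ≤ (2 * Y) ^ (1 - γ) := by
            apply Real.rpow_le_rpow (by positivity) (by exact_mod_cast (by omega)) (by linarith)
        _ = 2 ^ (1 - γ) * (Y:ℝ) ^ (1 - γ) := Real.mul_rpow (by norm_num) (by linarith)
        _ ≤ 2 ^ (1:ℝ) * (Y:ℝ) ^ (1 - γ) := by
            apply mul_le_mul_of_nonneg_right _ (by positivity)
            apply Real.rpow_le_rpow_of_exponent_le (by norm_num) (by linarith)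
        _ = _ := by rw [Real.rpow_one]
    refine (Finset.sum_le_sum b1).trans ?_
    rw [← Finset.mul_sum]
    have b2 : ∑ p ∈ Q, |sawE H (((p:ℝ) + ν) ^ γ)| ≤ C2 * (Y:ℝ) ^ (1 - 272/10000 : ℝ) := by
      refine le_trans ?_ (H2 Y ν hY hν hν1)
      apply Finset.sum_le_sum_of_subset_of_nonneg
      · intro p hp
        rw [hQ, Finset.mem_filter, Finset.mem_Ioc] at hp
        rw [Finset.mem_Ioc]; omega
      · intro i _ _; exact abs_nonneg _
    calc _ ≤ 2 * (Y:ℝ) ^ (1 - γ) * (C2 * (Y:ℝ) ^ (1 - 272/10000 : ℝ)) := mul_le_mul_of_nonneg_left b2 (by positivity)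
      _ = 2 * C2 * (Y:ℝ) ^ (1 - 272/10000 + (1 - γ) : ℝ) := by rw [Real.rpow_add hY0]; ring
      _ ≤ _ := by
        apply mul_le_mul_of_nonneg_left _ (by positivity)
        apply Real.rpow_le_rpow_of_exponent_le hY1; linarith
  linarith

lemma dyadic_bound (f : ℕ → ℂ) (C θ : ℝ) (hC : 0 ≤ C) (hθ : 1/2 ≤ θ) (h1 : ‖f 1‖ ≤ C)
    (hb : ∀ Y Y' : ℕ, 1 ≤ Y → Y ≤ Y' → Y' ≤ 2 * Y → ‖∑ n ∈ Finset.Ioc Y Y', f n‖ ≤ C * (Y:ℝ) ^ θ) :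
    ∀ X : ℕ, 1 ≤ X → ‖∑ n ∈ Finset.Ioc 0 X, f n‖ ≤ 8 * C * (X:ℝ) ^ θ := by
  intro X
  induction X using Nat.strong_induction_on with
  | _ X ih =>
    intro hX
    rcases Nat.lt_or_ge X 2 with h | h
    · have : X = 1 := by omega
      subst this
      simp; linarith
    · set Y := (X + 1) / 2 with hY
      have hY1 : 1 ≤ Y := by omega
      have hYX : Y < X := by omega
      have e : Finset.Ioc 0 X = Finset.Ioc 0 Y ∪ Finset.Ioc Y X := by
        rw [Finset.Ioc_union_Ioc_eq_Ioc (by omega) (by omega)]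
      have hd : Disjoint (Finset.Ioc 0 Y) (Finset.Ioc Y X) := by
        rw [Finset.disjoint_left]; intro x; simp only [Finset.mem_Ioc]; omega
      rw [e, Finset.sum_union hd]
      refine (norm_add_le _ _).trans ?_
      have i1 := ih Y hYX hY1
      have i2 := hb Y X hY1 hYX.le (by omega)
      have i3 : (Y:ℝ) ^ θ ≤ (7/8) * (X:ℝ) ^ θ := by
        have hYr : (Y:ℝ) ≤ (3/4) * X := by
          have : 4 * Y ≤ 3 * X := by omega
          have : (4:ℝ) * Y ≤ 3 * X := by exact_mod_cast this
          linarith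
        calc (Y:ℝ) ^ θ ≤ ((3/4) * X) ^ θ := Real.rpow_le_rpow (by positivity) hYr (by linarith)
          _ = (3/4) ^ θ * (X:ℝ) ^ θ := Real.mul_rpow (by norm_num) (by positivity)
          _ ≤ (7/8) * (X:ℝ) ^ θ := by
            apply mul_le_mul_of_nonneg_right _ (by positivity)
            calc (3/4:ℝ) ^ θ ≤ (3/4) ^ (1/2:ℝ) := Real.rpow_le_rpow_of_exponent_ge (by norm_num) (by norm_num) hθ
              _ ≤ 7/8 := by
                rw [← Real.sqrt_eq_rpow]
                rw [Real.sqrt_le_left (by norm_num)]; norm_num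
      have i4 : 0 ≤ C * (X:ℝ) ^ θ := by positivity
      have i5 := mul_le_mul_of_nonneg_left i3 hC
      nlinarith


lemma ps_iff (γ : ℝ) (hγ : 0 < γ) (p : ℕ) (hp : p.Prime) :
    p ∈ PiatetskiShapiroSet γ ↔ ∃ m : ℕ, (p:ℝ) ^ γ ≤ m ∧ (m:ℝ) < ((p:ℝ) + 1) ^ γ := by
  have hp0 : (0:ℝ) < p := by exact_mod_cast hp.pos
  have key : ∀ m : ℕ, p = ⌊(m : ℝ) ^ ((1 : ℝ) / γ)⌋₊ ↔ ((p:ℝ) ^ γ ≤ m ∧ (m:ℝ) < ((p:ℝ) + 1) ^ γ) := by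
    intro m
    rw [eq_comm, Nat.floor_eq_iff (by positivity), one_div,
      Real.le_rpow_inv_iff_of_pos hp0.le (by positivity) hγ, Real.rpow_inv_lt_iff_of_pos (by positivity) (by positivity) hγ]
  constructor
  · rintro ⟨_, m, hm, h⟩
    exact ⟨m, (key m).1 h⟩
  · rintro ⟨m, h⟩
    refine ⟨hp, m, ?_, (key m).2 h⟩
    have : (0:ℝ) < m := lt_of_lt_of_le (by positivity) h.1
    exact_mod_cast this

lemma ps_ind (γ : ℝ) (hγ : 0 < γ) (hγ1 : γ ≤ 1) (p : ℕ) (hp : p.Prime) :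
    (if p ∈ PiatetskiShapiroSet γ then (1:ℝ) else 0) = (⌈((p:ℝ) + 1) ^ γ⌉ : ℝ) - (⌈((p:ℝ) + 0) ^ γ⌉ : ℝ) := by
  have hp0 : (0:ℝ) < p := by exact_mod_cast hp.pos
  rw [add_zero]
  set a := (p:ℝ) ^ γ with ha
  set b := ((p:ℝ) + 1) ^ γ with hb
  have hab : a ≤ b := Real.rpow_le_rpow hp0.le (by linarith) hγ.le
  have ha0 : 0 < a := by positivity
  have hba : b ≤ a + 1 := by
    have := Real.rpow_add_le_add_rpow hp0.le zero_le_one hγ.le hγ1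
    rwa [Real.one_rpow] at this
  rw [ps_iff γ hγ p hp]
  split_ifs with h
  · obtain ⟨m, h1, h2⟩ := h
    have c1 : ⌈a⌉ ≤ m := Int.ceil_le.2 (by exact_mod_cast h1)
    have c2 : ((m:ℤ)) < ⌈b⌉ := Int.lt_ceil.2 (by rw [Int.cast_natCast]; exact h2)
    have c3 : ⌈b⌉ ≤ ⌈a⌉ + 1 := by
      rw [← Int.ceil_add_one]; exact Int.ceil_mono hba
    have : ⌈b⌉ = ⌈a⌉ + 1 := by omega
    rw [this]; push_cast; ring
  · have c0 : 0 ≤ ⌈a⌉ := Int.ceil_nonneg ha0.le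
    obtain ⟨m, hm⟩ := Int.eq_ofNat_of_zero_le c0
    have c1 : a ≤ m := by
      have := Int.le_ceil a; rw [hm] at this; exact_mod_cast this
    have c2 : b ≤ m := by
      by_contra hc
      exact h ⟨m, c1, not_le.1 hc⟩
    have c3 : ⌈b⌉ ≤ m := Int.ceil_le.2 (by exact_mod_cast c2)
    have c4 := Int.ceil_mono hab
    have : ⌈b⌉ = ⌈a⌉ := by omega
    rw [this]; ring

lemma main_term (γ : ℝ) (hγ : 0 < γ) (hγ1 : γ < 1) (p : ℕ) (hp : 1 ≤ p) :
    |γ⁻¹ * (p:ℝ) ^ (1 - γ) * (((p:ℝ) + 1) ^ γ - (p:ℝ) ^ γ) - 1| ≤ 1 / p := by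
  have hp0 : (0:ℝ) < p := by exact_mod_cast hp
  have hy0 : 0 < (p:ℝ) ^ (1 - γ) := by positivity
  have hpp : (p:ℝ) ^ (1 - γ) * (p:ℝ) ^ γ = p := by rw [← Real.rpow_add hp0]; norm_num
  have up : γ⁻¹ * (p:ℝ) ^ (1 - γ) * (((p:ℝ) + 1) ^ γ - (p:ℝ) ^ γ) ≤ 1 := by
    have h := rpow_one_add_le_one_add_mul_self (s := 1 / (p:ℝ)) (by linarith [show (0:ℝ) < 1 / p by positivity]) hγ.le hγ1.le
    have e : ((p:ℝ) + 1) ^ γ = (p:ℝ) ^ γ * (1 + 1 / p) ^ γ := by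
      rw [← Real.mul_rpow hp0.le (by positivity)]; congr 1; field_simp
    rw [e]
    calc γ⁻¹ * (p:ℝ) ^ (1 - γ) * ((p:ℝ) ^ γ * (1 + 1 / p) ^ γ - (p:ℝ) ^ γ)
        = γ⁻¹ * ((p:ℝ) ^ (1 - γ) * (p:ℝ) ^ γ) * ((1 + 1 / p) ^ γ - 1) := by ring
      _ ≤ γ⁻¹ * ((p:ℝ) ^ (1 - γ) * (p:ℝ) ^ γ) * (γ * (1 / p)) := by
          apply mul_le_mul_of_nonneg_left _ (by positivity); linarith
      _ = 1 := by rw [hpp]; field_simp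
  have lo : 1 - 1 / (p:ℝ) ≤ γ⁻¹ * (p:ℝ) ^ (1 - γ) * (((p:ℝ) + 1) ^ γ - (p:ℝ) ^ γ) := by
    have h := rpow_concave_diff γ p (p+1) hγ hγ1 hp0.le (by linarith)
    have e1 : (p:ℝ) ^ (1 - γ) * ((p:ℝ)+1) ^ (γ - 1) = (p / (p + 1)) ^ (1 - γ) := by
      rw [Real.div_rpow hp0.le (by positivity), show γ - 1 = -(1 - γ) by ring, Real.rpow_neg (by positivity)]; rfl
    have e2 : (p:ℝ) / (p + 1) ≤ (p / (p + 1)) ^ (1 - γ) := by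
      conv_lhs => rw [← Real.rpow_one ((p:ℝ) / (p + 1))]
      apply Real.rpow_le_rpow_of_exponent_ge (by positivity)
      · rw [div_le_one (by positivity)]; linarith
      · linarith
    have e3 : 1 - 1 / (p:ℝ) ≤ p / (p + 1) := by
      rw [le_div_iff₀ (by positivity)]
      have : (1 - 1 / (p:ℝ)) * (p + 1) = p - 1 / p := by field_simp; ring
      rw [this]
      have : 0 < 1 / (p:ℝ) := by positivity
      linarith
    calc 1 - 1 / (p:ℝ) ≤ (p:ℝ) ^ (1 - γ) * ((p:ℝ)+1) ^ (γ - 1) := by rw [e1]; exact e3.trans e2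
      _ = γ⁻¹ * (p:ℝ) ^ (1 - γ) * (γ * (p + 1 - p) * ((p:ℝ)+1) ^ (γ - 1)) := by field_simp; ring
      _ ≤ _ := mul_le_mul_of_nonneg_left h (by positivity)
  have : 0 < 1 / (p:ℝ) := by positivity
  rw [abs_le]; constructor <;> linarith

/-- Coefficient `γ⁻¹ p^{1-γ} 1_{𝒫_γ}(p) - 1`. -/
noncomputable def psc (γ : ℝ) (p : ℕ) : ℝ := γ⁻¹ * (p:ℝ) ^ (1 - γ) * (if p ∈ PiatetskiShapiroSet γ then (1:ℝ) else 0) - 1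

lemma propA (γ : ℝ) (hγ : 97/100 ≤ γ) (hγ1 : γ < 1) : ∃ C : ℝ, 1 ≤ C ∧
    ∀ (X : ℕ) (a1 a3 : ℝ), 1 ≤ X →
    ‖∑ p ∈ (Finset.Ioc 0 X).filter (fun n => n.Prime), ((psc γ p : ℝ) : ℂ) * eexp (a1 * p + a3 * (p:ℝ)^3)‖ ≤
      C * (X:ℝ) ^ (1 - 270/10000 + (1 - γ) : ℝ) := by
  have hγ0 : 0 < γ := by linarith
  obtain ⟨C, hC, HB⟩ := psi_block γ hγ hγ1
  refine ⟨8 * (4 * C + 1), by linarith, ?_⟩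
  intro X a1 a3 hX
  rw [Finset.sum_filter]
  refine dyadic_bound (fun p => if p.Prime then ((psc γ p : ℝ) : ℂ) * eexp (a1 * p + a3 * (p:ℝ)^3) else 0) (4 * C + 1)
    (1 - 270/10000 + (1 - γ)) (by linarith) (by linarith) ?_ ?_ X hX
  · simp [Nat.not_prime_one]; linarith
  · intro Y Y' hY hYY hY'
    have hY1 : (1:ℝ) ≤ Y := by exact_mod_cast hY
    have hY0 : (0:ℝ) < Y := by linarith
    rw [← Finset.sum_filter]
    set Q := (Finset.Ioc Y Y').filter (fun n => n.Prime) with hQ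
    have e : ∀ p ∈ Q, ((psc γ p : ℝ) : ℂ) * eexp (a1 * p + a3 * (p:ℝ)^3) =
      ((γ⁻¹ : ℝ) : ℂ) * ((((p:ℝ) ^ (1 - γ) : ℝ) : ℂ) *
      (((⌈((p:ℝ) + 1) ^ γ⌉ : ℝ) - ((p:ℝ) + 1) ^ γ - 1/2 : ℝ) : ℂ) * eexp (a1 * p + a3 * (p:ℝ)^3)) -
      ((γ⁻¹ : ℝ) : ℂ) * ((((p:ℝ) ^ (1 - γ) : ℝ) : ℂ) *
      (((⌈((p:ℝ) + 0) ^ γ⌉ : ℝ) - ((p:ℝ) + 0) ^ γ - 1/2 : ℝ) : ℂ) * eexp (a1 * p + a3 * (p:ℝ)^3)) +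
      ((γ⁻¹ * (p:ℝ) ^ (1 - γ) * (((p:ℝ) + 1) ^ γ - (p:ℝ) ^ γ) - 1 : ℝ) : ℂ) * eexp (a1 * p + a3 * (p:ℝ)^3) := by
      intro p hp
      rw [hQ, Finset.mem_filter] at hp
      rw [psc, ps_ind γ hγ0 hγ1.le p hp.2]
      push_cast
      rw [add_zero]
      ring
    rw [Finset.sum_congr rfl e, Finset.sum_add_distrib, Finset.sum_sub_distrib, ← Finset.mul_sum, ← Finset.mul_sum]
    have B1 := HB Y Y' a1 a3 1 hY hYY hY' (by norm_num) le_rfl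
    have B0 := HB Y Y' a1 a3 0 hY hYY hY' le_rfl (by norm_num)
    rw [← hQ] at B1 B0
    set W := (Y:ℝ) ^ (1 - 270/10000 + (1 - γ) : ℝ) with hW
    have hW1 : 1 ≤ W := Real.one_le_rpow hY1 (by linarith)
    have hg : γ⁻¹ ≤ 2 := by
      rw [show (2:ℝ) = (1/2)⁻¹ by norm_num]; exact inv_anti₀ (by norm_num) (by linarith)
    have hgn : ‖((γ⁻¹ : ℝ) : ℂ)‖ ≤ 2 := by
      rw [Complex.norm_real, Real.norm_eq_abs, abs_of_pos (by positivity)]; exact hg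
    have B2 : ‖∑ p ∈ Q, ((γ⁻¹ * (p:ℝ) ^ (1 - γ) * (((p:ℝ) + 1) ^ γ - (p:ℝ) ^ γ) - 1 : ℝ) : ℂ) * eexp (a1 * p + a3 * (p:ℝ)^3)‖ ≤ 1 := by
      refine (norm_sum_le _ _).trans ?_
      have : ∀ p ∈ Q, ‖((γ⁻¹ * (p:ℝ) ^ (1 - γ) * (((p:ℝ) + 1) ^ γ - (p:ℝ) ^ γ) - 1 : ℝ) : ℂ) * eexp (a1 * p + a3 * (p:ℝ)^3)‖ ≤ 1 / (Y:ℝ) := by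
        intro p hp
        rw [hQ, Finset.mem_filter, Finset.mem_Ioc] at hp
        rw [norm_mul, norm_eexp, mul_one, Complex.norm_real, Real.norm_eq_abs]
        refine (main_term γ hγ0 hγ1 p (by omega)).trans ?_
        apply one_div_le_one_div_of_le hY0
        exact_mod_cast hp.1.1.le
      refine (Finset.sum_le_sum this).trans ?_
      rw [Finset.sum_const, nsmul_eq_mul, mul_one_div, div_le_one hY0]
      have : Q.card ≤ Y := by
        refine (Finset.card_filter_le _ _).trans ?_
        rw [Nat.card_Ioc]; omega
      exact_mod_cast this
    refine (norm_add_le _ _).trans ((add_le_add (norm_sub_le _ _) B2).trans ?_)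
    rw [norm_mul, norm_mul]
    have t1 := mul_le_mul hgn B1 (norm_nonneg _) (by norm_num)
    have t0 := mul_le_mul hgn B0 (norm_nonneg _) (by norm_num)
    linarith


/-- finite exponential sum with integer frequencies -/
noncomputable def EE {ι : Type} (A : Finset ι) (φ : ι → ℤ) (α : ℝ) : ℂ :=
  ∑ x ∈ A, eexp (α * ((φ x : ℤ) : ℝ))

lemma EE_mul {ι κ : Type} (A : Finset ι) (B : Finset κ) (φ : ι → ℤ) (ψ : κ → ℤ) (α : ℝ) :
    EE A φ α * EE B ψ α = EE (A ×ˢ B) (fun z => φ z.1 + ψ z.2) α := by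
  unfold EE
  rw [Finset.sum_mul_sum, Finset.sum_product]
  refine Finset.sum_congr rfl fun x _ => Finset.sum_congr rfl fun y _ => ?_
  push_cast
  rw [mul_add, eexp_add]

lemma EE_conj {ι : Type} (A : Finset ι) (φ : ι → ℤ) (α : ℝ) :
    (starRingEnd ℂ) (EE A φ α) = EE A (fun x => - φ x) α := by
  unfold EE
  rw [map_sum]
  refine Finset.sum_congr rfl fun x _ => ?_
  rw [conj_eexp]; push_cast; rw [mul_neg]

lemma EE_normsq {ι : Type} (A : Finset ι) (φ : ι → ℤ) (α : ℝ) :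
    ((‖EE A φ α‖ ^ 2 : ℝ) : ℂ) = EE (A ×ˢ A) (fun z => φ z.1 - φ z.2) α := by
  have := EE_mul A A φ (fun x => - φ x) α
  rw [← EE_conj, Complex.mul_conj, Complex.normSq_eq_norm_sq] at this
  rw [this]; simp only [sub_eq_add_neg]

lemma eexp_cont : Continuous eexp := by
  unfold eexp; fun_prop

lemma EE_cont {ι : Type} (A : Finset ι) (φ : ι → ℤ) : Continuous (EE A φ) := by
  unfold EE
  refine continuous_finsetSum _ fun x _ => eexp_cont.comp (by fun_prop)

lemma int_eexp (n : ℤ) : ∫ α in (0:ℝ)..1, eexp (α * (n:ℝ)) = if n = 0 then 1 else 0 := by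
  split_ifs with h
  · subst h; simp [eexp]
  · have hc : (2 * Real.pi * Complex.I * n : ℂ) ≠ 0 := by
      simp [Real.pi_ne_zero, h]
    have := integral_exp_mul_complex (a := 0) (b := 1) hc
    have e : ∀ α : ℝ, eexp (α * (n:ℝ)) = Complex.exp (2 * Real.pi * Complex.I * n * α) := by
      intro α; unfold eexp; push_cast; ring_nf
    simp_rw [e, this]
    have h1 := eexp_int n
    unfold eexp at h1
    push_cast at h1
    simp [h1]

lemma EE_int {ι : Type} (A : Finset ι) (φ : ι → ℤ) :
    ∫ α in (0:ℝ)..1, EE A φ α = ((A.filter (fun x => φ x = 0)).card : ℂ) := by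
  unfold EE
  rw [intervalIntegral.integral_finsetSum]
  · simp_rw [int_eexp]
    rw [Finset.sum_ite]; simp
  · intro x _
    exact (eexp_cont.comp (by fun_prop)).intervalIntegrable _ _

lemma EE_int_real {ι : Type} (A : Finset ι) (φ : ι → ℤ) (g : ℝ → ℝ) (hg : ∀ α, ((g α : ℝ) : ℂ) = EE A φ α) :
    ∫ α in (0:ℝ)..1, g α = ((A.filter (fun x => φ x = 0)).card : ℝ) := by
  have := EE_int A φ
  simp_rw [← hg] at this
  rw [intervalIntegral.integral_ofReal] at this
  exact_mod_cast this

/-- quadruple phase -/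
def qph (z : (ℤ × ℤ) × (ℤ × ℤ)) : ℤ := (z.1.1 ^ 3 - z.1.2 ^ 3) - (z.2.1 ^ 3 - z.2.2 ^ 3)

lemma EE_four (A : Finset ℤ) (α : ℝ) :
    ((‖EE A (fun n => n ^ 3) α‖ ^ 4 : ℝ) : ℂ) = EE ((A ×ˢ A) ×ˢ (A ×ˢ A)) qph α := by
  have h1 := EE_normsq A (fun n => n ^ 3) α
  have h2 := EE_normsq (A ×ˢ A) (fun z => z.1 ^ 3 - z.2 ^ 3) α
  rw [← h1, Complex.norm_real, Real.norm_of_nonneg (by positivity)] at h2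
  rw [show ‖EE A (fun n => n ^ 3) α‖ ^ 4 = (‖EE A (fun n => n ^ 3) α‖ ^ 2) ^ 2 by ring, h2]
  rfl

lemma EE_eight_mono (A B : Finset ℤ) (h : A ⊆ B) :
    ∫ α in (0:ℝ)..1, ‖EE A (fun n => n ^ 3) α‖ ^ 8 ≤ ∫ α in (0:ℝ)..1, ‖EE B (fun n => n ^ 3) α‖ ^ 8 := by
  have key : ∀ A : Finset ℤ, ∫ α in (0:ℝ)..1, ‖EE A (fun n => n ^ 3) α‖ ^ 8 = _ := fun A =>
    EE_int_real (((A ×ˢ A) ×ˢ (A ×ˢ A)) ×ˢ ((A ×ˢ A) ×ˢ (A ×ˢ A))) (fun z => qph z.1 - qph z.2) _ (by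
      intro α
      have h1 := EE_four A α
      have h2 := EE_normsq ((A ×ˢ A) ×ˢ (A ×ˢ A)) qph α
      rw [← h1, Complex.norm_real, Real.norm_of_nonneg (by positivity)] at h2
      rw [show ‖EE A (fun n => n ^ 3) α‖ ^ 8 = (‖EE A (fun n => n ^ 3) α‖ ^ 4) ^ 2 by ring, h2])
  rw [key A, key B]
  exact_mod_cast Finset.card_le_card (Finset.filter_subset_filter _
    (Finset.product_subset_product (Finset.product_subset_product (Finset.product_subset_product h h) (Finset.product_subset_product h h)) (Finset.product_subset_product (Finset.product_subset_product h h) (Finset.product_subset_product h h))))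

/-- integer divisors count -/
lemma int_div_count (ε : ℝ) (hε : 0 < ε) : ∃ C : ℝ, 1 ≤ C ∧ ∀ m : ℤ, m ≠ 0 → ∃ D : Finset ℤ,
    (∀ d : ℤ, d ∣ m → d ∈ D) ∧ (D.card : ℝ) ≤ C * (|m| : ℝ) ^ ε := by
  obtain ⟨C, hC, h⟩ := card_divisors_bound ε hε
  refine ⟨2 * C, by linarith, fun m hm => ?_⟩
  refine ⟨(m.natAbs.divisors.image (fun d : ℕ => (d:ℤ))) ∪ (m.natAbs.divisors.image (fun d : ℕ => -(d:ℤ))), ?_, ?_⟩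
  · intro d hd
    have : d.natAbs ∈ m.natAbs.divisors := by
      rw [Nat.mem_divisors]; exact ⟨Int.natAbs_dvd_natAbs.2 hd, by simpa using hm⟩
    rw [Finset.mem_union, Finset.mem_image, Finset.mem_image]
    rcases Int.natAbs_eq d with h1 | h1
    · left; exact ⟨_, this, h1.symm⟩
    · right; exact ⟨_, this, h1.symm⟩
  · have h1 := h m.natAbs (by simpa using hm)
    have e : ((m.natAbs : ℕ) : ℝ) = |(m:ℝ)| := by rw [Nat.cast_natAbs]; push_cast; rfl
    rw [e] at h1
    have h2 := (Finset.card_union_le (m.natAbs.divisors.image (fun d : ℕ => (d:ℤ))) (m.natAbs.divisors.image (fun d : ℕ => -(d:ℤ)))).trans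
      (add_le_add Finset.card_image_le Finset.card_image_le)
    have h3 : (((m.natAbs.divisors.image (fun d : ℕ => (d:ℤ))) ∪ (m.natAbs.divisors.image (fun d : ℕ => -(d:ℤ)))).card : ℝ) ≤ m.natAbs.divisors.card + m.natAbs.divisors.card := by exact_mod_cast h2
    refine h3.trans ?_
    linarith

/-- generic counting of factored phases -/
lemma fourth_count (ε : ℝ) (hε : 0 < ε) : ∃ C : ℝ, 1 ≤ C ∧ ∀ P : ℕ, 1 ≤ P →
    ∀ m : ℤ, m ≠ 0 → |(m:ℝ)| ≤ 10 * (P:ℝ) ^ 3 →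
    ((((Finset.Icc (1:ℤ) P) ×ˢ (Finset.Icc (1:ℤ) P)).filter (fun z => z.1 ^ 3 - z.2 ^ 3 = m)).card : ℝ) ≤ C * (P:ℝ) ^ ε := by
  obtain ⟨C, hC, h⟩ := int_div_count (ε / 6) (by positivity)
  refine ⟨C ^ 2 * (10:ℝ) ^ (ε/3), ?_, fun P hP m hm hmP => ?_⟩
  · have : (1:ℝ) ≤ (10:ℝ) ^ (ε/3) := Real.one_le_rpow (by norm_num) (by positivity)
    nlinarith [one_le_pow₀ hC (n := 2)]
  obtain ⟨D, hD, hDc⟩ := h m hm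
  have hP0 : (0:ℝ) < P := by exact_mod_cast hP
  have c1 : (((Finset.Icc (1:ℤ) P) ×ˢ (Finset.Icc (1:ℤ) P)).filter (fun z => z.1 ^ 3 - z.2 ^ 3 = m)).card ≤ (D ×ˢ D).card := by
    refine Finset.card_le_card_of_injOn (fun z => (z.1 - z.2, z.1 ^ 2 + z.1 * z.2 + z.2 ^ 2)) ?_ ?_
    · rintro ⟨a, b⟩ hz
      simp only [Finset.coe_filter, Finset.mem_product, Finset.mem_Icc, Set.mem_ofPred_eq] at hz
      simp only [Finset.coe_product, Set.mem_prod, Finset.mem_coe]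
      exact ⟨hD _ ⟨a ^ 2 + a * b + b ^ 2, by rw [← hz.2]; ring⟩, hD _ ⟨a - b, by rw [← hz.2]; ring⟩⟩
    · rintro ⟨a, b⟩ hz ⟨c, d⟩ hz' heq
      simp only [Finset.coe_filter, Finset.mem_product, Finset.mem_Icc, Set.mem_ofPred_eq] at hz hz'
      simp only [Prod.mk.injEq] at heq ⊢
      obtain ⟨e1, e2⟩ := heq
      have e3 : (a + b - (c + d)) * (a + b + (c + d)) = 0 := by
        have : a = c - d + b := by linarith
        subst this
        nlinarith
      rcases mul_eq_zero.1 e3 with h | h <;> omega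
  have c2 : ((((Finset.Icc (1:ℤ) P) ×ˢ (Finset.Icc (1:ℤ) P)).filter (fun z => z.1 ^ 3 - z.2 ^ 3 = m)).card : ℝ) ≤ (D.card:ℝ) ^ 2 := by
    rw [Finset.card_product] at c1
    rw [sq]; exact_mod_cast c1
  refine c2.trans ?_
  calc (D.card:ℝ) ^ 2 ≤ (C * (10 * (P:ℝ) ^ 3) ^ (ε / 6)) ^ 2 := by
        refine pow_le_pow_left₀ (by positivity) (hDc.trans ?_) 2
        exact mul_le_mul_of_nonneg_left (Real.rpow_le_rpow (abs_nonneg _) hmP (by positivity)) (by linarith)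
    _ = C ^ 2 * (10:ℝ) ^ (ε/3) * (P:ℝ) ^ ε := by
        rw [Real.mul_rpow (by norm_num) (by positivity), ← Real.rpow_natCast (P:ℝ) 3, ← Real.rpow_mul hP0.le,
          mul_pow, mul_pow, ← Real.rpow_natCast _ 2, ← Real.rpow_natCast _ 2, ← Real.rpow_natCast _ 2, ← Real.rpow_mul (by norm_num), ← Real.rpow_mul hP0.le]
        push_cast
        ring_nf

/-- second-difference index set -/
noncomputable def BH (P : ℕ) (h : ℤ) : Finset ℤ := (Finset.Icc (1:ℤ) P).filter (fun b => b + h ∈ Finset.Icc (1:ℤ) P)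

def kph (z : (_ : ℤ) × (ℤ × ℤ)) : ℤ := 3 * z.1 * (z.2.1 - z.2.2) * (z.2.1 + z.2.2 + z.1)

noncomputable def KK (P : ℕ) : Finset ((_ : ℤ) × (ℤ × ℤ)) := (Finset.Icc (-(P:ℤ)) P).sigma (fun h => BH P h ×ˢ BH P h)

lemma eighth_count (ε : ℝ) (hε : 0 < ε) : ∃ C : ℝ, 1 ≤ C ∧ ∀ P : ℕ, 1 ≤ P →
    ∀ m : ℤ, m ≠ 0 → |(m:ℝ)| ≤ 10 * (P:ℝ) ^ 3 →
    (((KK P).filter (fun z => kph z = m)).card : ℝ) ≤ C * (P:ℝ) ^ ε := by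
  obtain ⟨C, hC, h⟩ := int_div_count (ε / 9) (by positivity)
  refine ⟨C ^ 3 * (10:ℝ) ^ (ε/3), ?_, fun P hP m hm hmP => ?_⟩
  · have : (1:ℝ) ≤ (10:ℝ) ^ (ε/3) := Real.one_le_rpow (by norm_num) (by positivity)
    nlinarith [one_le_pow₀ hC (n := 3)]
  obtain ⟨D, hD, hDc⟩ := h m hm
  have hP0 : (0:ℝ) < P := by exact_mod_cast hP
  have c1 : ((KK P).filter (fun z => kph z = m)).card ≤ (D ×ˢ (D ×ˢ D)).card := by
    refine Finset.card_le_card_of_injOn (fun z => (z.1, (z.2.1 - z.2.2, z.2.1 + z.2.2 + z.1))) ?_ ?_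
    · rintro ⟨h, a, b⟩ hz
      replace hz := Finset.mem_filter.1 (Finset.mem_coe.1 hz)
      simp only [kph] at hz
      simp only [Finset.coe_product, Set.mem_prod, Finset.mem_coe]
      exact ⟨hD _ ⟨3 * (a - b) * (a + b + h), by rw [← hz.2]; ring⟩, hD _ ⟨3 * h * (a + b + h), by rw [← hz.2]; ring⟩,
        hD _ ⟨3 * h * (a - b), by rw [← hz.2]; ring⟩⟩
    · rintro ⟨h, a, b⟩ hz ⟨h', c, d⟩ hz' heq
      simp only [Prod.mk.injEq] at heq
      obtain ⟨e1, e2, e3⟩ := heq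
      have : a = c := by omega
      have : b = d := by omega
      subst_vars; rfl
  have c2 : (((KK P).filter (fun z => kph z = m)).card : ℝ) ≤ (D.card:ℝ) ^ 3 := by
    rw [Finset.card_product, Finset.card_product] at c1
    have : (((KK P).filter (fun z => kph z = m)).card : ℝ) ≤ (D.card:ℝ) * (D.card * D.card) := by exact_mod_cast c1
    linarith [show (D.card:ℝ) ^ 3 = (D.card:ℝ) * (D.card * D.card) by ring]
  refine c2.trans ?_
  calc (D.card:ℝ) ^ 3 ≤ (C * (10 * (P:ℝ) ^ 3) ^ (ε / 9)) ^ 3 := by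
        refine pow_le_pow_left₀ (by positivity) (hDc.trans ?_) 3
        exact mul_le_mul_of_nonneg_left (Real.rpow_le_rpow (abs_nonneg _) hmP (by positivity)) (by linarith)
    _ = C ^ 3 * (10:ℝ) ^ (ε/3) * (P:ℝ) ^ ε := by
        rw [Real.mul_rpow (by norm_num) (by positivity), ← Real.rpow_natCast (P:ℝ) 3, ← Real.rpow_mul hP0.le,
          mul_pow, mul_pow, ← Real.rpow_natCast _ 3, ← Real.rpow_natCast _ 3, ← Real.rpow_natCast _ 3, ← Real.rpow_mul (by norm_num), ← Real.rpow_mul hP0.le]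
        push_cast
        ring_nf


lemma kk_zero (P : ℕ) (hP : 1 ≤ P) : (((KK P).filter (fun z => kph z = 0)).card : ℝ) ≤ 4 * (P:ℝ) ^ 2 := by
  have hP1 : (1:ℝ) ≤ P := by exact_mod_cast hP
  have c1 : ((KK P).filter (fun z => kph z = 0)).card ≤
      (((Finset.Icc (1:ℤ) P ×ˢ Finset.Icc (1:ℤ) P).image (fun z => (⟨0, z⟩ : (_ : ℤ) × (ℤ × ℤ)))) ∪
       ((Finset.Icc (-(P:ℤ)) P ×ˢ Finset.Icc (1:ℤ) P).image (fun z => (⟨z.1, (z.2, z.2)⟩ : (_ : ℤ) × (ℤ × ℤ))))).card := by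
    refine Finset.card_le_card ?_
    rintro ⟨h, a, b⟩ hz
    rw [Finset.mem_filter] at hz
    obtain ⟨h1, h2⟩ := hz
    simp only [KK, BH, Finset.mem_sigma, Finset.mem_product, Finset.mem_filter, Finset.mem_Icc] at h1
    simp only [kph] at h2
    rw [Finset.mem_union, Finset.mem_image, Finset.mem_image]
    have h3 : a + b + h ≠ 0 := by omega
    have h4 : h = 0 ∨ a = b := by
      rcases mul_eq_zero.1 h2 with h5 | h5
      · rcases mul_eq_zero.1 h5 with h6 | h6
        · left; omega
        · right; omega
      · exact absurd h5 h3
    rcases h4 with h5 | h5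
    · left; subst h5
      exact ⟨(a, b), by simp only [Finset.mem_product, Finset.mem_Icc]; omega, rfl⟩
    · right; subst h5
      exact ⟨(h, a), by simp only [Finset.mem_product, Finset.mem_Icc]; omega, rfl⟩
  have c2 := c1.trans ((Finset.card_union_le _ _).trans (add_le_add Finset.card_image_le Finset.card_image_le))
  rw [Finset.card_product, Finset.card_product, Int.card_Icc, Int.card_Icc] at c2
  have e1 : ((P:ℤ) + 1 - 1).toNat = P := by omega
  have e2 : ((P:ℤ) + 1 - -(P:ℤ)).toNat = 2 * P + 1 := by omega
  rw [e1, e2] at c2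
  have c3 : (((KK P).filter (fun z => kph z = 0)).card : ℝ) ≤ P * P + (2 * P + 1) * P := by exact_mod_cast c2
  nlinarith

lemma cube_diff_bound (P : ℕ) (a b : ℤ) (ha : a ∈ Finset.Icc (1:ℤ) P) (hb : b ∈ Finset.Icc (1:ℤ) P) :
    |((a:ℝ) ^ 3 - (b:ℝ) ^ 3)| ≤ (P:ℝ) ^ 3 := by
  rw [Finset.mem_Icc] at ha hb
  have a1 : (1:ℝ) ≤ a := by exact_mod_cast ha.1
  have a2 : (a:ℝ) ≤ P := by exact_mod_cast ha.2
  have b1 : (1:ℝ) ≤ b := by exact_mod_cast hb.1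
  have b2 : (b:ℝ) ≤ P := by exact_mod_cast hb.2
  have a3 := pow_le_pow_left₀ (by linarith) a2 3
  have b3 := pow_le_pow_left₀ (by linarith) b2 3
  have : (0:ℝ) ≤ (a:ℝ) ^ 3 := by positivity
  have : (0:ℝ) ≤ (b:ℝ) ^ 3 := by positivity
  rw [abs_le]; constructor <;> linarith

/-- generic counting: pairs with matching phases -/
lemma count_match {ι κ : Type} (A : Finset ι) (B : Finset κ) (φ : ι → ℤ) (ψ : κ → ℤ) (c0 c1 : ℝ)
    (hc1 : 0 ≤ c1)
    (h0 : ((B.filter (fun y => ψ y = 0)).card : ℝ) ≤ c0)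
    (h1 : ∀ x ∈ A, φ x ≠ 0 → ((B.filter (fun y => ψ y = - φ x)).card : ℝ) ≤ c1) :
    (((A ×ˢ B).filter (fun z => φ z.1 + ψ z.2 = 0)).card : ℝ) ≤
      (A.filter (fun x => φ x = 0)).card * c0 + A.card * c1 := by
  have e : (((A ×ˢ B).filter (fun z => φ z.1 + ψ z.2 = 0)).card : ℝ) = ∑ x ∈ A, ((B.filter (fun y => ψ y = - φ x)).card : ℝ) := by
    rw [Finset.card_filter, Finset.sum_product]
    push_cast
    refine Finset.sum_congr rfl fun x _ => ?_
    rw [Finset.card_filter]; push_cast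
    refine Finset.sum_congr rfl fun y _ => ?_
    have : φ x + ψ y = 0 ↔ ψ y = - φ x := by constructor <;> intro h <;> omega
    simp only [this]
  rw [e, Finset.card_filter]
  push_cast
  rw [Finset.sum_mul, show (A.card:ℝ) * c1 = ∑ x ∈ A, c1 by rw [Finset.sum_const, nsmul_eq_mul], ← Finset.sum_add_distrib]
  refine Finset.sum_le_sum fun x hx => ?_
  by_cases h : φ x = 0
  · rw [if_pos h, h, neg_zero, one_mul]; linarith
  · rw [if_neg h, zero_mul, zero_add]; exact h1 x hx h

lemma pair_zero (P : ℕ) : (((Finset.Icc (1:ℤ) P ×ˢ Finset.Icc (1:ℤ) P).filter (fun z => z.1 ^ 3 - z.2 ^ 3 = 0)).card : ℝ) ≤ P := by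
  have : ((Finset.Icc (1:ℤ) P ×ˢ Finset.Icc (1:ℤ) P).filter (fun z => z.1 ^ 3 - z.2 ^ 3 = 0)).card ≤ (Finset.Icc (1:ℤ) P).card := by
    refine Finset.card_le_card_of_injOn (fun z => z.1) ?_ ?_
    · rintro ⟨a, b⟩ hz
      have := Finset.mem_filter.1 (Finset.mem_coe.1 hz)
      exact Finset.mem_coe.2 (Finset.mem_product.1 this.1).1
    · rintro ⟨a, b⟩ hz ⟨c, d⟩ hz' heq
      have h1 := (Finset.mem_filter.1 (Finset.mem_coe.1 hz)).2
      have h2 := (Finset.mem_filter.1 (Finset.mem_coe.1 hz')).2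
      simp only at h1 h2 heq
      have o : Odd 3 := by decide
      have h3 : a = b := o.strictMono_pow.injective (by simpa using (sub_eq_zero.1 h1))
      have h4 : c = d := o.strictMono_pow.injective (by simpa using (sub_eq_zero.1 h2))
      subst_vars; rfl
  rw [Int.card_Icc, show ((P:ℤ) + 1 - 1).toNat = P by omega] at this
  exact_mod_cast this

/-- number of zeros of the quadruple phase -/
lemma quad_count (ε : ℝ) (hε : 0 < ε) : ∃ C : ℝ, 1 ≤ C ∧ ∀ P : ℕ, 1 ≤ P →
    (((((Finset.Icc (1:ℤ) P ×ˢ Finset.Icc (1:ℤ) P) ×ˢ (Finset.Icc (1:ℤ) P ×ˢ Finset.Icc (1:ℤ) P))).filter (fun z => qph z = 0)).card : ℝ)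
      ≤ C * (P:ℝ) ^ (2 + ε) := by
  obtain ⟨C, hC, h⟩ := fourth_count ε hε
  refine ⟨1 + C, by linarith, fun P hP => ?_⟩
  have hP1 : (1:ℝ) ≤ P := by exact_mod_cast hP
  have hP0 : (0:ℝ) < P := by linarith
  have hb := count_match (Finset.Icc (1:ℤ) P ×ˢ Finset.Icc (1:ℤ) P) (Finset.Icc (1:ℤ) P ×ˢ Finset.Icc (1:ℤ) P)
    (fun z => z.1 ^ 3 - z.2 ^ 3) (fun z => -(z.1 ^ 3 - z.2 ^ 3)) P (C * (P:ℝ) ^ ε) (by positivity)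
    (by
      have := pair_zero P
      simpa only [neg_eq_zero] using this)
    (by
      rintro ⟨a, b⟩ hz hne
      simp only [neg_inj] at hne ⊢
      refine h P hP _ hne ?_
      rw [Finset.mem_product] at hz
      have := cube_diff_bound P a b hz.1 hz.2
      push_cast
      nlinarith [pow_pos hP0 3])
  have e : (fun z : (ℤ × ℤ) × (ℤ × ℤ) => qph z = 0) = (fun z => (z.1.1 ^ 3 - z.1.2 ^ 3) + -(z.2.1 ^ 3 - z.2.2 ^ 3) = 0) := by
    funext z; unfold qph; rw [sub_eq_add_neg]
  have e2 : (((((Finset.Icc (1:ℤ) P ×ˢ Finset.Icc (1:ℤ) P) ×ˢ (Finset.Icc (1:ℤ) P ×ˢ Finset.Icc (1:ℤ) P))).filter (fun z => qph z = 0)).card : ℝ)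
      ≤ (((Finset.Icc (1:ℤ) P ×ˢ Finset.Icc (1:ℤ) P).filter (fun z => z.1 ^ 3 - z.2 ^ 3 = 0)).card : ℝ) * P + (Finset.Icc (1:ℤ) P ×ˢ Finset.Icc (1:ℤ) P).card * (C * (P:ℝ) ^ ε) := by
    simp only [e]
    exact hb
  refine e2.trans ?_
  have hcard : ((Finset.Icc (1:ℤ) P ×ˢ Finset.Icc (1:ℤ) P).card : ℝ) = (P:ℝ) ^ 2 := by
    rw [Finset.card_product, Int.card_Icc, show ((P:ℤ) + 1 - 1).toNat = P by omega]; push_cast; ring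
  rw [hcard]
  have := pair_zero P
  have hr : (P:ℝ) ^ (2 + ε) = (P:ℝ) ^ 2 * (P:ℝ) ^ ε := by
    rw [Real.rpow_add hP0, Real.rpow_ofNat]
  rw [hr]
  have h1 : (1:ℝ) ≤ (P:ℝ) ^ ε := Real.one_le_rpow hP1 hε.le
  have h2 := mul_le_mul_of_nonneg_right this hP0.le
  have h3 : (P:ℝ) * P ≤ (P:ℝ) ^ 2 * (P:ℝ) ^ ε := by
    rw [← sq]; exact le_mul_of_one_le_right (by positivity) h1
  linarith

/-- Weyl differencing -/
lemma weyl_four (P : ℕ) (hP : 1 ≤ P) (α : ℝ) : ∃ g : ℝ, ((g : ℝ) : ℂ) = EE (KK P) kph α ∧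
    ‖EE (Finset.Icc (1:ℤ) P) (fun n => n ^ 3) α‖ ^ 4 ≤ 3 * P * g := by
  have hP1 : (1:ℝ) ≤ P := by exact_mod_cast hP
  refine ⟨∑ h ∈ Finset.Icc (-(P:ℤ)) P, ‖EE (BH P h) (fun b => (b + h) ^ 3 - b ^ 3) α‖ ^ 2, ?_, ?_⟩
  · rw [Complex.ofReal_sum]
    simp_rw [EE_normsq]
    unfold EE KK
    rw [Finset.sum_sigma]
    refine Finset.sum_congr rfl fun h _ => Finset.sum_congr rfl fun z _ => ?_
    congr 3
    unfold kph; push_cast; ring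
  · have h1 : ((‖EE (Finset.Icc (1:ℤ) P) (fun n => n ^ 3) α‖ ^ 2 : ℝ) : ℂ) = ∑ h ∈ Finset.Icc (-(P:ℤ)) P, EE (BH P h) (fun b => (b + h) ^ 3 - b ^ 3) α := by
      rw [EE_normsq]
      unfold EE
      rw [Finset.sum_sigma']
      refine Finset.sum_nbij' (fun z => ⟨z.1 - z.2, z.2⟩) (fun z => (z.2 + z.1, z.2)) ?_ ?_ ?_ ?_ ?_
      · rintro ⟨a, b⟩ hz
        simp only [BH, Finset.mem_sigma, Finset.mem_product, Finset.mem_filter, Finset.mem_Icc] at hz ⊢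
        omega
      · rintro ⟨a, b⟩ hz
        simp only [BH, Finset.mem_sigma, Finset.mem_product, Finset.mem_filter, Finset.mem_Icc] at hz ⊢
        omega
      · rintro ⟨a, b⟩ hz
        simp
      · rintro ⟨a, b⟩ hz
        simp
      · rintro ⟨a, b⟩ hz
        simp
    have h2 : ‖EE (Finset.Icc (1:ℤ) P) (fun n => n ^ 3) α‖ ^ 2 ≤ ∑ h ∈ Finset.Icc (-(P:ℤ)) P, ‖EE (BH P h) (fun b => (b + h) ^ 3 - b ^ 3) α‖ := by
      have := norm_sum_le (Finset.Icc (-(P:ℤ)) P) (fun h => EE (BH P h) (fun b => (b + h) ^ 3 - b ^ 3) α)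
      rwa [← h1, Complex.norm_real, Real.norm_of_nonneg (by positivity)] at this
    have h3 := sq_sum_le_card_mul_sum_sq (s := Finset.Icc (-(P:ℤ)) P) (f := fun h => ‖EE (BH P h) (fun b => (b + h) ^ 3 - b ^ 3) α‖)
    rw [Int.card_Icc, show ((P:ℤ) + 1 - -(P:ℤ)).toNat = 2 * P + 1 by omega] at h3
    calc ‖EE (Finset.Icc (1:ℤ) P) (fun n => n ^ 3) α‖ ^ 4 = (‖EE (Finset.Icc (1:ℤ) P) (fun n => n ^ 3) α‖ ^ 2) ^ 2 := by ring
      _ ≤ _ := pow_le_pow_left₀ (by positivity) h2 2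
      _ ≤ _ := h3
      _ ≤ _ := by
        refine mul_le_mul_of_nonneg_right ?_ (Finset.sum_nonneg fun _ _ => by positivity)
        push_cast; linarith

/-- Hua eighth moment for cubes -/
lemma hua_eight (ε : ℝ) (hε : 0 < ε) : ∃ C : ℝ, 1 ≤ C ∧ ∀ P : ℕ, 1 ≤ P →
    ∫ α in (0:ℝ)..1, ‖EE (Finset.Icc (1:ℤ) P) (fun n => n ^ 3) α‖ ^ 8 ≤ C * (P:ℝ) ^ (5 + ε) := by
  obtain ⟨C1, hC1, hq⟩ := quad_count ε hε
  obtain ⟨C2, hC2, he⟩ := eighth_count ε hε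
  refine ⟨3 * (4 * C1 + C2), by linarith, fun P hP => ?_⟩
  have hP1 : (1:ℝ) ≤ P := by exact_mod_cast hP
  have hP0 : (0:ℝ) < P := by linarith
  set Q := ((Finset.Icc (1:ℤ) P ×ˢ Finset.Icc (1:ℤ) P) ×ˢ (Finset.Icc (1:ℤ) P ×ˢ Finset.Icc (1:ℤ) P)) with hQ
  choose g hg1 hg2 using weyl_four P hP
  have i1 := EE_int_real (Q ×ˢ KK P) (fun z => qph z.1 + kph z.2)
    (fun α => ‖EE (Finset.Icc (1:ℤ) P) (fun n => n ^ 3) α‖ ^ 4 * g α) (by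
      intro α
      rw [Complex.ofReal_mul, EE_four, hg1, EE_mul])
  have gc : Continuous g := by
    have : g = fun α => (EE (KK P) kph α).re := by
      funext α; rw [← hg1, Complex.ofReal_re]
    rw [this]; exact Complex.continuous_re.comp (EE_cont _ _)
  have fc : Continuous fun α => ‖EE (Finset.Icc (1:ℤ) P) (fun n => n ^ 3) α‖ := (EE_cont _ _).norm
  have i2 : ∫ α in (0:ℝ)..1, ‖EE (Finset.Icc (1:ℤ) P) (fun n => n ^ 3) α‖ ^ 8 ≤
      ∫ α in (0:ℝ)..1, (3 * P) * (‖EE (Finset.Icc (1:ℤ) P) (fun n => n ^ 3) α‖ ^ 4 * g α) := by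
    refine intervalIntegral.integral_mono_on zero_le_one ((fc.pow 8).intervalIntegrable _ _)
      ((continuous_const.mul ((fc.pow 4).mul gc)).intervalIntegrable _ _) fun α _ => ?_
    have := mul_le_mul_of_nonneg_left (hg2 α) (show 0 ≤ ‖EE (Finset.Icc (1:ℤ) P) (fun n => n ^ 3) α‖ ^ 4 by positivity)
    calc _ = ‖EE (Finset.Icc (1:ℤ) P) (fun n => n ^ 3) α‖ ^ 4 * ‖EE (Finset.Icc (1:ℤ) P) (fun n => n ^ 3) α‖ ^ 4 := by ring
      _ ≤ _ := this
      _ = _ := by ring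
  rw [intervalIntegral.integral_const_mul, i1] at i2
  have cm := count_match Q (KK P) qph kph (4 * (P:ℝ) ^ 2) (C2 * (P:ℝ) ^ ε) (by positivity) (kk_zero P hP) (by
    rintro ⟨⟨a, b⟩, ⟨c, d⟩⟩ hz hne
    refine he P hP _ (neg_ne_zero.2 hne) ?_
    simp only [hQ, Finset.mem_product] at hz
    have b1 := cube_diff_bound P a b hz.1.1 hz.1.2
    have b2 := cube_diff_bound P c d hz.2.1 hz.2.2
    unfold qph
    push_cast
    rw [abs_neg]
    refine (abs_sub _ _).trans ?_
    nlinarith [pow_pos hP0 3])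
  have hcard : (Q.card : ℝ) = (P:ℝ) ^ 4 := by
    rw [hQ, Finset.card_product, Finset.card_product, Int.card_Icc, show ((P:ℤ) + 1 - 1).toNat = P by omega]; push_cast; ring
  have hq1 := hq P hP
  rw [hcard] at cm
  have e1 : (P:ℝ) ^ (2 + ε) = (P:ℝ) ^ 2 * (P:ℝ) ^ ε := by
    rw [Real.rpow_add hP0, Real.rpow_ofNat]
  have e2 : (P:ℝ) ^ (5 + ε) = (P:ℝ) ^ 5 * (P:ℝ) ^ ε := by
    rw [Real.rpow_add hP0, Real.rpow_ofNat]
  rw [e1] at hq1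
  rw [e2]
  have h2 := mul_le_mul_of_nonneg_right hq1 (show (0:ℝ) ≤ 4 * (P:ℝ) ^ 2 by positivity)
  have h3 := mul_le_mul_of_nonneg_left (cm.trans (add_le_add h2 le_rfl)) (show (0:ℝ) ≤ 3 * P by positivity)
  refine i2.trans (h3.trans (le_of_eq ?_))
  ring


/-- weighted linear exponential sum -/
noncomputable def FF (w : ℕ → ℝ) (N : ℕ) (α : ℝ) : ℂ :=
  ∑ p ∈ Finset.range (N + 1), ((w p : ℝ) : ℂ) * eexp (α * (p:ℝ))

lemma FF_cont (w : ℕ → ℝ) (N : ℕ) : Continuous (FF w N) := by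
  unfold FF
  exact continuous_finsetSum _ fun x _ => continuous_const.mul (eexp_cont.comp (by fun_prop))

lemma FF_parseval (w : ℕ → ℝ) (N : ℕ) :
    ∫ α in (0:ℝ)..1, ‖FF w N α‖ ^ 2 = ∑ p ∈ Finset.range (N + 1), w p ^ 2 := by
  have h : ∀ α : ℝ, ((‖FF w N α‖ ^ 2 : ℝ) : ℂ) = ∑ p ∈ Finset.range (N + 1), ∑ q ∈ Finset.range (N + 1),
      ((w p * w q : ℝ) : ℂ) * eexp (α * (((p:ℤ) - (q:ℤ) : ℤ) : ℝ)) := by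
    intro α
    rw [← Complex.normSq_eq_norm_sq, ← Complex.mul_conj]
    unfold FF
    rw [map_sum, Finset.sum_mul_sum]
    refine Finset.sum_congr rfl fun p _ => Finset.sum_congr rfl fun q _ => ?_
    push_cast
    rw [mul_sub, eexp_sub, map_mul, Complex.conj_ofReal]
    ring
  have h2 : ((∫ α in (0:ℝ)..1, ‖FF w N α‖ ^ 2 : ℝ) : ℂ) = ((∑ p ∈ Finset.range (N + 1), w p ^ 2 : ℝ) : ℂ) := by
    rw [← intervalIntegral.integral_ofReal]
    simp_rw [h]
    rw [intervalIntegral.integral_finsetSum]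
    · rw [Complex.ofReal_sum]
      refine Finset.sum_congr rfl fun p hp => ?_
      rw [intervalIntegral.integral_finsetSum]
      · simp_rw [intervalIntegral.integral_const_mul, int_eexp]
        rw [Finset.sum_eq_single p]
        · simp [sq]
        · intro q _ hq
          rw [if_neg (by omega), mul_zero]
        · intro hh; exact absurd hp hh
      · intro q _
        exact (continuous_const.mul (eexp_cont.comp (by fun_prop))).intervalIntegrable _ _
    · intro p _
      exact (continuous_finsetSum _ fun q _ => continuous_const.mul (eexp_cont.comp (by fun_prop))).intervalIntegrable _ _
  exact_mod_cast h2

lemma cs_int (f g : ℝ → ℝ) (hf : Continuous f) (hg : Continuous g) :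
    (∫ α in (0:ℝ)..1, f α * g α) ^ 2 ≤ (∫ α in (0:ℝ)..1, f α ^ 2) * (∫ α in (0:ℝ)..1, g α ^ 2) := by
  have h : ∀ t : ℝ, 0 ≤ (∫ α in (0:ℝ)..1, g α ^ 2) * (t * t) + (2 * ∫ α in (0:ℝ)..1, f α * g α) * t + ∫ α in (0:ℝ)..1, f α ^ 2 := by
    intro t
    have e : ∫ α in (0:ℝ)..1, (f α + t * g α) ^ 2 = (∫ α in (0:ℝ)..1, g α ^ 2) * (t * t) + (2 * ∫ α in (0:ℝ)..1, f α * g α) * t + ∫ α in (0:ℝ)..1, f α ^ 2 := by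
      have e1 : ∀ α, (f α + t * g α) ^ 2 = (t * t) * g α ^ 2 + (2 * t) * (f α * g α) + f α ^ 2 := fun α => by ring
      simp_rw [e1]
      rw [intervalIntegral.integral_add, intervalIntegral.integral_add, intervalIntegral.integral_const_mul, intervalIntegral.integral_const_mul]
      · ring
      · exact (by fun_prop : Continuous fun α => t * t * g α ^ 2).intervalIntegrable _ _
      · exact (by fun_prop : Continuous fun α => 2 * t * (f α * g α)).intervalIntegrable _ _
      · exact (by fun_prop : Continuous fun α => t * t * g α ^ 2 + 2 * t * (f α * g α)).intervalIntegrable _ _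
      · exact (by fun_prop : Continuous fun α => f α ^ 2).intervalIntegrable _ _
    rw [← e]
    exact intervalIntegral.integral_nonneg zero_le_one fun _ _ => by positivity
  have := discrim_le_zero h
  unfold discrim at this
  nlinarith

lemma int_nonneg' (f : ℝ → ℝ) (h : ∀ α, 0 ≤ f α) : 0 ≤ ∫ α in (0:ℝ)..1, f α :=
  intervalIntegral.integral_nonneg zero_le_one fun _ _ => h _

/-- triple Cauchy-Schwarz -/
lemma cs_eight (T D S : ℝ → ℝ) (hT : Continuous T) (hD : Continuous D) (hS : Continuous S)
    (hD0 : ∀ α, 0 ≤ D α) (M : ℝ) (hM : ∀ α, D α ≤ M) :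
    (∫ α in (0:ℝ)..1, T α * (D α * S α)) ^ 8 ≤
      (∫ α in (0:ℝ)..1, T α ^ 2) ^ 4 * (∫ α in (0:ℝ)..1, D α ^ 2) ^ 3 * M ^ 2 * (∫ α in (0:ℝ)..1, S α ^ 8) := by
  have c1 := cs_int T (fun α => D α * S α) hT (hD.mul hS)
  have c2 := cs_int D (fun α => D α * S α ^ 2) hD (hD.mul (hS.pow 2))
  have c3 := cs_int (fun α => D α ^ 2) (fun α => S α ^ 4) (hD.pow 2) (hS.pow 4)
  have M0 : 0 ≤ M := (hD0 0).trans (hM 0)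
  have c4 : ∫ α in (0:ℝ)..1, (D α ^ 2) ^ 2 ≤ M ^ 2 * ∫ α in (0:ℝ)..1, D α ^ 2 := by
    rw [← intervalIntegral.integral_const_mul]
    refine intervalIntegral.integral_mono_on zero_le_one (((hD.pow 2).pow 2).intervalIntegrable _ _) ((continuous_const.mul (hD.pow 2)).intervalIntegrable _ _) fun α _ => ?_
    rw [sq (D α ^ 2)]
    exact mul_le_mul_of_nonneg_right (pow_le_pow_left₀ (hD0 α) (hM α) 2) (by positivity)
  have e1 : ∫ α in (0:ℝ)..1, D α * (D α * S α ^ 2) = ∫ α in (0:ℝ)..1, (D α * S α) ^ 2 := by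
    congr 1; funext α; ring
  have e2 : ∫ α in (0:ℝ)..1, (D α * S α ^ 2) ^ 2 = ∫ α in (0:ℝ)..1, D α ^ 2 * S α ^ 4 := by
    congr 1; funext α; ring
  have e3 : ∫ α in (0:ℝ)..1, (S α ^ 4) ^ 2 = ∫ α in (0:ℝ)..1, S α ^ 8 := by
    congr 1; funext α; ring
  rw [e1, e2] at c2
  rw [e3] at c3
  have t0 := int_nonneg' (fun α => T α ^ 2) (fun α => by positivity)
  have a0 := int_nonneg' (fun α => D α ^ 2) (fun α => by positivity)
  have j0 := int_nonneg' (fun α => S α ^ 8) (fun α => by positivity)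
  have y0 := int_nonneg' (fun α => (D α * S α) ^ 2) (fun α => by positivity)
  have z0 := int_nonneg' (fun α => D α ^ 2 * S α ^ 4) (fun α => by positivity)
  set X := ∫ α in (0:ℝ)..1, T α * (D α * S α)
  set Y := ∫ α in (0:ℝ)..1, (D α * S α) ^ 2
  set Z := ∫ α in (0:ℝ)..1, D α ^ 2 * S α ^ 4
  set t := ∫ α in (0:ℝ)..1, T α ^ 2
  set A := ∫ α in (0:ℝ)..1, D α ^ 2
  set J := ∫ α in (0:ℝ)..1, S α ^ 8
  have hZ : Z ^ 2 ≤ M ^ 2 * A * J := c3.trans (mul_le_mul_of_nonneg_right c4 j0)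
  calc X ^ 8 = (X ^ 2) ^ 4 := by ring
    _ ≤ (t * Y) ^ 4 := pow_le_pow_left₀ (by positivity) c1 4
    _ = t ^ 4 * (Y ^ 2) ^ 2 := by ring
    _ ≤ t ^ 4 * (A * Z) ^ 2 := mul_le_mul_of_nonneg_left (pow_le_pow_left₀ (by positivity) c2 2) (by positivity)
    _ = t ^ 4 * A ^ 2 * Z ^ 2 := by ring
    _ ≤ t ^ 4 * A ^ 2 * (M ^ 2 * A * J) := mul_le_mul_of_nonneg_left hZ (by positivity)
    _ = _ := by ring

noncomputable def wT (γ : ℝ) (p : ℕ) : ℝ := if p ∈ PiatetskiShapiroSet γ then γ⁻¹ * (p:ℝ) ^ (1 - γ) else 0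
noncomputable def wS (p : ℕ) : ℝ := if p.Prime then 1 else 0

lemma T₁_eq (γ : ℝ) (N : ℕ) (α : ℝ) : T₁ γ N α = FF (wT γ) N α := by
  unfold T₁ FF wT
  rw [Finset.sum_filter, Finset.mul_sum]
  refine Finset.sum_congr rfl fun p _ => ?_
  split_ifs
  · push_cast; ring
  · simp

lemma S₁_eq (N : ℕ) (α : ℝ) : S₁ N α = FF wS N α := by
  unfold S₁ FF wS
  rw [Finset.sum_filter]
  refine Finset.sum_congr rfl fun p _ => ?_
  split_ifs <;> simp

lemma ps_prime {γ : ℝ} {p : ℕ} (h : p ∈ PiatetskiShapiroSet γ) : p.Prime := h.1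

lemma wD_eq (γ : ℝ) (p : ℕ) : wT γ p - wS p = if p.Prime then psc γ p else 0 := by
  unfold wT wS psc
  by_cases h : p.Prime
  · simp only [h, if_true]
    split_ifs <;> ring
  · have h2 : p ∉ PiatetskiShapiroSet γ := fun h' => h (ps_prime h')
    simp [h, h2]

lemma FF_sub (w v : ℕ → ℝ) (N : ℕ) (α : ℝ) : FF w N α - FF v N α = FF (fun p => w p - v p) N α := by
  unfold FF
  rw [← Finset.sum_sub_distrib]
  refine Finset.sum_congr rfl fun p _ => ?_
  push_cast; ring

lemma propA' (γ : ℝ) (h : 97/100 ≤ γ) (h1 : γ ≤ 1) : ∃ C : ℝ, 1 ≤ C ∧ ∀ (X : ℕ) (a1 a3 : ℝ), 1 ≤ X →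
    ‖∑ p ∈ (Finset.Ioc 0 X).filter Nat.Prime, ((psc γ p : ℝ) : ℂ) * eexp (a1 * p + a3 * (p:ℝ) ^ 3)‖ ≤ C * (X:ℝ) ^ (1 - 270/10000 + (1 - γ)) := by
  rcases h1.lt_or_eq with h2 | h2
  · exact propA γ h h2
  · refine ⟨1, le_rfl, fun X a1 a3 hX => ?_⟩
    rw [Finset.sum_eq_zero]
    · rw [norm_zero]; positivity
    · intro p hp
      have hp' := (Finset.mem_filter.1 hp).2
      have : p ∈ PiatetskiShapiroSet γ := ⟨hp', p, hp'.pos, by rw [h2]; simp⟩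
      have : psc γ p = 0 := by
        unfold psc; rw [if_pos this, h2]; simp
      rw [this]; simp

lemma FD_bound (γ : ℝ) (h : 97/100 ≤ γ) (h1 : γ ≤ 1) : ∃ C : ℝ, 1 ≤ C ∧ ∀ (N : ℕ) (α : ℝ), 1 ≤ N →
    ‖FF (fun p => wT γ p - wS p) N α‖ ≤ C * (N:ℝ) ^ (1 - 270/10000 + (1 - γ)) := by
  obtain ⟨C, hC, hb⟩ := propA' γ h h1
  refine ⟨C, hC, fun N α hN => ?_⟩
  have := hb N α 0 hN
  refine le_trans (le_of_eq ?_) this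
  congr 1
  unfold FF
  simp_rw [wD_eq]
  rw [Finset.sum_filter]
  symm
  rw [Finset.sum_subset (s₂ := Finset.range (N+1))]
  · refine Finset.sum_congr rfl fun p _ => ?_
    split_ifs <;> simp
  · intro p hp; rw [Finset.mem_Ioc] at hp; rw [Finset.mem_range]; omega
  · intro p hp hp'
    rw [Finset.mem_range] at hp
    rw [Finset.mem_Ioc] at hp'
    have : p = 0 := by omega
    subst this
    rw [if_neg Nat.not_prime_zero]

lemma cube_root_floor (N : ℕ) (hN : 1 ≤ N) : 1 ≤ ⌊(N:ℝ) ^ ((1:ℝ)/3)⌋₊ ∧ ⌊(N:ℝ) ^ ((1:ℝ)/3)⌋₊ ≤ N := by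
  have hN1 : (1:ℝ) ≤ N := by exact_mod_cast hN
  constructor
  · rw [Nat.one_le_floor_iff]; exact Real.one_le_rpow hN1 (by norm_num)
  · refine Nat.floor_le_of_le ?_
    calc (N:ℝ) ^ ((1:ℝ)/3) ≤ (N:ℝ) ^ (1:ℝ) := Real.rpow_le_rpow_of_exponent_le hN1 (by norm_num)
      _ = N := Real.rpow_one _

lemma cube_filter (N : ℕ) (hN : 1 ≤ N) (p : ℕ) :
    (p ∈ Finset.range (N+1) ∧ p.Prime ∧ (p:ℝ) ≤ (N:ℝ) ^ ((1:ℝ)/3)) ↔ (p ∈ Finset.Ioc 0 ⌊(N:ℝ) ^ ((1:ℝ)/3)⌋₊ ∧ p.Prime) := by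
  obtain ⟨h1, h2⟩ := cube_root_floor N hN
  rw [Finset.mem_range, Finset.mem_Ioc]
  constructor
  · rintro ⟨a, b, c⟩
    exact ⟨⟨b.pos, Nat.le_floor c⟩, b⟩
  · rintro ⟨⟨a, b⟩, c⟩
    exact ⟨by omega, c, (Nat.le_floor_iff (by positivity)).1 b⟩

lemma S₃_eq (N : ℕ) (hN : 1 ≤ N) (α : ℝ) :
    S₃ N α = ∑ p ∈ (Finset.Ioc 0 ⌊(N:ℝ) ^ ((1:ℝ)/3)⌋₊).filter Nat.Prime, eexp (α * (p:ℝ) ^ 3) := by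
  unfold S₃
  refine Finset.sum_congr ?_ fun _ _ => rfl
  ext p
  rw [Finset.mem_filter, Finset.mem_filter, cube_filter N hN]

lemma T₃_sub (γ : ℝ) (N : ℕ) (hN : 1 ≤ N) (α : ℝ) :
    T₃ γ N α - S₃ N α = ∑ p ∈ (Finset.Ioc 0 ⌊(N:ℝ) ^ ((1:ℝ)/3)⌋₊).filter Nat.Prime,
      ((psc γ p : ℝ) : ℂ) * eexp (0 * p + α * (p:ℝ) ^ 3) := by
  have hT : T₃ γ N α = ∑ p ∈ (Finset.Ioc 0 ⌊(N:ℝ) ^ ((1:ℝ)/3)⌋₊).filter Nat.Prime,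
      (if p ∈ PiatetskiShapiroSet γ then ((γ⁻¹:ℝ):ℂ) * ((((p : ℝ) ^ (1 - γ) : ℝ) : ℂ) * eexp (α * (p : ℝ) ^ 3)) else 0) := by
    unfold T₃
    rw [Finset.mul_sum, ← Finset.sum_filter]
    refine Finset.sum_congr ?_ fun _ _ => rfl
    ext p
    rw [Finset.mem_filter, Finset.mem_filter, Finset.mem_filter, ← cube_filter N hN]
    constructor
    · rintro ⟨a, b, c⟩; exact ⟨⟨a, ps_prime b, c⟩, b⟩
    · rintro ⟨⟨a, b, c⟩, d⟩; exact ⟨a, d, c⟩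
  rw [hT, S₃_eq N hN, ← Finset.sum_sub_distrib]
  refine Finset.sum_congr rfl fun p _ => ?_
  unfold psc
  rw [zero_mul, zero_add]
  split_ifs <;> push_cast <;> ring

lemma TD3_bound (γ : ℝ) (h : 97/100 ≤ γ) (h1 : γ ≤ 1) : ∃ C : ℝ, 1 ≤ C ∧ ∀ (N : ℕ) (α : ℝ), 1 ≤ N →
    ‖T₃ γ N α - S₃ N α‖ ≤ C * (N:ℝ) ^ ((1 - 270/10000 + (1 - γ)) / 3) := by
  obtain ⟨C, hC, hb⟩ := propA' γ h h1
  refine ⟨C, hC, fun N α hN => ?_⟩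
  rw [T₃_sub γ N hN]
  refine (hb _ 0 α (cube_root_floor N hN).1).trans ?_
  refine mul_le_mul_of_nonneg_left ?_ (by linarith)
  calc (⌊(N:ℝ) ^ ((1:ℝ)/3)⌋₊:ℝ) ^ (1 - 270/10000 + (1 - γ)) ≤ ((N:ℝ) ^ ((1:ℝ)/3)) ^ (1 - 270/10000 + (1 - γ)) :=
        Real.rpow_le_rpow (by positivity) (Nat.floor_le (by positivity)) (by linarith)
    _ = _ := by rw [← Real.rpow_mul (by positivity)]; congr 1; ring

lemma S3_eight (ε : ℝ) (hε : 0 < ε) : ∃ C : ℝ, 1 ≤ C ∧ ∀ N : ℕ, 1 ≤ N →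
    ∫ α in (0:ℝ)..1, ‖S₃ N α‖ ^ 8 ≤ C * (N:ℝ) ^ ((5 + ε) / 3) := by
  obtain ⟨C, hC, hb⟩ := hua_eight ε hε
  refine ⟨C, hC, fun N hN => ?_⟩
  obtain ⟨h1, h2⟩ := cube_root_floor N hN
  set X := ⌊(N:ℝ) ^ ((1:ℝ)/3)⌋₊ with hX
  have e : ∀ α, S₃ N α = EE (((Finset.Ioc 0 X).filter Nat.Prime).image (fun p : ℕ => (p:ℤ))) (fun n => n ^ 3) α := by
    intro α
    rw [S₃_eq N hN]
    unfold EE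
    rw [Finset.sum_image (fun a _ b _ h => by exact_mod_cast h)]
    refine Finset.sum_congr rfl fun p _ => ?_
    push_cast; rfl
  simp_rw [e]
  refine (EE_eight_mono _ (Finset.Icc (1:ℤ) X) ?_).trans ((hb X h1).trans ?_)
  · intro n hn
    rw [Finset.mem_image] at hn
    obtain ⟨p, hp, rfl⟩ := hn
    have := Finset.mem_Ioc.1 (Finset.mem_filter.1 hp).1
    rw [Finset.mem_Icc]; omega
  · refine mul_le_mul_of_nonneg_left ?_ (by linarith)
    calc (X:ℝ) ^ (5 + ε) ≤ ((N:ℝ) ^ ((1:ℝ)/3)) ^ (5 + ε) :=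
        Real.rpow_le_rpow (by positivity) (Nat.floor_le (by positivity)) (by linarith)
      _ = _ := by rw [← Real.rpow_mul (by positivity)]; congr 1; ring

lemma ps_count (γ : ℝ) (h0 : 0 < γ) (h1 : γ ≤ 1) (N : ℕ) (hN : 1 ≤ N) :
    (((Finset.range (N+1)).filter (fun p => p ∈ PiatetskiShapiroSet γ)).card : ℝ) ≤ 4 * (N:ℝ) ^ γ := by
  have hN1 : (1:ℝ) ≤ N := by exact_mod_cast hN
  set K := ⌊((N:ℝ) + 1) ^ γ⌋₊ with hK
  have c : ((Finset.range (N+1)).filter (fun p => p ∈ PiatetskiShapiroSet γ)).card ≤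
      ((Finset.range (K+1)).image (fun m : ℕ => ⌊(m : ℝ) ^ ((1 : ℝ) / γ)⌋₊)).card := by
    refine Finset.card_le_card ?_
    intro p hp
    obtain ⟨hpN, hp⟩ := Finset.mem_filter.1 hp
    rw [Finset.mem_range] at hpN
    obtain ⟨hpr, m, hm, he⟩ := hp
    rw [Finset.mem_image]
    refine ⟨m, ?_, he.symm⟩
    rw [Finset.mem_range]
    refine Nat.lt_succ_of_le (Nat.le_floor ?_)
    have h2 := Nat.lt_floor_add_one ((m:ℝ) ^ ((1:ℝ)/γ))
    rw [← he, one_div, Real.rpow_inv_lt_iff_of_pos (by positivity) (by positivity) h0] at h2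
    refine h2.le.trans (Real.rpow_le_rpow (by positivity) ?_ h0.le)
    have : (p:ℝ) ≤ N := by exact_mod_cast (by omega : p ≤ N)
    linarith
  have c2 := c.trans Finset.card_image_le
  rw [Finset.card_range] at c2
  have c3 : (((Finset.range (N+1)).filter (fun p => p ∈ PiatetskiShapiroSet γ)).card : ℝ) ≤ K + 1 := by exact_mod_cast c2
  have c4 : (K:ℝ) ≤ ((N:ℝ) + 1) ^ γ := Nat.floor_le (by positivity)
  have c5 := Real.rpow_add_le_add_rpow (show (0:ℝ) ≤ N by positivity) zero_le_one h0.le h1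
  rw [Real.one_rpow] at c5
  have c6 : (1:ℝ) ≤ (N:ℝ) ^ γ := Real.one_le_rpow hN1 h0.le
  linarith

lemma wT_sq (γ : ℝ) (h0 : 97/100 ≤ γ) (h1 : γ ≤ 1) (N : ℕ) (hN : 1 ≤ N) :
    ∑ p ∈ Finset.range (N+1), wT γ p ^ 2 ≤ 8 * (N:ℝ) ^ (1 + (1 - γ)) := by
  have hN1 : (1:ℝ) ≤ N := by exact_mod_cast hN
  have hN0 : (0:ℝ) < N := by linarith
  have hγi : (γ⁻¹) ^ 2 ≤ 2 := by
    rw [inv_pow, inv_le_comm₀ (by positivity) (by norm_num)]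
    nlinarith
  have e : ∀ p, wT γ p ^ 2 = if p ∈ PiatetskiShapiroSet γ then (γ⁻¹ * (p:ℝ) ^ (1 - γ)) ^ 2 else 0 := by
    intro p; unfold wT; split_ifs <;> simp
  simp_rw [e]
  rw [← Finset.sum_filter]
  have := Finset.sum_le_card_nsmul ((Finset.range (N+1)).filter (fun p => p ∈ PiatetskiShapiroSet γ))
    (fun p => (γ⁻¹ * (p:ℝ) ^ (1 - γ)) ^ 2) (2 * (N:ℝ) ^ (2 * (1 - γ))) (by
      intro p hp
      have hp1 := Finset.mem_range.1 (Finset.mem_filter.1 hp).1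
      have hp2 : (p:ℝ) ≤ N := by exact_mod_cast (by omega : p ≤ N)
      rw [mul_pow, ← Real.rpow_natCast _ 2, ← Real.rpow_natCast _ 2, ← Real.rpow_mul (by positivity), Real.rpow_natCast]
      refine mul_le_mul hγi ?_ (by positivity) (by norm_num)
      rw [show (1 - γ) * ((2:ℕ):ℝ) = 2 * (1 - γ) by push_cast; ring]
      exact Real.rpow_le_rpow (by positivity) hp2 (by linarith))
  refine this.trans ?_
  rw [nsmul_eq_mul]
  refine (mul_le_mul_of_nonneg_right (ps_count γ (by linarith) h1 N hN) (by positivity)).trans (le_of_eq ?_)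
  rw [show (1 + (1 - γ)) = γ + 2 * (1 - γ) by ring, Real.rpow_add hN0]
  ring

lemma wS_sq (N : ℕ) (hN : 1 ≤ N) : ∑ p ∈ Finset.range (N+1), wS p ^ 2 ≤ 2 * (N:ℝ) := by
  have hN1 : (1:ℝ) ≤ N := by exact_mod_cast hN
  have := Finset.sum_le_card_nsmul (Finset.range (N+1)) (fun p => wS p ^ 2) 1 (by
    intro p _; unfold wS; split_ifs <;> simp)
  rw [nsmul_eq_mul, Finset.card_range] at this
  push_cast at this
  linarith

lemma wD_sq (γ : ℝ) (h0 : 97/100 ≤ γ) (h1 : γ ≤ 1) (N : ℕ) (hN : 1 ≤ N) :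
    ∑ p ∈ Finset.range (N+1), (wT γ p - wS p) ^ 2 ≤ 20 * (N:ℝ) ^ (1 + (1 - γ)) := by
  have hN1 : (1:ℝ) ≤ N := by exact_mod_cast hN
  have a := wT_sq γ h0 h1 N hN
  have b := wS_sq N hN
  have c : ∑ p ∈ Finset.range (N+1), (wT γ p - wS p) ^ 2 ≤ ∑ p ∈ Finset.range (N+1), (2 * wT γ p ^ 2 + 2 * wS p ^ 2) := by
    refine Finset.sum_le_sum fun p _ => ?_
    nlinarith [sq_nonneg (wT γ p + wS p)]
  rw [Finset.sum_add_distrib, ← Finset.mul_sum, ← Finset.mul_sum] at c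
  have d : (N:ℝ) ≤ (N:ℝ) ^ (1 + (1 - γ)) := by
    calc (N:ℝ) = (N:ℝ) ^ (1:ℝ) := (Real.rpow_one _).symm
      _ ≤ _ := Real.rpow_le_rpow_of_exponent_le hN1 (by linarith)
  linarith


lemma S₃_cont (N : ℕ) : Continuous (S₃ N) := by
  unfold S₃
  exact continuous_finsetSum _ fun x _ => eexp_cont.comp (by fun_prop)

lemma T₃_cont (γ : ℝ) (N : ℕ) : Continuous (T₃ γ N) := by
  unfold T₃
  exact continuous_const.mul (continuous_finsetSum _ fun x _ => continuous_const.mul (eexp_cont.comp (by fun_prop)))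

lemma term8 (γ : ℝ) (h0 : 97/100 ≤ γ) (h1 : γ ≤ 1) (w : ℕ → ℝ) (a : ℝ)
    (hw : ∀ N : ℕ, 1 ≤ N → ∑ p ∈ Finset.range (N+1), w p ^ 2 ≤ 8 * (N:ℝ) ^ (1 + a))
    (δ : ℝ) (hδ : δ ≤ 270/10000 - (1 - γ)) (hη : 4 * a + 3 * (1 - γ) < 2 * δ) :
    ∃ C : ℝ, 1 ≤ C ∧ ∃ η : ℝ, 0 < η ∧ ∀ N : ℕ, 1 ≤ N →
      ∫ α in (0:ℝ)..1, ‖FF w N α‖ * (‖FF (fun p => wT γ p - wS p) N α‖ * ‖S₃ N α‖) ≤ C * (N:ℝ) ^ (4/3 - η) := by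
  obtain ⟨C1, hC1, hD⟩ := FD_bound γ h0 h1
  obtain ⟨C2, hC2, hJ⟩ := S3_eight (3/2 * (2 * δ - 4 * a - 3 * (1 - γ))) (by linarith)
  have hK1 : (1:ℝ) ≤ 8 ^ 4 * 20 ^ 3 * C1 ^ 2 * C2 := by
    have : 1 ≤ C1 ^ 2 := one_le_pow₀ hC1
    nlinarith
  refine ⟨8 ^ 4 * 20 ^ 3 * C1 ^ 2 * C2, hK1, (2 * δ - 4 * a - 3 * (1 - γ)) / 16, by linarith, fun N hN => ?_⟩
  have hN1 : (1:ℝ) ≤ N := by exact_mod_cast hN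
  have hN0 : (0:ℝ) < N := by linarith
  have hM : ∀ α, ‖FF (fun p => wT γ p - wS p) N α‖ ≤ C1 * (N:ℝ) ^ (1 - δ) := fun α =>
    (hD N α hN).trans (mul_le_mul_of_nonneg_left (Real.rpow_le_rpow_of_exponent_le hN1 (by linarith)) (by linarith))
  have key := cs_eight (fun α => ‖FF w N α‖) (fun α => ‖FF (fun p => wT γ p - wS p) N α‖) (fun α => ‖S₃ N α‖)
    (FF_cont _ _).norm (FF_cont _ _).norm (S₃_cont N).norm (fun α => norm_nonneg _) _ hM
  simp only [FF_parseval] at key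
  have hw1 := hw N hN
  have hd1 := wD_sq γ h0 h1 N hN
  have hj1 := hJ N hN
  have s0 : 0 ≤ ∑ p ∈ Finset.range (N+1), w p ^ 2 := Finset.sum_nonneg fun _ _ => by positivity
  have s1 : 0 ≤ ∑ p ∈ Finset.range (N+1), (wT γ p - wS p) ^ 2 := Finset.sum_nonneg fun _ _ => by positivity
  have b : (∑ p ∈ Finset.range (N+1), w p ^ 2) ^ 4 * (∑ p ∈ Finset.range (N+1), (wT γ p - wS p) ^ 2) ^ 3 * (C1 * (N:ℝ) ^ (1 - δ)) ^ 2 * (∫ α in (0:ℝ)..1, ‖S₃ N α‖ ^ 8)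
      ≤ (8 * (N:ℝ) ^ (1 + a)) ^ 4 * (20 * (N:ℝ) ^ (1 + (1 - γ))) ^ 3 * (C1 * (N:ℝ) ^ (1 - δ)) ^ 2 * (C2 * (N:ℝ) ^ ((5 + 3/2 * (2 * δ - 4 * a - 3 * (1 - γ))) / 3)) := by
    refine mul_le_mul ?_ hj1 (int_nonneg' _ fun _ => by positivity) (by positivity)
    refine mul_le_mul_of_nonneg_right ?_ (by positivity)
    exact mul_le_mul (pow_le_pow_left₀ s0 hw1 4) (pow_le_pow_left₀ s1 hd1 3) (by positivity) (by positivity)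
  have pw : ∀ (x : ℝ) (n : ℕ), ((N:ℝ) ^ x) ^ n = (N:ℝ) ^ (x * n) := fun x n => by
    rw [Real.rpow_mul hN0.le, Real.rpow_natCast]
  have e : (8 * (N:ℝ) ^ (1 + a)) ^ 4 * (20 * (N:ℝ) ^ (1 + (1 - γ))) ^ 3 * (C1 * (N:ℝ) ^ (1 - δ)) ^ 2 * (C2 * (N:ℝ) ^ ((5 + 3/2 * (2 * δ - 4 * a - 3 * (1 - γ))) / 3))
      = (8 ^ 4 * 20 ^ 3 * C1 ^ 2 * C2) * ((N:ℝ) ^ (4/3 - (2 * δ - 4 * a - 3 * (1 - γ)) / 16)) ^ 8 := by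
    rw [mul_pow, mul_pow, mul_pow, pw, pw, pw, pw]
    rw [show (4/3 - (2 * δ - 4 * a - 3 * (1 - γ)) / 16) * ((8:ℕ):ℝ) = (1 + a) * ((4:ℕ):ℝ) + (1 + (1 - γ)) * ((3:ℕ):ℝ) + (1 - δ) * ((2:ℕ):ℝ) + (5 + 3/2 * (2 * δ - 4 * a - 3 * (1 - γ))) / 3 by push_cast; ring,
      Real.rpow_add hN0, Real.rpow_add hN0, Real.rpow_add hN0]
    ring
  rw [e] at b
  refine le_of_pow_le_pow_left₀ (n := 8) (by norm_num) (by positivity) ((key.trans b).trans ?_)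
  rw [mul_pow]
  exact mul_le_mul_of_nonneg_right (le_self_pow₀ hK1 (by norm_num)) (by positivity)

lemma term2 (γ₁ γ₂ γ₃ δ : ℝ) (h1 : 97/100 ≤ γ₁) (h1' : γ₁ ≤ 1) (h2 : 97/100 ≤ γ₂) (h2' : γ₂ ≤ 1)
    (h3 : 97/100 ≤ γ₃) (h3' : γ₃ ≤ 1) (hδ : δ ≤ 270/10000 - (1 - γ₃)) (hη : 3 * ((1 - γ₁) + (1 - γ₂)) < 2 * δ) :
    ∃ C : ℝ, 1 ≤ C ∧ ∃ η : ℝ, 0 < η ∧ ∀ N : ℕ, 1 ≤ N →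
      ∫ α in (0:ℝ)..1, ‖FF (wT γ₁) N α‖ * ‖FF (wT γ₂) N α‖ * ‖T₃ γ₃ N α - S₃ N α‖ ≤ C * (N:ℝ) ^ (4/3 - η) := by
  obtain ⟨C, hC, hD⟩ := TD3_bound γ₃ h3 h3'
  refine ⟨8 * C, by linarith, (2 * δ - 3 * ((1 - γ₁) + (1 - γ₂))) / 6, by linarith, fun N hN => ?_⟩
  have hN1 : (1:ℝ) ≤ N := by exact_mod_cast hN
  have hN0 : (0:ℝ) < N := by linarith
  have hM : ∀ α, ‖T₃ γ₃ N α - S₃ N α‖ ≤ C * (N:ℝ) ^ ((1 - δ) / 3) := fun α =>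
    (hD N α hN).trans (mul_le_mul_of_nonneg_left (Real.rpow_le_rpow_of_exponent_le hN1 (by linarith)) (by linarith))
  have c1 := (FF_cont (wT γ₁) N).norm
  have c2 := (FF_cont (wT γ₂) N).norm
  have i1 : ∫ α in (0:ℝ)..1, ‖FF (wT γ₁) N α‖ * ‖FF (wT γ₂) N α‖ * ‖T₃ γ₃ N α - S₃ N α‖ ≤
      ∫ α in (0:ℝ)..1, (C * (N:ℝ) ^ ((1 - δ) / 3)) * (‖FF (wT γ₁) N α‖ * ‖FF (wT γ₂) N α‖) := by
    refine intervalIntegral.integral_mono_on zero_le_one (((c1.mul c2).mul ((T₃_cont γ₃ N).sub (S₃_cont N)).norm).intervalIntegrable _ _)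
      ((continuous_const.mul (c1.mul c2)).intervalIntegrable _ _) fun α _ => ?_
    rw [mul_comm (C * _)]
    exact mul_le_mul_of_nonneg_left (hM α) (by positivity)
  rw [intervalIntegral.integral_const_mul] at i1
  have cs := cs_int _ _ c1 c2
  rw [FF_parseval, FF_parseval] at cs
  have s0 : 0 ≤ ∑ p ∈ Finset.range (N+1), wT γ₂ p ^ 2 := Finset.sum_nonneg fun _ _ => by positivity
  have cs2 := cs.trans (mul_le_mul (wT_sq γ₁ h1 h1' N hN) (wT_sq γ₂ h2 h2' N hN) s0 (by positivity))
  have cs3 : ∫ α in (0:ℝ)..1, ‖FF (wT γ₁) N α‖ * ‖FF (wT γ₂) N α‖ ≤ 8 * (N:ℝ) ^ (((1 + (1 - γ₁)) + (1 + (1 - γ₂))) / 2) := by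
    refine le_of_pow_le_pow_left₀ (n := 2) (by norm_num) (by positivity) (cs2.trans (le_of_eq ?_))
    rw [mul_pow, ← Real.rpow_natCast (_ ^ _) 2, ← Real.rpow_mul hN0.le,
      show ((1 + (1 - γ₁)) + (1 + (1 - γ₂))) / 2 * ((2:ℕ):ℝ) = (1 + (1 - γ₁)) + (1 + (1 - γ₂)) by push_cast; ring, Real.rpow_add hN0 (1 + (1 - γ₁)) (1 + (1 - γ₂))]
    ring
  refine i1.trans ((mul_le_mul_of_nonneg_left cs3 (by positivity)).trans (le_of_eq ?_))
  rw [show (4/3 - (2 * δ - 3 * ((1 - γ₁) + (1 - γ₂))) / 6) = (1 - δ) / 3 + ((1 + (1 - γ₁)) + (1 + (1 - γ₂))) / 2 by ring, Real.rpow_add hN0]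
  ring

lemma log_save (η B : ℝ) (hη : 0 < η) : ∃ N₀ : ℕ, ∀ N : ℕ, N₀ ≤ N →
    (N:ℝ) ^ (4/3 - η) ≤ (N:ℝ) ^ ((4:ℝ)/3) * (Real.log N) ^ (-B) := by
  have h := (isLittleO_log_rpow_rpow_atTop B hη).bound (c := 1) one_pos
  have h' := (tendsto_natCast_atTop_atTop (R := ℝ)).eventually h
  obtain ⟨N₀, hN₀⟩ := Filter.eventually_atTop.1 h'
  refine ⟨max N₀ 3, fun N hN => ?_⟩
  have hh := hN₀ N ((le_max_left _ _).trans hN)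
  have hN3 : (3:ℝ) ≤ N := by exact_mod_cast (le_max_right _ _).trans hN
  have hN0 : (0:ℝ) < N := by linarith
  have hl : 0 < Real.log N := Real.log_pos (by linarith)
  rw [one_mul, Real.norm_of_nonneg (by positivity), Real.norm_of_nonneg (by positivity)] at hh
  rw [sub_eq_add_neg, Real.rpow_add hN0, Real.rpow_neg hN0.le, Real.rpow_neg hl.le]
  refine mul_le_mul_of_nonneg_left ?_ (by positivity)
  exact inv_anti₀ (by positivity) hh

theorem integral_asymptotic (γ₁ γ₂ γ₃ δ₁ δ₃ : ℝ)
    (hγ₁ : 0 < γ₁) (hγ₁' : γ₁ ≤ 1) (hγ₂ : 0 < γ₂) (hγ₂' : γ₂ ≤ 1)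
    (hγ₃ : 0 < γ₃) (hγ₃' : γ₃ ≤ 1)
    (hδ₁ : 0 < δ₁) (hδ₁' : δ₁ < 1) (hδ₃ : 0 < δ₃) (hδ₃' : δ₃ < 1)
    (h1 : (γ₁ + γ₂) / 2 + δ₁ / 40 > 1)
    (h2 : (γ₁ + γ₂) / 2 + δ₃ / 3 > 1)
    (h3 : 73 * (1 - γ₁) + 86 * δ₁ < 9)
    (h4 : 73 * (1 - γ₂) + 86 * δ₁ < 9)
    (h5 : 1714 * (1 - γ₃) + 1725 * δ₃ < 46) :
    ∀ B : ℝ, 0 < B → ∃ C > (0 : ℝ), ∃ N₀ : ℕ, ∀ N : ℕ, N₀ ≤ N →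
      ‖(∫ α in (0:ℝ)..1, T₁ γ₁ N α * T₁ γ₂ N α * T₃ γ₃ N α * eexp (-(N : ℝ) * α)) -
        ∫ α in (0:ℝ)..1, (S₁ N α) ^ 2 * S₃ N α * eexp (-(N : ℝ) * α)‖ ≤
      C * (N : ℝ) ^ ((4 : ℝ) / 3) * (Real.log N) ^ (-B) := by
  intro B hB
  have g1 : 97/100 ≤ γ₁ := by linarith
  have g2 : 97/100 ≤ γ₂ := by linarith
  have g3 : 97/100 ≤ γ₃ := by linarith
  obtain ⟨C1, hC1, η1, hη1, t1⟩ := term2 γ₁ γ₂ γ₃ δ₃ g1 hγ₁' g2 hγ₂' g3 hγ₃' (by linarith) (by linarith)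
  obtain ⟨C2, hC2, η2, hη2, t2⟩ := term8 γ₁ g1 hγ₁' (wT γ₂) (1 - γ₂) (fun N hN => wT_sq γ₂ g2 hγ₂' N hN)
    (δ₁ / 10) (by linarith) (by linarith)
  obtain ⟨C3, hC3, η3, hη3, t3⟩ := term8 γ₂ g2 hγ₂' wS 0 (fun N hN => by
      have := wS_sq N hN
      rw [add_zero, Real.rpow_one]
      have h0 : (0:ℝ) ≤ N := by positivity
      linarith)
    (δ₁ / 10) (by linarith) (by linarith)
  obtain ⟨N1, l1⟩ := log_save η1 B hη1
  obtain ⟨N2, l2⟩ := log_save η2 B hη2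
  obtain ⟨N3, l3⟩ := log_save η3 B hη3
  refine ⟨C1 + C2 + C3, by linarith, N1 + N2 + N3 + 1, fun N hN => ?_⟩
  have hN1 : 1 ≤ N := by omega
  have cT1 := FF_cont (wT γ₁) N
  have cT2 := FF_cont (wT γ₂) N
  have cS := FF_cont wS N
  have cD1 := FF_cont (fun p => wT γ₁ p - wS p) N
  have cD2 := FF_cont (fun p => wT γ₂ p - wS p) N
  have cT3 := T₃_cont γ₃ N
  have cS3 := S₃_cont N
  have ce : Continuous fun α : ℝ => eexp (-(N : ℝ) * α) := eexp_cont.comp (by fun_prop)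
  simp_rw [T₁_eq, S₁_eq]
  have i1 : IntervalIntegrable (fun α => FF (wT γ₁) N α * FF (wT γ₂) N α * T₃ γ₃ N α * eexp (-(N : ℝ) * α)) MeasureTheory.volume 0 1 :=
    (((cT1.mul cT2).mul cT3).mul ce).intervalIntegrable _ _
  have i2 : IntervalIntegrable (fun α => FF wS N α ^ 2 * S₃ N α * eexp (-(N : ℝ) * α)) MeasureTheory.volume 0 1 :=
    (((cS.pow 2).mul cS3).mul ce).intervalIntegrable _ _
  rw [← intervalIntegral.integral_sub i1 i2]
  have b0 : ‖∫ α in (0:ℝ)..1, (FF (wT γ₁) N α * FF (wT γ₂) N α * T₃ γ₃ N α * eexp (-(N : ℝ) * α) - FF wS N α ^ 2 * S₃ N α * eexp (-(N : ℝ) * α))‖ ≤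
      ∫ α in (0:ℝ)..1, (‖FF (wT γ₁) N α‖ * ‖FF (wT γ₂) N α‖ * ‖T₃ γ₃ N α - S₃ N α‖ +
        ‖FF (wT γ₂) N α‖ * (‖FF (fun p => wT γ₁ p - wS p) N α‖ * ‖S₃ N α‖) +
        ‖FF wS N α‖ * (‖FF (fun p => wT γ₂ p - wS p) N α‖ * ‖S₃ N α‖)) := by
    refine intervalIntegral.norm_integral_le_of_norm_le zero_le_one (MeasureTheory.ae_of_all _ fun α _ => ?_)
      (Continuous.intervalIntegrable ?_ _ _)
    · have e : FF (wT γ₁) N α * FF (wT γ₂) N α * T₃ γ₃ N α * eexp (-(N : ℝ) * α) - FF wS N α ^ 2 * S₃ N α * eexp (-(N : ℝ) * α)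
        = (FF (wT γ₁) N α * FF (wT γ₂) N α * (T₃ γ₃ N α - S₃ N α) +
          FF (wT γ₂) N α * (FF (fun p => wT γ₁ p - wS p) N α * S₃ N α) +
          FF wS N α * (FF (fun p => wT γ₂ p - wS p) N α * S₃ N α)) * eexp (-(N : ℝ) * α) := by
        rw [← FF_sub, ← FF_sub]; ring
      rw [e, norm_mul, norm_eexp, mul_one]
      refine (norm_add₃_le).trans (le_of_eq ?_)
      simp only [norm_mul]
    · exact ((((cT1.norm.mul cT2.norm).mul (cT3.sub cS3).norm).add (cT2.norm.mul (cD1.norm.mul cS3.norm))).add (cS.norm.mul (cD2.norm.mul cS3.norm)))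
  rw [intervalIntegral.integral_add, intervalIntegral.integral_add] at b0
  · refine b0.trans ((add_le_add (add_le_add (t1 N hN1) (t2 N hN1)) (t3 N hN1)).trans ?_)
    have m1 := mul_le_mul_of_nonneg_left (l1 N (by omega)) (show 0 ≤ C1 by linarith)
    have m2 := mul_le_mul_of_nonneg_left (l2 N (by omega)) (show 0 ≤ C2 by linarith)
    have m3 := mul_le_mul_of_nonneg_left (l3 N (by omega)) (show 0 ≤ C3 by linarith)
    refine (add_le_add (add_le_add m1 m2) m3).trans (le_of_eq ?_)
    ring
  · exact ((cT1.norm.mul cT2.norm).mul (cT3.sub cS3).norm).intervalIntegrable _ _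
  · exact (cT2.norm.mul (cD1.norm.mul cS3.norm)).intervalIntegrable _ _
  · exact (((cT1.norm.mul cT2.norm).mul (cT3.sub cS3).norm).add (cT2.norm.mul (cD1.norm.mul cS3.norm))).intervalIntegrable _ _
  · exact (cS.norm.mul (cD2.norm.mul cS3.norm)).intervalIntegrable _ _
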